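/- Let q ≥ 0, 1 ≤ t ≤ 2^q and k ≥ 2 be integers, let m = 2^{q+1} − t and d = 2^q·(k+1) − t. Then for any m masses μ_1, …, μ_m on ℝ^d there exist k pairwise orthogonal hyperplanes H_1, …, H_k in ℝ^d such that any 2 of the k hyperplanes equipartition each μ_i (each of the four regions determined by any two of the hyperplanes carries exactly a quarter of each mass). -/

import Mathlib

open MeasureTheory RealInnerProductSpace

noncomputable section

/-- The closed half-space determined by the hyperplane `{x | ⟪a, x⟫ = b}`:
`true` corresponds to `H⁺ = {x | ⟪a, x⟫ ≥ b}`, `false` to `H⁻ = {x | ⟪a, x⟫ ≤ b}`. -/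
def halfSpace {d : ℕ} (a : EuclideanSpace ℝ (Fin d)) (b : ℝ) (ε : Bool) :
    Set (EuclideanSpace ℝ (Fin d)) :=
  if ε then {x | b ≤ ⟪a, x⟫} else {x | ⟪a, x⟫ ≤ b}

/-- The region `⋂ i ∈ s, H i ^ (ε i)` determined by the hyperplanes indexed by `s`. -/
def region {d k : ℕ} (a : Fin k → EuclideanSpace ℝ (Fin d)) (b : Fin k → ℝ)
    (s : Finset (Fin k)) (ε : Fin k → Bool) : Set (EuclideanSpace ℝ (Fin d)) :=
  ⋂ i ∈ s, halfSpace (a i) (b i) (ε i)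

section

/-- `0` lies in the convex hull of the family `w` with index `i` removed. -/
def InH {J V : Type*} [Fintype J] [AddCommGroup V] [Module ℝ V] (w : J → V) (i : J) : Prop :=
  ∃ l : J → ℝ, (∀ j, 0 ≤ l j) ∧ l i = 0 ∧ l ≠ 0 ∧ ∑ j, l j • w j = 0

theorem exists_rel {J V : Type*} [Fintype J] [DecidableEq J] [AddCommGroup V] [Module ℝ V]
    [FiniteDimensional ℝ V] (w : J → V)
    (hc : Fintype.card J = Module.finrank ℝ V + 2)
    (hg : ∀ l : J → ℝ, ∑ j, l j • w j = 0 → ∀ i j, i ≠ j → l i = 0 → l j = 0 → l = 0) (i0 : J) :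
    ∃ m : J → ℝ, m i0 = 1 ∧ ∑ j, m j • w j = 0 := by
  classical
  let T : (J → ℝ) →ₗ[ℝ] V := Fintype.linearCombination ℝ w
  have hT : ∀ l, T l = ∑ j, l j • w j := fun l => rfl
  have hdim : 2 ≤ Module.finrank ℝ (LinearMap.ker T) := by
    have h1 := LinearMap.finrank_range_add_finrank_ker T
    have h2 := Submodule.finrank_le (LinearMap.range T)
    rw [Module.finrank_fintype_fun_eq_card] at h1
    omega
  by_contra hno
  push Not at hno
  have hz : ∀ l, T l = 0 → l i0 = 0 := by
    intro l hl
    by_contra h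
    apply hno (fun j => (l i0)⁻¹ * l j) (by field_simp)
    have : ∑ j, ((l i0)⁻¹ * l j) • w j = (l i0)⁻¹ • ∑ j, l j • w j := by
      rw [Finset.smul_sum]; simp [mul_smul]
    rw [this, ← hT, hl, smul_zero]
  have : ∃ j, j ≠ i0 := by
    by_contra h
    push Not at h
    have : Fintype.card J ≤ 1 := Fintype.card_le_one_iff.2 (fun a b => by rw [h a, h b])
    omega
  obtain ⟨j, hj⟩ := this
  have hinj : Function.Injective ((LinearMap.proj j : (J → ℝ) →ₗ[ℝ] ℝ).comp (LinearMap.ker T).subtype) := by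
    rw [injective_iff_map_eq_zero]
    rintro ⟨l, hl⟩ h
    have := hg l hl j i0 hj h (hz l hl)
    exact Subtype.ext this
  have := LinearMap.finrank_le_finrank_of_injective hinj
  simp at this
  omega

theorem even_InH {J V : Type*} [Fintype J] [DecidableEq J] [AddCommGroup V] [Module ℝ V]
    [FiniteDimensional ℝ V] (w : J → V)
    (hc : Fintype.card J = Module.finrank ℝ V + 2)
    (hg : ∀ l : J → ℝ, ∑ j, l j • w j = 0 → ∀ i j, i ≠ j → l i = 0 → l j = 0 → l = 0)
    [DecidablePred (InH w)] :
    ∑ i, (if InH w i then (1 : ZMod 2) else 0) = 0 := by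
  classical
  by_cases hex : ∃ i, InH w i
  swap
  · push Not at hex
    simp [hex]
  obtain ⟨i0, l, hl0, hli, hlne, hl⟩ := hex
  have hpos : ∀ j, j ≠ i0 → 0 < l j := fun j hj =>
    lt_of_le_of_ne (hl0 j) fun h => hlne (hg l hl j i0 hj h.symm hli)
  obtain ⟨m, hm1, hm⟩ := exists_rel w hc hg i0
  have hne : (Finset.univ.erase i0).Nonempty := by
    rw [← Finset.card_pos, Finset.card_erase_of_mem (Finset.mem_univ _), Finset.card_univ]
    omega
  obtain ⟨j, hj, hmax⟩ := Finset.exists_max_image (Finset.univ.erase i0) (fun j => - m j / l j) hne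
  have hji : j ≠ i0 := Finset.ne_of_mem_erase hj
  have hInj : InH w j := by
    refine ⟨fun i => m i + (- m j / l j) * l i, ?_, ?_, ?_, ?_⟩
    · intro i
      by_cases hi : i = i0
      · simp [hi, hm1, hli]
      · have h1 := hmax i (Finset.mem_erase.2 ⟨hi, Finset.mem_univ _⟩)
        have h2 := mul_le_mul_of_nonneg_right h1 (hpos i hi).le
        rw [div_mul_cancel₀ _ (hpos i hi).ne'] at h2
        simp only at h2 ⊢
        linarith
    · have := (hpos j hji).ne'
      field_simp
      ring
    · intro h
      have := congrFun h i0
      simp [hm1, hli] at this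
    · simp only [add_smul, Finset.sum_add_distrib, hm, mul_smul, ← Finset.smul_sum, hl]
      simp
  have huniq : ∀ i, InH w i → i = i0 ∨ i = j := by
    rintro i ⟨n, hn0, hni, hnne, hn⟩
    by_contra hcon
    push Not at hcon
    obtain ⟨hi0, hij⟩ := hcon
    have hnp : ∀ a, a ≠ i → 0 < n a := fun a ha =>
      lt_of_le_of_ne (hn0 a) fun h => hnne (hg n hn a i ha h.symm hni)
    have hni0 := hnp i0 hi0.symm
    have hli' := hpos i hi0
    have hlj := hpos j hji
    -- n / n i0 - m + (m i / l i) • l = 0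
    have hz : (fun a => n a / n i0 - m a + m i / l i * l a) = 0 := by
      apply hg _ _ i i0 hi0
      · simp only [hni]; field_simp; ring
      · simp only [hm1, hli]; field_simp; ring
      · have : ∀ a, (n a / n i0 - m a + m i / l i * l a) • w a =
          (n i0)⁻¹ • (n a • w a) - m a • w a + (m i / l i) • (l a • w a) := by
          intro a
          rw [smul_smul, smul_smul, ← sub_smul, ← add_smul]; congr 1; ring
        simp only [this, Finset.sum_add_distrib, Finset.sum_sub_distrib, ← Finset.smul_sum, hn, hm, hl]
        simp
    have h1 := congrFun hz j
    simp only [Pi.zero_apply] at h1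
    have h2 := hmax i (Finset.mem_erase.2 ⟨hi0, Finset.mem_univ _⟩)
    have h3 : 0 < n j / n i0 := div_pos (hnp j (Ne.symm hij)) hni0
    have h4 := mul_le_mul_of_nonneg_right h2 hlj.le
    simp only [neg_div, neg_mul] at h4
    rw [div_mul_cancel₀ _ hlj.ne'] at h4
    linarith
  have hIn0 : InH w i0 := ⟨l, hl0, hli, hlne, hl⟩
  rw [Finset.sum_ite, Finset.sum_const_zero, add_zero, Finset.sum_const]
  have : Finset.univ.filter (fun i => InH w i) = {i0, j} := by
    ext i
    simp only [Finset.mem_filter, Finset.mem_univ, true_and, Finset.mem_insert, Finset.mem_singleton]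
    constructor
    · exact huniq i
    · rintro (rfl | rfl) <;> assumption
  rw [this, Finset.card_pair hji.symm]
  decide

end

section

/-- `0` lies in the convex hull of the family `w`. -/
def InHull {J V : Type*} [Fintype J] [AddCommGroup V] [Module ℝ V] (w : J → V) : Prop :=
  ∃ l : J → ℝ, (∀ j, 0 ≤ l j) ∧ l ≠ 0 ∧ ∑ j, l j • w j = 0

theorem push_sum {J K V : Type*} [Fintype J] [Fintype K] [AddCommGroup V] [Module ℝ V]
    (e : J → K) (he : Function.Injective e) (w : K → V) (l : J → ℝ) :
    ∑ x, (Function.extend e l 0) x • w x = ∑ j, l j • w (e j) := by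
  symm
  apply Fintype.sum_of_injective e he
  · intro i hi
    rw [Function.extend_apply' _ _ _ (by simpa using hi)]; simp
  · intro i; rw [he.extend_apply]

theorem InHull.push {J K V : Type*} [Fintype J] [Fintype K] [AddCommGroup V] [Module ℝ V]
    (e : J → K) (he : Function.Injective e) (w : K → V) (h : InHull (w ∘ e)) : InHull w := by
  classical
  obtain ⟨l, h0, hne, hs⟩ := h
  refine ⟨Function.extend e l 0, ?_, ?_, ?_⟩
  · intro x
    by_cases hx : ∃ j, e j = x
    · obtain ⟨j, rfl⟩ := hx; rw [he.extend_apply]; exact h0 j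
    · rw [Function.extend_apply' _ _ _ hx]; simp
  · intro h
    apply hne
    funext j
    have := congrFun h (e j)
    rwa [he.extend_apply] at this
  · rw [push_sum e he]; exact hs

theorem InH.inHull {J V : Type*} [Fintype J] [AddCommGroup V] [Module ℝ V] {w : J → V} {i : J}
    (h : InH w i) : InHull w := by
  obtain ⟨l, h0, _, hne, hs⟩ := h
  exact ⟨l, h0, hne, hs⟩

theorem InH.congr {J V : Type*} [Fintype J] [AddCommGroup V] [Module ℝ V] {w w' : J → V} {i : J}
    (h : InH w i) (hw : ∀ j, j ≠ i → w' j = w j) : InH w' i := by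
  obtain ⟨l, h0, hi, hne, hs⟩ := h
  refine ⟨l, h0, hi, hne, ?_⟩
  rw [← hs]
  apply Finset.sum_congr rfl
  intro j _
  by_cases hj : j = i
  · rw [hj, hi]; simp
  · rw [hw j hj]

theorem InH.map {J V : Type*} [Fintype J] [AddCommGroup V] [Module ℝ V] {w w' : J → V} {i : J}
    (h : InH w i) (T : V →ₗ[ℝ] V) (hw : ∀ j, w' j = T (w j)) : InH w' i := by
  obtain ⟨l, h0, hi, hne, hs⟩ := h
  refine ⟨l, h0, hi, hne, ?_⟩
  simp only [hw, ← map_smul, ← map_sum, hs, map_zero]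

theorem InHull.map {J V : Type*} [Fintype J] [AddCommGroup V] [Module ℝ V] {w w' : J → V}
    (h : InHull w) (T : V →ₗ[ℝ] V) (hw : ∀ j, w' j = T (w j)) : InHull w' := by
  obtain ⟨l, h0, hne, hs⟩ := h
  refine ⟨l, h0, hne, ?_⟩
  simp only [hw, ← map_smul, ← map_sum, hs, map_zero]

theorem InH_iff_InHull {J V : Type*} [Fintype J] [Fintype K] [AddCommGroup V] [Module ℝ V]
    (e : K → J) (he : Function.Injective e) (i : J) (hi : ∀ j, j ∈ Set.range e ↔ j ≠ i) (w : J → V) :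
    InH w i ↔ InHull (w ∘ e) := by
  constructor
  · rintro ⟨l, h0, hli, hne, hs⟩
    refine ⟨l ∘ e, fun j => h0 _, ?_, ?_⟩
    · intro h
      apply hne
      funext j
      by_cases hj : j = i
      · rw [hj, hli]; rfl
      · obtain ⟨x, rfl⟩ := (hi j).2 hj
        exact congrFun h x
    · rw [← hs]
      apply Fintype.sum_of_injective e he
      · intro j hj
        have : j = i := by
          by_contra h; exact hj ((hi j).2 h)
        rw [this, hli, zero_smul]
      · intro x; rfl
  · rintro ⟨l, h0, hne, hs⟩
    refine ⟨Function.extend e l 0, ?_, ?_, ?_, ?_⟩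
    · intro x
      by_cases hx : ∃ j, e j = x
      · obtain ⟨j, rfl⟩ := hx; rw [he.extend_apply]; exact h0 j
      · rw [Function.extend_apply' _ _ _ hx]; simp
    · rw [Function.extend_apply']
      · rfl
      · intro h; exact (hi i).1 h rfl
    · intro h
      apply hne
      funext j
      have := congrFun h (e j)
      rwa [he.extend_apply] at this
    · rw [push_sum e he]; exact hs

/-- A coloured chamber system with a group action. -/
structure Chamb (N : ℕ) (G S P : Type) [Group G] [MulAction G S] [MulAction G P] where
  vert : S → Fin (N + 1) → P
  th : Fin (N + 1) → S → S
  color : P → ℕ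
  th_ne : ∀ j σ, th j σ ≠ σ
  th_invol : ∀ j σ, th j (th j σ) = σ
  th_smul : ∀ j (g : G) σ, th j (g • σ) = g • th j σ
  vert_th : ∀ j σ i, i ≠ j → vert (th j σ) i = vert σ i
  vert_smul : ∀ (g : G) σ j, vert (g • σ) j = g • vert σ j
  color_vert : ∀ σ j, color (vert σ j) = (j : ℕ)
  color_smul : ∀ (g : G) p, color (g • p) = color p

/-- All `2(N+1)` vectors attached to a chamber. -/
def famAll {N : ℕ} {G S P V : Type} [Group G] [MulAction G S] [MulAction G P]
    (C : Chamb N G S P) (v0 v1 : P → V) (σ : S) : Fin (N + 1) × Bool → V :=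
  fun p => if p.2 then v1 (C.vert σ p.1) else v0 (C.vert σ p.1)

def hyb {P V : Type} (color : P → ℕ) (v0 v1 : P → V) (j : ℕ) (p : P) : V :=
  if color p < j then v1 p else v0 p

set_option linter.unusedSectionVars false
section
variable {N : ℕ} {G S P V : Type} [Group G] [MulAction G S] [MulAction G P]
  [AddCommGroup V] [Module ℝ V]

/-- parity count -/
def Tcount (C : Chamb N G S P) [Fintype S] (v : P → V) : ZMod 2 :=
  open Classical in
  ∑ q : Quotient (MulAction.orbitRel G S),
    if InHull (fun j => v (C.vert q.out j)) then (1 : ZMod 2) else 0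

def famOpt (C : Chamb N G S P) (v0 v1 : P → V) (j : Fin (N + 1)) (σ : S) : Option (Fin (N + 1)) → V
  | none => v1 (C.vert σ j)
  | some l => hyb C.color v0 v1 j (C.vert σ l)

def optEmb (j : Fin (N + 1)) : Option (Fin (N + 1)) → Fin (N + 1) × Bool
  | none => (j, true)
  | some l => (l, decide (l < j))

theorem optEmb_inj (j : Fin (N + 1)) : Function.Injective (optEmb j) := by
  intro a b h
  cases a <;> cases b <;> simp [optEmb] at h ⊢
  · obtain ⟨h1, h2⟩ := h; omega
  · obtain ⟨h1, h2⟩ := h; omega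
  · exact h.1

theorem famOpt_eq (C : Chamb N G S P) (v0 v1 : P → V) (j : Fin (N + 1)) (σ : S) :
    famOpt C v0 v1 j σ = famAll C v0 v1 σ ∘ optEmb j := by
  funext a
  cases a with
  | none => simp [famOpt, optEmb, famAll]
  | some l => simp [famOpt, optEmb, famAll, hyb, C.color_vert]

theorem parity_step [FiniteDimensional ℝ V] [Fintype S] (C : Chamb N G S P) (hV : Module.finrank ℝ V = N)
    (hN : 1 ≤ N) (ρ : G →* (V →ₗ[ℝ] V)) (v0 v1 : P → V)
    (e0 : ∀ (g : G) p, v0 (g • p) = ρ g (v0 p)) (e1 : ∀ (g : G) p, v1 (g • p) = ρ g (v1 p))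
    (hgood : ∀ σ, ¬ InHull (famAll C v0 v1 σ) ∨
      ((∀ j (g : G), g • C.vert σ j = C.vert σ j → g = 1) ∧
        ∀ l : Fin (N + 1) × Bool → ℝ, (∃ s : Finset (Fin (N + 1) × Bool), s.card ≤ N ∧
          ∀ x ∉ s, l x = 0) →
          ∑ x, l x • famAll C v0 v1 σ x = 0 → l = 0)) (j : Fin (N + 1)) :
    Tcount C (hyb C.color v0 v1 j) = Tcount C (hyb C.color v0 v1 (j + 1)) := by
  classical
  let Q := Quotient (MulAction.orbitRel G S)
  -- the mixed counts
  let F : Q → Option (Fin (N + 1)) → ZMod 2 := fun q i =>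
    if InH (famOpt C v0 v1 j q.out) i then 1 else 0
  have hfam : ∀ (g : G) σ i, famOpt C v0 v1 j (g • σ) i = ρ g (famOpt C v0 v1 j σ i) := by
    intro g σ i
    cases i with
    | none => simp [famOpt, C.vert_smul, e1]
    | some l =>
      simp only [famOpt, C.vert_smul, hyb, C.color_smul, e1, e0]
      split_ifs <;> rfl
  have hinv : ∀ (g : G) σ i, InH (famOpt C v0 v1 j (g • σ)) i ↔ InH (famOpt C v0 v1 j σ) i := by
    intro g σ i
    constructor
    · intro h
      apply h.map (ρ g⁻¹)
      intro a
      rw [← hfam, inv_smul_smul]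
    · intro h
      exact h.map (ρ g) (hfam g σ)
  have hF : ∀ σ i, F ⟦σ⟧ i = if InH (famOpt C v0 v1 j σ) i then 1 else 0 := by
    intro σ i
    obtain ⟨g, hg⟩ : ∃ g : G, g • σ = (⟦σ⟧ : Q).out := by
      have : (MulAction.orbitRel G S).r (⟦σ⟧ : Q).out σ := Quotient.mk_out σ
      exact this
    simp only [F]
    rw [← hg]
    simp only [hinv]
  have hrow : ∀ q, ∑ i, F q i = 0 := by
    intro q
    rcases hgood q.out with h | ⟨hfree, hgen⟩
    · apply Finset.sum_eq_zero
      intro i _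
      simp only [F]
      rw [if_neg]
      intro h'
      apply h
      have := h'.inHull
      rw [famOpt_eq] at this
      exact this.push _ (optEmb_inj j)
    · apply even_InH
      · simp [hV]
      · intro l hl a b hab ha hb
        have h1 := hgen (Function.extend (optEmb j) l 0) ?_ ?_
        · funext x
          have := congrFun h1 (optEmb j x)
          rwa [(optEmb_inj j).extend_apply] at this
        · refine ⟨((Finset.univ.erase a).erase b).image (optEmb j), ?_, ?_⟩
          · apply Finset.card_image_le.trans
            rw [Finset.card_erase_of_mem, Finset.card_erase_of_mem (Finset.mem_univ _)]
            · simp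
            · simp [hab.symm]
          · intro x hx
            by_cases hx' : ∃ y, optEmb j y = x
            · obtain ⟨y, rfl⟩ := hx'
              rw [(optEmb_inj j).extend_apply]
              by_contra hy
              apply hx
              apply Finset.mem_image_of_mem
              simp only [Finset.mem_erase, Finset.mem_univ, and_true]
              constructor <;> (rintro rfl; contradiction)
            · rw [Function.extend_apply' _ _ _ hx']; rfl
        · rw [push_sum _ (optEmb_inj j)]
          rw [famOpt_eq] at hl
          exact hl
  have hcol : ∀ i : Fin (N + 1), i ≠ j → ∑ q, F q (some i) = 0 := by
    intro i hij
    have hth : ∀ σ, InH (famOpt C v0 v1 j σ) (some i) ↔ InH (famOpt C v0 v1 j (C.th i σ)) (some i) := by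
      have key : ∀ σ, ∀ a, a ≠ some i → famOpt C v0 v1 j (C.th i σ) a = famOpt C v0 v1 j σ a := by
        intro σ a ha
        cases a with
        | none => simp only [famOpt]; rw [C.vert_th i σ j hij.symm]
        | some l => simp only [famOpt]; rw [C.vert_th i σ l (by rintro rfl; exact ha rfl)]
      intro σ
      exact ⟨fun h => h.congr (key σ), fun h => h.congr (fun a ha => (key σ a ha).symm)⟩
    let thq : Q → Q := Quotient.map (C.th i) (by
      rintro a b ⟨g, hg⟩
      exact ⟨g, by simp only at hg ⊢; rw [← C.th_smul, hg]⟩)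
    have hthq : ∀ σ, thq ⟦σ⟧ = ⟦C.th i σ⟧ := fun σ => rfl
    apply Finset.sum_involution (fun q _ => thq q)
    · intro q _
      induction q using Quotient.inductionOn with
      | h σ =>
        rw [hthq, hF, hF]
        simp only [← hth]
        split_ifs <;> decide
    · intro q _
      induction q using Quotient.inductionOn with
      | h σ =>
        rw [hF, hthq]
        intro hne heq
        have hin : InH (famOpt C v0 v1 j σ) (some i) := by
          by_contra h; simp [h] at hne
        rcases hgood σ with h | ⟨hfree, -⟩
        · apply h
          have := hin.inHull
          rw [famOpt_eq] at this
          exact this.push _ (optEmb_inj j)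
        · obtain ⟨g, hg⟩ : ∃ g : G, g • σ = C.th i σ := Quotient.exact heq
          have h1 : g • C.vert σ j = C.vert σ j := by
            rw [← C.vert_smul, hg, C.vert_th i σ j hij.symm]
          have := hfree j g h1
          rw [this, one_smul] at hg
          exact C.th_ne i σ hg.symm
    · intro q _; exact Finset.mem_univ _
    · intro q _
      induction q using Quotient.inductionOn with
      | h σ => rw [hthq, hthq, C.th_invol]
  have htot : ∑ i, ∑ q, F q i = 0 := by
    rw [Finset.sum_comm]
    exact Finset.sum_eq_zero fun q _ => hrow q
  rw [Fintype.sum_option, Finset.sum_eq_single j (fun i _ hij => hcol i hij) (by simp)] at htot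
  have h1 : Tcount C (hyb C.color v0 v1 j) = ∑ q, F q none := by
    apply Finset.sum_congr rfl
    intro q _
    simp only [F]
    congr 1
    rw [InH_iff_InHull (fun a : Fin (N + 1) => some a) (Option.some_injective _) none]
    · rfl
    · intro a; cases a <;> simp
  have h2 : Tcount C (hyb C.color v0 v1 (j + 1)) = ∑ q, F q (some j) := by
    apply Finset.sum_congr rfl
    intro q _
    simp only [F]
    congr 1
    rw [InH_iff_InHull (fun a : Fin (N + 1) => if a = j then none else some a) ?_ (some j)]
    · congr! 2 with a
      simp only [Function.comp]
      split_ifs with h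
      · subst h; simp [famOpt, hyb, C.color_vert]
      · simp only [famOpt, hyb, C.color_vert]
        have : (a : ℕ) ≠ j := fun h' => h (Fin.ext h')
        congr 1
        simp only [eq_iff_iff]; omega
    · intro a
      cases a with
      | none => simp
      | some a =>
        simp only [Set.mem_range, ne_eq, Option.some.injEq]
        constructor
        · rintro ⟨y, hy⟩
          split_ifs at hy with h
          rw [← Option.some.inj hy]; exact h
        · intro h; exact ⟨a, by simp [h]⟩
    · intro a b hab
      simp only at hab
      split_ifs at hab <;> simp_all
  rw [h1, h2]
  have : ∀ a b : ZMod 2, a + b = 0 → a = b := by decide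
  exact this _ _ htot

theorem parity_thm [FiniteDimensional ℝ V] [Fintype S] (C : Chamb N G S P) (hV : Module.finrank ℝ V = N)
    (hN : 1 ≤ N) (ρ : G →* (V →ₗ[ℝ] V)) (v0 v1 : P → V)
    (e0 : ∀ (g : G) p, v0 (g • p) = ρ g (v0 p)) (e1 : ∀ (g : G) p, v1 (g • p) = ρ g (v1 p))
    (hgood : ∀ σ, ¬ InHull (famAll C v0 v1 σ) ∨
      ((∀ j (g : G), g • C.vert σ j = C.vert σ j → g = 1) ∧
        ∀ l : Fin (N + 1) × Bool → ℝ, (∃ s : Finset (Fin (N + 1) × Bool), s.card ≤ N ∧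
          ∀ x ∉ s, l x = 0) →
          ∑ x, l x • famAll C v0 v1 σ x = 0 → l = 0)) :
    Tcount C v0 = Tcount C v1 := by
  have h : ∀ j ≤ N + 1, Tcount C (hyb C.color v0 v1 0) = Tcount C (hyb C.color v0 v1 j) := by
    intro j
    induction j with
    | zero => intro _; rfl
    | succ j ih =>
      intro hj
      rw [ih (by omega)]
      exact parity_step C hV hN ρ v0 v1 e0 e1 hgood ⟨j, by omega⟩
  have h0 : Tcount C (hyb C.color v0 v1 0) = Tcount C v0 := by
    congr 1
  have h1 : Tcount C (hyb C.color v0 v1 (N + 1)) = Tcount C v1 := by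
    unfold Tcount
    congr! 3 with q
    funext j
    simp only [hyb, C.color_vert]
    rw [if_pos j.2]
  rw [← h0, ← h1]
  exact h _ le_rfl

end

end

section

theorem avoid_submodules {V ι : Type*} [NormedAddCommGroup V] [NormedSpace ℝ V] [FiniteDimensional ℝ V]
    [Finite ι] (W : ι → Submodule ℝ V) (hW : ∀ i, W i ≠ ⊤) (p : V) (ε : ℝ) (hε : 0 < ε) :
    ∃ u, dist u p < ε ∧ ∀ i, u ∉ W i := by
  have : CompleteSpace V := FiniteDimensional.complete ℝ V
  have hd : Dense (⋂ i, (W i : Set V)ᶜ) := by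
    apply dense_iInter_of_isOpen
    · intro i
      exact (Submodule.closed_of_finiteDimensional (W i)).isOpen_compl
    · intro i
      rw [← interior_eq_empty_iff_dense_compl]
      by_contra h
      exact hW i (Submodule.eq_top_of_nonempty_interior' _ (Set.nonempty_iff_ne_empty.2 h))
  obtain ⟨u, hu, hu'⟩ := Metric.dense_iff.1 hd p ε hε
  refine ⟨u, hu, fun i => ?_⟩
  exact Set.mem_iInter.1 hu' i

theorem gen_pos {J V G : Type*} [Fintype J] [Group G] [Finite G] [NormedAddCommGroup V] [NormedSpace ℝ V]
    [FiniteDimensional ℝ V] (ρ : G →* (V →ₗ[ℝ] V)) (N : ℕ) (hN : Module.finrank ℝ V = N)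
    (p : J → V) (ε : ℝ) (hε : 0 < ε) :
    ∃ u : J → V, (∀ j, dist (u j) (p j) < ε) ∧ ∀ (g : J → G) (l : J → ℝ),
      (∃ s : Finset J, s.card ≤ N ∧ ∀ x ∉ s, l x = 0) → ∑ j, l j • ρ (g j) (u j) = 0 → l = 0 := by
  classical
  suffices H : ∀ T : Finset J, ∃ u : J → V, (∀ j, dist (u j) (p j) < ε) ∧ ∀ (g : J → G) (l : J → ℝ),
      (∃ s : Finset J, s.card ≤ N ∧ s ⊆ T ∧ ∀ x ∉ s, l x = 0) → ∑ j, l j • ρ (g j) (u j) = 0 → l = 0 by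
    obtain ⟨u, h1, h2⟩ := H Finset.univ
    refine ⟨u, h1, fun g l ⟨s, hs, hl⟩ => h2 g l ⟨s, hs, Finset.subset_univ _, hl⟩⟩
  intro T
  induction T using Finset.induction_on with
  | empty =>
    refine ⟨p, by simp [hε], ?_⟩
    rintro g l ⟨s, -, hs, hl⟩ -
    funext x
    apply hl
    intro h; simpa using hs h
  | insert a T ha ih =>
    obtain ⟨u, hu1, hu2⟩ := ih
    let W : {s : Finset J // s.card < N} × (J → G) → Submodule ℝ V := fun x =>
      Submodule.span ℝ ((x.1.1.image (fun j => ρ (x.2 j) (u j)) : Finset V) : Set V)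
    have hW : ∀ i, W i ≠ ⊤ := by
      rintro ⟨⟨s, hs⟩, g⟩ h
      have h1 : Module.finrank ℝ (W ⟨⟨s, hs⟩, g⟩) ≤ s.card :=
        (finrank_span_finset_le_card _).trans Finset.card_image_le
      rw [h, finrank_top] at h1
      omega
    obtain ⟨z, hz1, hz2⟩ := avoid_submodules W hW (p a) ε hε
    refine ⟨Function.update u a z, ?_, ?_⟩
    · intro j
      by_cases hj : j = a
      · subst hj; simpa using hz1
      · rw [Function.update_of_ne hj]; exact hu1 j
    · rintro g l ⟨s, hsN, hsT, hl⟩ hsum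
      have hrest : ∑ j ∈ Finset.univ.erase a, l j • ρ (g j) (u j) + l a • ρ (g a) z = 0 := by
        rw [← hsum, ← Finset.sum_erase_add _ _ (Finset.mem_univ a)]
        simp only [Function.update_self]
        congr 1
        apply Finset.sum_congr rfl
        intro j hj
        rw [Function.update_of_ne (Finset.ne_of_mem_erase hj)]
      by_cases hla : l a = 0
      · apply hu2 g l
        · refine ⟨s.erase a, (Finset.card_erase_le).trans hsN, ?_, ?_⟩
          · intro x hx
            rw [Finset.mem_erase] at hx
            have := hsT hx.2
            rw [Finset.mem_insert] at this
            exact this.resolve_left hx.1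
          · intro x hx
            rw [Finset.mem_erase] at hx
            by_cases hxa : x = a
            · rw [hxa, hla]
            · exact hl x (fun h => hx ⟨hxa, h⟩)
        · rw [← Finset.sum_erase_add _ _ (Finset.mem_univ a), hla, zero_smul, add_zero]
          rw [hla, zero_smul, add_zero] at hrest
          exact hrest
      · exfalso
        have has : a ∈ s := by
          by_contra h; exact hla (hl a h)
        have hcard : (s.erase a).card < N := by
          rw [Finset.card_erase_of_mem has]
          have := Finset.card_pos.2 ⟨a, has⟩
          omega
        apply hz2 ⟨⟨s.erase a, hcard⟩, fun j => (g a)⁻¹ * g j⟩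
        have hz : z = ∑ j ∈ s.erase a, (-(l a)⁻¹ * l j) • ρ ((g a)⁻¹ * g j) (u j) := by
          have h3 : ρ (g a) z = ∑ j ∈ Finset.univ.erase a, (-(l a)⁻¹ * l j) • ρ (g j) (u j) := by
            simp only [mul_smul, ← Finset.smul_sum]
            rw [neg_smul, eq_neg_of_add_eq_zero_left hrest, smul_neg, neg_neg, smul_smul,
              inv_mul_cancel₀ hla, one_smul]
          have h4 : z = ρ (g a)⁻¹ (ρ (g a) z) := by
            rw [← Module.End.mul_apply, ← map_mul]; simp
          rw [h4, h3, map_sum]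
          symm
          apply Finset.sum_subset_zero_on_sdiff
          · exact Finset.erase_subset_erase _ (Finset.subset_univ _)
          · intro x hx
            simp only [Finset.mem_sdiff, Finset.mem_erase, Finset.mem_univ, and_true, not_and] at hx
            rw [hl x (hx.2 hx.1)]; simp
          · intro x _
            rw [map_smul, map_mul]; rfl
        rw [hz]
        apply Submodule.sum_mem
        intro j hj
        apply Submodule.smul_mem
        apply Submodule.subset_span
        simp only [Finset.coe_image]
        exact ⟨j, hj, rfl⟩

end

section

theorem not_inHull_open {J V : Type*} [Fintype J] [NormedAddCommGroup V] [NormedSpace ℝ V]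
    (w : J → V) (h : ¬ InHull w) : ∀ᶠ w' in nhds w, ¬ InHull w' := by
  have hcl : IsClosed {w : J → V | InHull w} := by
    have h1 : IsClosed {x : stdSimplex ℝ J × (J → V) | ∑ j, x.1.1 j • x.2 j = 0} := by
      apply isClosed_eq _ continuous_const
      apply continuous_finsetSum
      intro j _
      apply Continuous.smul
      · exact (continuous_apply j).comp (continuous_subtype_val.comp continuous_fst)
      · exact (continuous_apply j).comp continuous_snd
    have h2 := isClosedMap_snd_of_compactSpace _ h1
    convert h2 using 1
    ext w
    simp only [Set.mem_ofPred_eq, Set.mem_image]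
    constructor
    · rintro ⟨l, h0, hne, hs⟩
      have hpos : 0 < ∑ j, l j := by
        obtain ⟨j, hj⟩ := Function.ne_iff.1 hne
        exact Finset.sum_pos' (fun j _ => h0 j) ⟨j, Finset.mem_univ _, lt_of_le_of_ne (h0 j) (Ne.symm hj)⟩
      refine ⟨(⟨fun j => (∑ j, l j)⁻¹ * l j, ?_, ?_⟩, w), ?_, rfl⟩
      · intro j; exact mul_nonneg (inv_nonneg.2 hpos.le) (h0 j)
      · rw [← Finset.mul_sum, inv_mul_cancel₀ hpos.ne']
      · simp only [mul_smul, ← Finset.smul_sum, hs, smul_zero]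
    · rintro ⟨⟨⟨l, h0, h1⟩, w'⟩, hs, rfl⟩
      refine ⟨l, h0, ?_, hs⟩
      rintro rfl
      simp at h1
  exact hcl.isOpen_compl.eventually_mem h

/-- non-degenerate containment of the origin in a simplex -/
def NonDeg {J V : Type*} [Fintype J] [AddCommGroup V] [Module ℝ V] (w : J → V) : Prop :=
  (∃ l : J → ℝ, (∀ j, 0 < l j) ∧ ∑ j, l j • w j = 0) ∧
    ∀ l : J → ℝ, ∑ j, l j • w j = 0 → ∑ j, l j = 0 → l = 0

def hullMap {J V : Type*} [Fintype J] [NormedAddCommGroup V] [NormedSpace ℝ V] (w : J → V) :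
    (J → ℝ) →L[ℝ] V × ℝ :=
  ∑ j, (ContinuousLinearMap.proj (R := ℝ) (φ := fun _ : J => ℝ) j).smulRight ((w j, (1 : ℝ)) : V × ℝ)

theorem hullMap_apply {J V : Type*} [Fintype J] [NormedAddCommGroup V] [NormedSpace ℝ V] (w : J → V)
    (l : J → ℝ) : hullMap w l = (∑ j, l j • w j, ∑ j, l j) := by
  simp only [hullMap, sum_apply, ContinuousLinearMap.smulRight_apply,
    ContinuousLinearMap.proj_apply]
  ext
  · simp [Prod.fst_sum]
  · simp [Prod.snd_sum]

theorem hullMap_cont {J V : Type*} [Fintype J] [NormedAddCommGroup V] [NormedSpace ℝ V] :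
    Continuous (hullMap : (J → V) → _) := by
  unfold hullMap
  apply continuous_finsetSum
  intro j _
  have : Continuous fun x : V × ℝ =>
      (ContinuousLinearMap.proj (R := ℝ) (φ := fun _ : J => ℝ) j).smulRight x :=
    (ContinuousLinearMap.smulRightL ℝ (J → ℝ) (V × ℝ) (ContinuousLinearMap.proj j)).continuous
  exact this.comp (by fun_prop)

theorem nonDeg_open {J V : Type*} [Fintype J] [Nonempty J] [NormedAddCommGroup V] [NormedSpace ℝ V]
    [FiniteDimensional ℝ V]
    (hc : Fintype.card J = Module.finrank ℝ V + 1)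
    (w : J → V) (h : NonDeg w) : ∀ᶠ w' in nhds w, InHull w' := by
  obtain ⟨⟨l, hl0, hl⟩, hinj⟩ := h
  have hinj' : Function.Injective (hullMap w) := by
    rw [injective_iff_map_eq_zero]
    intro x hx
    rw [hullMap_apply, Prod.mk_eq_zero] at hx
    exact hinj x hx.1 hx.2
  have hfr : Module.finrank ℝ (J → ℝ) = Module.finrank ℝ (V × ℝ) := by
    simp [hc]
  let e : (J → ℝ) ≃L[ℝ] V × ℝ :=
    (LinearEquiv.ofInjectiveOfFinrankEq (hullMap w : (J → ℝ) →ₗ[ℝ] V × ℝ) hinj' hfr).toContinuousLinearEquiv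
  have he : (e : (J → ℝ) →L[ℝ] V × ℝ) = hullMap w := by
    ext1 x; rfl
  have hmem : ∀ᶠ w' in nhds w, hullMap w' ∈ Set.range ((↑) : ((J → ℝ) ≃L[ℝ] V × ℝ) → _) := by
    apply hullMap_cont.continuousAt.eventually
    rw [← he]
    exact ContinuousLinearEquiv.nhds e
  have hcont : ContinuousAt (fun w' => ContinuousLinearMap.inverse (hullMap w') ((0 : V), (1 : ℝ))) w := by
    have h1 : ContinuousAt (ContinuousLinearMap.inverse : ((J → ℝ) →L[ℝ] V × ℝ) → _) (hullMap w) := by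
      rw [← he]
      exact (contDiffAt_map_inverse (n := 0) e).continuousAt
    have h2 := h1.comp hullMap_cont.continuousAt (x := w)
    exact h2.clm_apply continuousAt_const
  have hspos : 0 < ∑ j, l j := Finset.sum_pos (fun j _ => hl0 j) Finset.univ_nonempty
  have hval : ContinuousLinearMap.inverse (hullMap w) ((0 : V), (1 : ℝ)) = (∑ j, l j)⁻¹ • l := by
    rw [← he, ContinuousLinearMap.inverse_equiv]
    change e.symm _ = _
    rw [ContinuousLinearEquiv.symm_apply_eq]
    change _ = hullMap w _
    rw [map_smul, hullMap_apply, hl]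
    ext
    · simp
    · simp [hspos.ne']
  have hpos : ∀ᶠ w' in nhds w, ∀ j, 0 < ContinuousLinearMap.inverse (hullMap w') ((0 : V), (1 : ℝ)) j := by
    rw [Filter.eventually_all]
    intro j
    have h3 : ContinuousAt (fun w' => ContinuousLinearMap.inverse (hullMap w') ((0 : V), (1 : ℝ)) j) w :=
      (continuous_apply j).continuousAt.comp hcont
    apply h3.eventually (lt_mem_nhds _)
    change 0 < ContinuousLinearMap.inverse (hullMap w) ((0 : V), (1 : ℝ)) j
    rw [hval]
    exact mul_pos (inv_pos.2 hspos) (hl0 j)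
  filter_upwards [hmem, hpos] with w' h1 h2
  refine ⟨_, fun j => (h2 j).le, ?_, ?_⟩
  · intro h
    obtain ⟨j⟩ := ‹Nonempty J›
    have := h2 j
    rw [h] at this
    simp at this
  · obtain ⟨e', he'⟩ := h1
    have h3 : hullMap w' (ContinuousLinearMap.inverse (hullMap w') ((0 : V), (1 : ℝ))) = (0, 1) := by
      rw [← he', ContinuousLinearMap.inverse_equiv]
      exact e'.apply_symm_apply _
    rw [hullMap_apply] at h3
    exact (Prod.mk.inj h3).1

section
variable {N : ℕ} {G S P V : Type} [Group G] [MulAction G S] [MulAction G P]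
  [NormedAddCommGroup V] [NormedSpace ℝ V]

def IsFree (G : Type) {P : Type} [Group G] [MulAction G P] (p : P) : Prop := ∀ g : G, g • p = p → g = 1

theorem IsFree.smul {p : P} (h : IsFree G p) (g : G) : IsFree G (g • p) := by
  intro x hx
  have := h (g⁻¹ * x * g) (by rw [mul_smul, mul_smul, hx, inv_smul_smul])
  have h2 : x = g * (g⁻¹ * x * g) * g⁻¹ := by group
  rw [h2, this]; simp

theorem isFree_smul_iff {p : P} (g : G) : IsFree G (g • p) ↔ IsFree G p :=
  ⟨fun h => by simpa using h.smul g⁻¹, fun h => h.smul g⟩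

theorem orb_exists (p : P) : ∃ g : G, g • (⟦p⟧ : Quotient (MulAction.orbitRel G P)).out = p := by
  have : (MulAction.orbitRel G P).r (⟦p⟧ : Quotient (MulAction.orbitRel G P)).out p := Quotient.mk_out p
  exact (MulAction.orbitRel G P).symm this

def orbG (p : P) : G := (orb_exists (G := G) p).choose

theorem orbG_spec (p : P) : (orbG p : G) • (⟦p⟧ : Quotient (MulAction.orbitRel G P)).out = p :=
  (orb_exists (G := G) p).choose_spec

theorem mk_smul (g : G) (p : P) : (⟦g • p⟧ : Quotient (MulAction.orbitRel G P)) = ⟦p⟧ :=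
  Quotient.sound ⟨g, rfl⟩

theorem orbG_smul {p : P} (h : IsFree G p) (g : G) : (orbG (g • p) : G) = g * orbG p := by
  have h1 := orbG_spec (G := G) (g • p)
  rw [mk_smul] at h1
  have h2 := orbG_spec (G := G) p
  have hout : IsFree G (⟦p⟧ : Quotient (MulAction.orbitRel G P)).out := by
    rw [← h2] at h
    exact (isFree_smul_iff _).1 h
  have h3 : ((g * orbG p)⁻¹ * orbG (g • p) : G) • (⟦p⟧ : Quotient (MulAction.orbitRel G P)).out
      = (⟦p⟧ : Quotient (MulAction.orbitRel G P)).out := by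
    rw [mul_smul, h1, inv_smul_eq_iff, mul_smul, h2]
  have := hout _ h3
  rw [inv_mul_eq_one] at this
  exact this.symm

/-- equivariant extension of values given on free orbits -/
def eqExt (ρ : G →* (V →ₗ[ℝ] V)) (b : P → V) (u : Quotient (MulAction.orbitRel G P) → V) (p : P) : V :=
  open Classical in
  if IsFree G p then ρ (orbG p) (u ⟦p⟧) else b p

theorem eqExt_equiv (ρ : G →* (V →ₗ[ℝ] V)) (b : P → V) (u : Quotient (MulAction.orbitRel G P) → V)
    (hb : ∀ (g : G) p, b (g • p) = ρ g (b p)) (g : G) (p : P) :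
    eqExt ρ b u (g • p) = ρ g (eqExt ρ b u p) := by
  unfold eqExt
  by_cases h : IsFree G p
  · rw [if_pos (h.smul g), if_pos h, orbG_smul h, map_mul, mk_smul]; rfl
  · rw [if_neg h, if_neg (fun h' => h ((isFree_smul_iff g).1 h')), hb]

theorem eqExt_base (ρ : G →* (V →ₗ[ℝ] V)) (b : P → V)
    (hb : ∀ (g : G) p, b (g • p) = ρ g (b p)) : eqExt ρ b (fun q => b q.out) = b := by
  funext p
  unfold eqExt
  split_ifs
  · rw [← hb, orbG_spec]
  · rfl

theorem eqExt_cont [FiniteDimensional ℝ V] (ρ : G →* (V →ₗ[ℝ] V)) (b : P → V) :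
    Continuous (eqExt ρ b) := by
  apply continuous_pi
  intro p
  unfold eqExt
  split_ifs
  · exact (LinearMap.continuous_of_finiteDimensional _).comp (continuous_apply _)
  · exact continuous_const

theorem parity_robust [FiniteDimensional ℝ V] [Fintype S] [Finite P] [Finite G]
    (C : Chamb N G S P) (hV : Module.finrank ℝ V = N)
    (hN : 1 ≤ N) (ρ : G →* (V →ₗ[ℝ] V)) (b0 b1 : P → V)
    (e0 : ∀ (g : G) p, b0 (g • p) = ρ g (b0 p)) (e1 : ∀ (g : G) p, b1 (g • p) = ρ g (b1 p))
    (hnf : ∀ σ, (∃ j, ¬ IsFree G (C.vert σ j)) → ¬ InHull (famAll C b0 b1 σ))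
    (h0 : ∀ σ, InHull (fun j => b0 (C.vert σ j)) → NonDeg (fun j => b0 (C.vert σ j)))
    (h1 : ∀ σ, ¬ InHull (fun j => b1 (C.vert σ j))) :
    Tcount C b0 = 0 := by
  classical
  let Q := Quotient (MulAction.orbitRel G P)
  have : Fintype Q := Fintype.ofFinite Q
  let base : Q × Bool → V := fun x => if x.2 then b1 x.1.out else b0 x.1.out
  let Φ0 : (Q × Bool → V) → P → V := fun u => eqExt ρ b0 (fun q => u (q, false))
  let Φ1 : (Q × Bool → V) → P → V := fun u => eqExt ρ b1 (fun q => u (q, true))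
  have c0 : Continuous Φ0 := (eqExt_cont ρ b0).comp (by fun_prop)
  have c1 : Continuous Φ1 := (eqExt_cont ρ b1).comp (by fun_prop)
  have hb0 : Φ0 base = b0 := eqExt_base ρ b0 e0
  have hb1 : Φ1 base = b1 := eqExt_base ρ b1 e1
  have ev : ∀ᶠ u in nhds base, ∀ σ,
      ((∃ j, ¬ IsFree G (C.vert σ j)) → ¬ InHull (famAll C (Φ0 u) (Φ1 u) σ)) ∧
      (InHull (fun j => Φ0 u (C.vert σ j)) ↔ InHull (fun j => b0 (C.vert σ j))) ∧
      ¬ InHull (fun j => Φ1 u (C.vert σ j)) := by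
    rw [Filter.eventually_all]
    intro σ
    refine Filter.Eventually.and ?_ (Filter.Eventually.and ?_ ?_)
    · by_cases hn : ∃ j, ¬ IsFree G (C.vert σ j)
      · have hc : Continuous (fun u => famAll C (Φ0 u) (Φ1 u) σ) := by
          apply continuous_pi
          intro x
          unfold famAll
          split_ifs
          · exact continuous_pi_iff.1 c1 _
          · exact continuous_pi_iff.1 c0 _
        have := (hc.continuousAt (x := base)).eventually (p := fun w => ¬ InHull w) (by
          simp only [hb0, hb1]
          exact not_inHull_open _ (hnf σ hn))
        filter_upwards [this] with u hu _ using hu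
      · simp [hn]
    · have hc : Continuous (fun u => fun j => Φ0 u (C.vert σ j)) :=
        continuous_pi fun j => continuous_pi_iff.1 c0 _
      by_cases hi : InHull (fun j => b0 (C.vert σ j))
      · have := (hc.continuousAt (x := base)).eventually (p := fun w => InHull w) (by
          simp only [hb0]
          exact nonDeg_open (by simp [hV]) _ (h0 σ hi))
        filter_upwards [this] with u hu
        simp only [hu, hi]
      · have := (hc.continuousAt (x := base)).eventually (p := fun w => ¬ InHull w) (by
          simp only [hb0]
          exact not_inHull_open _ hi)
        filter_upwards [this] with u hu
        simp only [hu, hi]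
    · have hc : Continuous (fun u => fun j => Φ1 u (C.vert σ j)) :=
        continuous_pi fun j => continuous_pi_iff.1 c1 _
      exact (hc.continuousAt (x := base)).eventually (p := fun w => ¬ InHull w) (by
          simp only [hb1]
          exact not_inHull_open _ (h1 σ))
  obtain ⟨ε, hε, hball⟩ := Metric.eventually_nhds_iff.1 ev
  obtain ⟨u, hu1, hu2⟩ := gen_pos ρ N hV base ε hε
  have hu := hball ((dist_pi_lt_iff hε).2 hu1)
  have key := parity_thm C hV hN ρ (Φ0 u) (Φ1 u) (eqExt_equiv ρ b0 _ e0) (eqExt_equiv ρ b1 _ e1) ?_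
  · have k1 : Tcount C (Φ1 u) = 0 := by
      unfold Tcount
      apply Finset.sum_eq_zero
      intro q _
      rw [if_neg (hu q.out).2.2]
    have k0 : Tcount C (Φ0 u) = Tcount C b0 := by
      unfold Tcount
      apply Finset.sum_congr rfl
      intro q _
      congr 1
      exact propext (hu q.out).2.1
    rw [← k0, key, k1]
  · intro σ
    by_cases hn : ∃ j, ¬ IsFree G (C.vert σ j)
    · exact Or.inl ((hu σ).1 hn)
    · right
      push Not at hn
      refine ⟨hn, ?_⟩
      rintro l ⟨s, hs, hl⟩ hsum
      let e : Fin (N + 1) × Bool → Q × Bool := fun x => (⟦C.vert σ x.1⟧, x.2)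
      have he : Function.Injective e := by
        rintro ⟨a, a'⟩ ⟨b, b'⟩ hab
        simp only [e, Prod.mk.injEq] at hab
        obtain ⟨g, hg⟩ : ∃ g : G, g • C.vert σ b = C.vert σ a := Quotient.exact hab.1
        have := congrArg C.color hg
        rw [C.color_smul, C.color_vert, C.color_vert] at this
        ext
        · exact this.symm
        · simp [hab.2]
      have := hu2 (Function.extend e (fun x => orbG (C.vert σ x.1)) 1) (Function.extend e l 0) ?_ ?_
      · funext x
        have h := congrFun this (e x)
        rwa [he.extend_apply] at h
      · refine ⟨s.image e, Finset.card_image_le.trans hs, ?_⟩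
        intro x hx
        by_cases hx' : ∃ y, e y = x
        · obtain ⟨y, rfl⟩ := hx'
          rw [he.extend_apply]
          apply hl
          intro hy; exact hx (Finset.mem_image_of_mem _ hy)
        · rw [Function.extend_apply' _ _ _ hx']; rfl
      · rw [push_sum e he, ← hsum]
        apply Finset.sum_congr rfl
        intro x _
        rw [he.extend_apply]
        congr 1
        obtain ⟨a, b⟩ := x
        cases b
        · simp only [famAll, Φ0, eqExt, if_pos (hn a), e]; simp
        · simp only [famAll, Φ1, eqExt, if_pos (hn a), e]; simp
end

end

section

/-- signed permutations -/
@[ext] structure SP (k : ℕ) where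
  perm : Equiv.Perm (Fin k)
  sgn : Fin k → ℤˣ

namespace SP
variable {k : ℕ}

instance : Mul (SP k) := ⟨fun g h => ⟨h.perm * g.perm, fun i => g.sgn i * h.sgn (g.perm i)⟩⟩
instance : One (SP k) := ⟨⟨1, 1⟩⟩
instance : Inv (SP k) := ⟨fun g => ⟨g.perm⁻¹, fun i => (g.sgn (g.perm⁻¹ i))⁻¹⟩⟩

theorem mul_perm (g h : SP k) (i) : (g * h).perm i = h.perm (g.perm i) := rfl
theorem mul_sgn (g h : SP k) (i) : (g * h).sgn i = g.sgn i * h.sgn (g.perm i) := rfl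
theorem one_perm (i) : (1 : SP k).perm i = i := rfl
theorem one_sgn (i) : (1 : SP k).sgn i = 1 := rfl
theorem inv_perm (g : SP k) (i) : (g⁻¹).perm i = g.perm⁻¹ i := rfl
theorem inv_sgn (g : SP k) (i) : (g⁻¹).sgn i = (g.sgn (g.perm⁻¹ i))⁻¹ := rfl

theorem ext' {g h : SP k} (h1 : ∀ i, g.perm i = h.perm i) (h2 : ∀ i, g.sgn i = h.sgn i) : g = h :=
  SP.ext (Equiv.ext h1) (funext h2)

instance : Group (SP k) :=
  Group.ofLeftAxioms
    (fun a b c => ext' (fun i => by simp only [mul_perm]) (fun i => by simp only [mul_perm, mul_sgn, mul_assoc]))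
    (fun a => ext' (fun i => by simp only [mul_perm, one_perm]) (fun i => by simp only [mul_sgn, one_sgn, one_perm, one_mul]))
    (fun a => ext' (fun i => by simp [mul_perm, one_perm, inv_perm]) (fun i => by simp [mul_sgn, one_sgn, inv_perm, inv_sgn]))

instance : Finite (SP k) :=
  Finite.of_injective (fun g : SP k => (g.perm, g.sgn)) (fun g h e => by
    simp only [Prod.mk.injEq] at e; exact SP.ext e.1 e.2)

end SP

theorem intunits_abs (u : ℤˣ) (z : ℤ) : |(u : ℤ) * z| = |z| := by
  rcases Int.units_eq_one_or u with h | h <;> simp [h]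

theorem intunits_odd (u : ℤˣ) (z : ℤ) : Odd ((u : ℤ) * z) ↔ Odd z := by
  rcases Int.units_eq_one_or u with h | h <;> simp [h]

/-- raw action on integer arrays -/
def cact {k n : ℕ} (g : SP k) (c : Fin k × Fin n → ℤ) : Fin k × Fin n → ℤ :=
  fun x => (g.sgn x.1 : ℤ) * c (g.perm x.1, x.2)

theorem cact_one {k n : ℕ} (c : Fin k × Fin n → ℤ) : cact 1 c = c := by
  funext x; simp [cact, SP.one_sgn, SP.one_perm]

theorem cact_mul {k n : ℕ} (g h : SP k) (c : Fin k × Fin n → ℤ) : cact (g * h) c = cact g (cact h c) := by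
  funext x; simp [cact, SP.mul_sgn, SP.mul_perm, mul_assoc]

/-- the odd coordinates of a cell -/
def oddS {k n : ℕ} (c : Fin k × Fin n → ℤ) : Finset (Fin k × Fin n) :=
  Finset.univ.filter fun x => Odd (c x)

theorem mem_oddS {k n : ℕ} {c : Fin k × Fin n → ℤ} {x} : x ∈ oddS c ↔ Odd (c x) := by simp [oddS]

def InX {k n : ℕ} (L : ℕ) (c : Fin k × Fin n → ℤ) : Prop :=
  (∀ x, |c x| ≤ 2 * L) ∧ ∀ i, ∃ s, |c (i, s)| = 2 * L

def face {k n : ℕ} (c c' : Fin k × Fin n → ℤ) : Prop :=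
  ∀ x, c x = c' x ∨ (Odd (c' x) ∧ |c x - c' x| = 1)

section
variable {k n : ℕ} {L : ℕ}

theorem abs_one_cases {a b : ℤ} (h : |a - b| = 1) : a = b + 1 ∨ a = b - 1 := by
  rcases (abs_eq (by norm_num)).1 h with h | h <;> omega

theorem face_eq_of_odd {a p : Fin k × Fin n → ℤ} (h : face a p) {x} (hx : Odd (a x)) : a x = p x := by
  rcases h x with h | ⟨h1, h2⟩
  · exact h
  · rcases abs_one_cases h2 with h | h <;> (rw [h] at hx; grind)

theorem face_eq_of_even {a p : Fin k × Fin n → ℤ} (h : face a p) {x} (hx : ¬ Odd (p x)) : a x = p x := by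
  rcases h x with h | ⟨h1, h2⟩
  · exact h
  · exact absurd h1 hx

theorem face_sub {a p : Fin k × Fin n → ℤ} (h : face a p) : oddS a ⊆ oddS p := by
  intro x hx
  rw [mem_oddS] at hx ⊢
  rw [← face_eq_of_odd h hx]; exact hx

theorem face_refl (a : Fin k × Fin n → ℤ) : face a a := fun x => Or.inl rfl

theorem face_trans {a b c : Fin k × Fin n → ℤ} (h1 : face a b) (h2 : face b c) : face a c := by
  intro x
  by_cases hb : Odd (b x)
  · rw [← face_eq_of_odd h2 hb]; exact h1 x
  · rw [face_eq_of_even h1 hb]; exact h2 x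

theorem face_cact {a b : Fin k × Fin n → ℤ} (g : SP k) (h : face a b) : face (cact g a) (cact g b) := by
  intro x
  unfold cact
  rcases h (g.perm x.1, x.2) with h | ⟨h1, h2⟩
  · left; rw [h]
  · right
    refine ⟨(intunits_odd _ _).2 h1, ?_⟩
    rw [← mul_sub, intunits_abs, h2]

theorem InX_cact {c : Fin k × Fin n → ℤ} (g : SP k) (h : InX L c) : InX L (cact g c) := by
  refine ⟨fun x => ?_, fun i => ?_⟩
  · unfold cact; rw [intunits_abs]; exact h.1 _
  · obtain ⟨s, hs⟩ := h.2 (g.perm i)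
    exact ⟨s, by unfold cact; rw [intunits_abs]; exact hs⟩

theorem card_oddS_cact (c : Fin k × Fin n → ℤ) (g : SP k) : (oddS (cact g c)).card = (oddS c).card := by
  apply Finset.card_bij (fun x _ => (g.perm x.1, x.2))
  · intro x hx
    rw [mem_oddS] at hx ⊢
    exact (intunits_odd _ _).1 hx
  · rintro ⟨a, b⟩ _ ⟨c, d⟩ _ h
    simp only [Prod.mk.injEq, EmbeddingLike.apply_eq_iff_eq] at h
    ext <;> simp [h]
  · rintro ⟨a, b⟩ h
    refine ⟨(g.perm⁻¹ a, b), ?_, by simp⟩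
    rw [mem_oddS] at h ⊢
    apply (intunits_odd _ _).2
    simpa using h

def Ex2 {α : Type*} (Q : α → Prop) : Prop := ∃ p1 p2, p1 ≠ p2 ∧ ∀ p, Q p ↔ p = p1 ∨ p = p2

/-- mixture of two cells -/
def mixc (a b : Fin k × Fin n → ℤ) (O : Finset (Fin k × Fin n)) : Fin k × Fin n → ℤ :=
  fun x => if x ∈ O then b x else a x

theorem odd_not_two_mul {a : ℤ} (h : |a| = 2 * L) : ¬ Odd a := by
  intro h'
  rw [← odd_abs, h] at h'
  grind

theorem mixc_InX {a b : Fin k × Fin n → ℤ} (O : Finset (Fin k × Fin n)) (hab : face a b)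
    (ha : InX L a) (hb : InX L b) : InX L (mixc a b O) := by
  refine ⟨fun x => ?_, fun i => ?_⟩
  · unfold mixc; split_ifs
    · exact hb.1 x
    · exact ha.1 x
  · obtain ⟨s, hs⟩ := hb.2 i
    refine ⟨s, ?_⟩
    have := face_eq_of_even hab (odd_not_two_mul hs)
    unfold mixc; split_ifs
    · exact hs
    · rw [this]; exact hs

theorem mixc_odd {a b : Fin k × Fin n → ℤ} (O : Finset (Fin k × Fin n))
    (h1 : oddS a ⊆ O) (h2 : O ⊆ oddS b) : oddS (mixc a b O) = O := by
  ext x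
  rw [mem_oddS]
  unfold mixc
  split_ifs with h
  · simp [h, mem_oddS.1 (h2 h)]
  · simp only [h, iff_false]
    intro h'; exact h (h1 (mem_oddS.2 h'))

theorem mixc_face1 {a b : Fin k × Fin n → ℤ} (O : Finset (Fin k × Fin n)) (hab : face a b) :
    face a (mixc a b O) := by
  intro x; unfold mixc; split_ifs
  · exact hab x
  · left; rfl

theorem mixc_face2 {a b : Fin k × Fin n → ℤ} (O : Finset (Fin k × Fin n)) (hab : face a b) :
    face (mixc a b O) b := by
  intro x; unfold mixc; split_ifs
  · left; rfl
  · exact hab x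

theorem eq_mixc {a b p : Fin k × Fin n → ℤ} (h1 : face a p) (h2 : face p b) : p = mixc a b (oddS p) := by
  funext x
  unfold mixc
  split_ifs with h
  · exact face_eq_of_odd h2 (mem_oddS.1 h)
  · exact (face_eq_of_even h1 (fun h' => h (mem_oddS.2 h'))).symm

theorem ex2_mid {a b : Fin k × Fin n → ℤ} (hab : face a b) (ha : InX L a) (hb : InX L b)
    (hc : (oddS b).card = (oddS a).card + 2) :
    Ex2 fun p => InX L p ∧ (oddS p).card = (oddS a).card + 1 ∧ face a p ∧ face p b := by
  classical
  have hsub := face_sub hab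
  have hcd : (oddS b \ oddS a).card = 2 := by rw [Finset.card_sdiff_of_subset hsub]; omega
  obtain ⟨x, y, hxy, hd⟩ := Finset.card_eq_two.1 hcd
  have hx : x ∈ oddS b \ oddS a := by rw [hd]; simp
  have hy : y ∈ oddS b \ oddS a := by rw [hd]; simp
  rw [Finset.mem_sdiff] at hx hy
  have hsx : insert x (oddS a) ⊆ oddS b := Finset.insert_subset hx.1 hsub
  have hsy : insert y (oddS a) ⊆ oddS b := Finset.insert_subset hy.1 hsub
  have ox := mixc_odd _ (Finset.subset_insert x (oddS a)) hsx
  have oy := mixc_odd _ (Finset.subset_insert y (oddS a)) hsy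
  refine ⟨mixc a b (insert x (oddS a)), mixc a b (insert y (oddS a)), ?_, ?_⟩
  · intro h
    have h' : x ∈ oddS (mixc a b (insert y (oddS a))) := by rw [← h, ox]; simp
    rw [oy, Finset.mem_insert] at h'
    exact h'.elim hxy hx.2
  · intro p
    constructor
    · rintro ⟨hp, hpc, h1, h2⟩
      have hs1 := face_sub h1
      have hs2 := face_sub h2
      have : (oddS p \ oddS a).card = 1 := by rw [Finset.card_sdiff_of_subset hs1]; omega
      obtain ⟨z, hz⟩ := Finset.card_eq_one.1 this
      have hO : oddS p = insert z (oddS a) := by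
        rw [← Finset.sdiff_union_of_subset hs1, hz]; rfl
      have hz' : z ∈ oddS b \ oddS a := by
        have : z ∈ oddS p \ oddS a := by rw [hz]; simp
        exact Finset.sdiff_subset_sdiff hs2 le_rfl this
      rw [hd] at hz'
      simp only [Finset.mem_insert, Finset.mem_singleton] at hz'
      rw [eq_mixc h1 h2, hO]
      rcases hz' with rfl | rfl
      · left; rfl
      · right; rfl
    · rintro (rfl | rfl)
      · exact ⟨mixc_InX _ hab ha hb, by rw [ox, Finset.card_insert_of_notMem hx.2], mixc_face1 _ hab, mixc_face2 _ hab⟩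
      · exact ⟨mixc_InX _ hab ha hb, by rw [oy, Finset.card_insert_of_notMem hy.2], mixc_face1 _ hab, mixc_face2 _ hab⟩

theorem ex2_bot {b : Fin k × Fin n → ℤ} (hb : InX L b) (hc : (oddS b).card = 1) :
    Ex2 fun p => InX L p ∧ (oddS p).card = 0 ∧ face p b := by
  classical
  obtain ⟨x, hx⟩ := Finset.card_eq_one.1 hc
  have hox : Odd (b x) := by rw [← mem_oddS, hx]; simp
  have hoy : ∀ y, y ≠ x → ¬ Odd (b y) := by
    intro y hy; rw [← mem_oddS, hx]; simpa using hy
  have hlt : |b x| < 2 * L := lt_of_le_of_ne (hb.1 x) fun h => odd_not_two_mul h hox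
  rw [abs_lt] at hlt
  have valid : ∀ e : ℤ, |e| = 1 → InX L (Function.update b x (b x + e)) ∧
      (oddS (Function.update b x (b x + e))).card = 0 ∧ face (Function.update b x (b x + e)) b := by
    intro e he
    have he' : e = 1 ∨ e = -1 := (abs_eq (by norm_num)).1 he
    refine ⟨⟨fun y => ?_, fun i => ?_⟩, ?_, ?_⟩
    · by_cases hy : y = x
      · subst hy; rw [Function.update_self, abs_le]; omega
      · rw [Function.update_of_ne hy]; exact hb.1 y
    · obtain ⟨s, hs⟩ := hb.2 i
      refine ⟨s, ?_⟩
      rw [Function.update_of_ne]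
      · exact hs
      · intro h; rw [h] at hs; exact odd_not_two_mul hs hox
    · rw [Finset.card_eq_zero, Finset.eq_empty_iff_forall_notMem]
      intro y
      rw [mem_oddS]
      by_cases hy : y = x
      · subst hy; rw [Function.update_self]; rcases he' with h | h <;> rw [h] <;> grind
      · rw [Function.update_of_ne hy]; exact hoy y hy
    · intro y
      by_cases hy : y = x
      · subst hy; rw [Function.update_self]; right; exact ⟨hox, by simpa using he⟩
      · rw [Function.update_of_ne hy]; left; rfl
  refine ⟨Function.update b x (b x + 1), Function.update b x (b x + (-1)), ?_, ?_⟩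
  · intro h
    have := congrFun h x
    simp at this
  · intro p
    constructor
    · rintro ⟨hp, hpc, hf⟩
      rw [Finset.card_eq_zero] at hpc
      have hev : ∀ y, ¬ Odd (p y) := fun y => by rw [← mem_oddS, hpc]; simp
      have heq : ∀ e, p x = b x + e → p = Function.update b x (b x + e) := by
        intro e he
        funext y
        by_cases hy : y = x
        · subst hy; rw [Function.update_self, he]
        · rw [Function.update_of_ne hy]; exact face_eq_of_even hf (hoy y hy)
      rcases hf x with h | ⟨_, h⟩
      · exact absurd (h ▸ hox) (hev x)
      · rcases abs_one_cases h with h | h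
        · left; exact heq 1 h
        · right; exact heq (-1) h
    · rintro (rfl | rfl)
      · exact valid 1 (by norm_num)
      · exact valid (-1) (by norm_num)

end

end

section

section
variable {k n : ℕ} {L : ℕ}

/-- admissible top moves -/
def TopMove (L : ℕ) (a : Fin k × Fin n → ℤ) (x : Fin k × Fin n) (e : ℤ) : Prop :=
  ¬ Odd (a x) ∧ |e| = 1 ∧ |a x + e| ≤ 2 * L ∧ ∃ y, y.1 = x.1 ∧ y ≠ x ∧ |a y| = 2 * L

theorem topMove_valid {a : Fin k × Fin n → ℤ} (ha : InX L a) {x e} (h : TopMove L a x e) :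
    InX L (Function.update a x (a x + e)) ∧
      (oddS (Function.update a x (a x + e))).card = (oddS a).card + 1 ∧
      face a (Function.update a x (a x + e)) := by
  classical
  obtain ⟨hx, he, hle, ⟨y1, y2⟩, hy1, hyx, hy⟩ := h
  have he' : e = 1 ∨ e = -1 := (abs_eq (by norm_num)).1 he
  have hodd : Odd (a x + e) := by rcases he' with h | h <;> rw [h] <;> grind
  refine ⟨⟨fun z => ?_, fun i => ?_⟩, ?_, ?_⟩
  · by_cases hz : z = x
    · subst hz; rw [Function.update_self]; exact hle
    · rw [Function.update_of_ne hz]; exact ha.1 z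
  · by_cases hi : i = x.1
    · refine ⟨y2, ?_⟩
      simp only at hy1
      rw [hi, ← hy1, Function.update_of_ne hyx]; exact hy
    · obtain ⟨s, hs⟩ := ha.2 i
      refine ⟨s, ?_⟩
      rw [Function.update_of_ne]
      · exact hs
      · rintro rfl; exact hi rfl
  · have : oddS (Function.update a x (a x + e)) = insert x (oddS a) := by
      ext z
      rw [mem_oddS, Finset.mem_insert, mem_oddS]
      by_cases hz : z = x
      · subst hz; simp [hodd]
      · rw [Function.update_of_ne hz]; simp [hz]
    rw [this, Finset.card_insert_of_notMem (by rwa [mem_oddS])]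
  · intro z
    by_cases hz : z = x
    · subst hz
      right
      rw [Function.update_self]
      refine ⟨hodd, ?_⟩
      rw [← he, ← abs_neg]; congr 1; ring
    · rw [Function.update_of_ne hz]; left; rfl

theorem topMove_complete {a p : Fin k × Fin n → ℤ} (hp : InX L p)
    (hc : (oddS p).card = (oddS a).card + 1) (hf : face a p) :
    ∃ x e, TopMove L a x e ∧ p = Function.update a x (a x + e) := by
  classical
  have hs := face_sub hf
  have : (oddS p \ oddS a).card = 1 := by rw [Finset.card_sdiff_of_subset hs]; omega
  obtain ⟨x, hx⟩ := Finset.card_eq_one.1 this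
  have hx' : x ∈ oddS p \ oddS a := by rw [hx]; simp
  rw [Finset.mem_sdiff, mem_oddS, mem_oddS] at hx'
  have hoff : ∀ y, y ≠ x → p y = a y := by
    intro y hy
    by_cases hpy : Odd (p y)
    · have : y ∈ oddS a := by
        by_contra h
        have : y ∈ oddS p \ oddS a := Finset.mem_sdiff.2 ⟨mem_oddS.2 hpy, h⟩
        rw [hx] at this
        exact hy (Finset.mem_singleton.1 this)
      exact (face_eq_of_odd hf (mem_oddS.1 this)).symm
    · exact (face_eq_of_even hf hpy).symm
  refine ⟨x, p x - a x, ⟨hx'.2, ?_, ?_, ?_⟩, ?_⟩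
  · rcases hf x with h | ⟨_, h⟩
    · rw [h] at hx'; exact absurd hx'.1 hx'.2
    · rw [← h, abs_sub_comm]
  · have := hp.1 x
    simpa using this
  · obtain ⟨s, hs⟩ := hp.2 x.1
    have hne : (x.1, s) ≠ x := by
      intro h; rw [h] at hs; exact odd_not_two_mul hs hx'.1
    exact ⟨(x.1, s), rfl, hne, by rw [← hoff _ hne]; exact hs⟩
  · funext y
    by_cases hy : y = x
    · subst hy; rw [Function.update_self]; ring
    · rw [Function.update_of_ne hy, hoff y hy]

def inw (z : ℤ) : ℤ := if 0 < z then -1 else 1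

theorem update_ne {a : Fin k × Fin n → ℤ} {x y : Fin k × Fin n} {e e' : ℤ} (he : e ≠ 0)
    (h : x ≠ y ∨ e ≠ e') : Function.update a x (a x + e) ≠ Function.update a y (a y + e') := by
  intro heq
  have h1 := congrFun heq x
  rw [Function.update_self] at h1
  by_cases hxy : x = y
  · subst hxy
    rw [Function.update_self] at h1
    rcases h with h | h
    · exact h rfl
    · exact h (by linarith)
  · rw [Function.update_of_ne hxy] at h1
    exact he (by linarith)

theorem ex2_top {n' : ℕ} (hL : 1 ≤ L) {a : Fin k × Fin (n' + 1) → ℤ} (ha : InX L a)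
    (hc : (oddS a).card + 1 = k * n') :
    Ex2 fun p => InX L p ∧ (oddS p).card = (oddS a).card + 1 ∧ face a p := by
  classical
  have hval : ∀ p, (InX L p ∧ (oddS p).card = (oddS a).card + 1 ∧ face a p) ↔
      ∃ x e, TopMove L a x e ∧ p = Function.update a x (a x + e) := by
    intro p
    constructor
    · rintro ⟨h1, h2, h3⟩; exact topMove_complete h1 h2 h3
    · rintro ⟨x, e, h, rfl⟩; exact topMove_valid ha h
  choose f hf using ha.2
  let R : Finset (Fin k × Fin (n' + 1)) := Finset.univ.image fun i => (i, f i)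
  have hRc : R.card = k := by
    rw [Finset.card_image_of_injective]
    · simp
    · intro i j h; exact (Prod.mk.inj h).1
  have hRE : R ⊆ (oddS a)ᶜ := by
    intro x hx
    obtain ⟨i, _, rfl⟩ := Finset.mem_image.1 hx
    rw [Finset.mem_compl, mem_oddS]
    exact odd_not_two_mul (hf i)
  have hEc : ((oddS a)ᶜ).card = k + 1 := by
    rw [Finset.card_compl]
    simp only [Fintype.card_prod, Fintype.card_fin]
    have : k * (n' + 1) = k * n' + k := by ring
    omega
  have : ((oddS a)ᶜ \ R).card = 1 := by rw [Finset.card_sdiff_of_subset hRE]; omega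
  obtain ⟨u, hu⟩ := Finset.card_eq_one.1 this
  have hu' : u ∈ (oddS a)ᶜ \ R := by rw [hu]; simp
  rw [Finset.mem_sdiff, Finset.mem_compl, mem_oddS] at hu'
  have hE : ∀ x, ¬ Odd (a x) → x = u ∨ x = (x.1, f x.1) := by
    intro x hx
    by_cases hxR : x ∈ R
    · obtain ⟨i, _, rfl⟩ := Finset.mem_image.1 hxR
      right; rfl
    · left
      have : x ∈ (oddS a)ᶜ \ R := by
        rw [Finset.mem_sdiff, Finset.mem_compl, mem_oddS]; exact ⟨hx, hxR⟩
      rw [hu] at this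
      exact Finset.mem_singleton.1 this
  have huv : u ≠ (u.1, f u.1) := by
    intro h
    apply hu'.2
    rw [h]
    exact Finset.mem_image_of_mem _ (Finset.mem_univ _)
  set v := (u.1, f u.1) with hv
  have hav : |a v| = 2 * L := hf _
  have hmove : ∀ x e, TopMove L a x e → x = u ∨ (x = v ∧ |a u| = 2 * L) := by
    rintro x e ⟨h1, -, -, y, hy1, hy2, hy3⟩
    rcases hE x h1 with h | h
    · left; exact h
    · right
      have hyu : y = u := by
        rcases hE y (odd_not_two_mul hy3) with h' | h'
        · exact h'
        · exfalso; apply hy2; rw [h', h, hy1]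
      rw [← hyu]
      refine ⟨?_, hy3⟩
      rw [hv, ← hyu, hy1]; exact h
  have hinw : ∀ z : ℤ, |z| = 2 * L → ∀ e : ℤ, |e| = 1 → (|z + e| ≤ 2 * L ↔ e = inw z) := by
    intro z hz e he
    have he' : e = 1 ∨ e = -1 := (abs_eq (by norm_num)).1 he
    have hz' := (abs_eq (by positivity)).1 hz
    unfold inw
    rw [abs_le]
    split_ifs with h <;> omega
  have hinw1 : ∀ z, |inw z| = 1 := by intro z; unfold inw; split_ifs <;> simp
  have hinw0 : ∀ z, inw z ≠ 0 := by intro z; unfold inw; split_ifs <;> simp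
  by_cases hau : |a u| = 2 * L
  · refine ⟨Function.update a u (a u + inw (a u)), Function.update a v (a v + inw (a v)),
      update_ne (hinw0 _) (Or.inl huv), fun p => ?_⟩
    refine (hval p).trans ?_
    constructor
    · rintro ⟨x, e, h, rfl⟩
      rcases hmove x e h with rfl | ⟨rfl, _⟩
      · left; rw [(hinw _ hau e h.2.1).1 h.2.2.1]
      · right; rw [(hinw _ hav e h.2.1).1 h.2.2.1]
    · rintro (rfl | rfl)
      · exact ⟨u, _, ⟨hu'.1, hinw1 _, (hinw _ hau _ (hinw1 _)).2 rfl, v, rfl, huv.symm, hav⟩, rfl⟩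
      · exact ⟨v, _, ⟨odd_not_two_mul hav, hinw1 _, (hinw _ hav _ (hinw1 _)).2 rfl, u, rfl, huv, hau⟩, rfl⟩
  · have hlt : |a u| < 2 * L := lt_of_le_of_ne (ha.1 u) hau
    have hb : ∀ e : ℤ, |e| = 1 → |a u + e| ≤ 2 * L := by
      intro e he
      have := abs_add_le (a u) e
      omega
    refine ⟨Function.update a u (a u + 1), Function.update a u (a u + (-1)),
      update_ne (by norm_num) (Or.inr (by norm_num)), fun p => ?_⟩
    refine (hval p).trans ?_
    constructor
    · rintro ⟨x, e, h, rfl⟩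
      rcases hmove x e h with rfl | ⟨_, h'⟩
      · rcases (abs_eq (by norm_num)).1 h.2.1 with rfl | rfl
        · left; rfl
        · right; rfl
      · exact absurd h' hau
    · rintro (rfl | rfl)
      · exact ⟨u, _, ⟨hu'.1, by norm_num, hb _ (by norm_num), v, rfl, huv.symm, hav⟩, rfl⟩
      · exact ⟨u, _, ⟨hu'.1, by norm_num, hb _ (by norm_num), v, rfl, huv.symm, hav⟩, rfl⟩

/-- cells of the subdivided boundary -/
abbrev Cell (k n L : ℕ) : Type := {c : Fin k × Fin n → ℤ // InX L c}

instance : Finite (Cell k n L) := by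
  have hfin : ({c : Fin k × Fin n → ℤ | ∀ x, c x ∈ Set.Icc (-(2 * L : ℤ)) (2 * L)}).Finite := by
    have := Set.Finite.pi' (fun _ : Fin k × Fin n => Set.finite_Icc (-(2 * L : ℤ)) (2 * L))
    exact this
  have : Finite {c : Fin k × Fin n → ℤ | ∀ x, c x ∈ Set.Icc (-(2 * L : ℤ)) (2 * L)} := hfin
  apply Finite.of_injective (β := {c : Fin k × Fin n → ℤ | ∀ x, c x ∈ Set.Icc (-(2 * L : ℤ)) (2 * L)})
    (fun c : Cell k n L => ⟨c.1, fun x => by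
    have := c.2.1 x
    rw [abs_le] at this
    exact this⟩)
  intro a b h
  exact Subtype.ext (Subtype.mk.inj h)

instance : MulAction (SP k) (Cell k n L) where
  smul g c := ⟨cact g c.1, InX_cact g c.2⟩
  one_smul c := Subtype.ext (cact_one c.1)
  mul_smul g h c := Subtype.ext (cact_mul g h c.1)

theorem cell_smul_val (g : SP k) (c : Cell k n L) : (g • c).1 = cact g c.1 := rfl

/-- maximal flags of cells -/
abbrev CFlag (k n L N : ℕ) : Type := {σ : Fin (N + 1) → Cell k n L //
  (∀ j, (oddS (σ j).1).card = (j : ℕ)) ∧ ∀ a b, a ≤ b → face (σ a).1 (σ b).1}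

instance {N : ℕ} : Finite (CFlag k n L N) := by unfold CFlag; infer_instance

instance {N : ℕ} : MulAction (SP k) (CFlag k n L N) where
  smul g σ := ⟨fun j => g • σ.1 j, fun j => by rw [cell_smul_val, card_oddS_cact]; exact σ.2.1 j,
    fun a b h => face_cact g (σ.2.2 a b h)⟩
  one_smul σ := Subtype.ext (funext fun j => one_smul _ _)
  mul_smul g h σ := Subtype.ext (funext fun j => mul_smul _ _ _)

theorem flag_smul_val {N : ℕ} (g : SP k) (σ : CFlag k n L N) (j) : (g • σ).1 j = g • σ.1 j := rfl

theorem flag_ex2 {n' N : ℕ} (hL : 1 ≤ L) (hN : N = k * n') (hN1 : 1 ≤ N) (σ : CFlag k (n' + 1) L N)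
    (j : Fin (N + 1)) :
    Ex2 fun p : Fin k × Fin (n' + 1) → ℤ => InX L p ∧ (oddS p).card = (j : ℕ) ∧
      (∀ a < j, face (σ.1 a).1 p) ∧ (∀ b > j, face p (σ.1 b).1) := by
  obtain ⟨j, hj⟩ := j
  rcases Nat.eq_zero_or_pos j with h0 | hpos
  · subst h0
    have hE := ex2_bot (σ.1 ⟨1, by omega⟩).2 (σ.2.1 _)
    obtain ⟨p1, p2, hne, h⟩ := hE
    refine ⟨p1, p2, hne, fun p => ?_⟩
    rw [← h]
    constructor
    · rintro ⟨h1, h2, h3, h4⟩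
      exact ⟨h1, h2, h4 _ (by rw [gt_iff_lt, Fin.mk_lt_mk]; omega)⟩
    · rintro ⟨h1, h2, h3⟩
      refine ⟨h1, h2, fun a ha => absurd ha (by rw [Fin.lt_def]; simp), fun b hb => ?_⟩
      exact face_trans h3 (σ.2.2 _ _ (by rw [gt_iff_lt, Fin.lt_def] at hb; rw [Fin.le_def]; exact hb))
  · rcases Nat.lt_or_ge j N with hlt | hge
    · have hE := ex2_mid (σ.2.2 ⟨j - 1, by omega⟩ ⟨j + 1, by omega⟩ (by rw [Fin.mk_le_mk]; omega))
        (σ.1 _).2 (σ.1 _).2 (by rw [σ.2.1, σ.2.1]; simp only; omega)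
      obtain ⟨p1, p2, hne, h⟩ := hE
      refine ⟨p1, p2, hne, fun p => ?_⟩
      rw [← h, σ.2.1]
      constructor
      · rintro ⟨h1, h2, h3, h4⟩
        exact ⟨h1, by simp only at h2 ⊢; omega, h3 _ (by rw [Fin.mk_lt_mk]; omega), h4 _ (by rw [gt_iff_lt, Fin.mk_lt_mk]; omega)⟩
      · rintro ⟨h1, h2, h3, h4⟩
        refine ⟨h1, by simp only at h2 ⊢; omega, fun a ha => ?_, fun b hb => ?_⟩
        · refine face_trans (σ.2.2 _ _ ?_) h3
          rw [Fin.lt_def] at ha; rw [Fin.le_def]; simp only at ha ⊢; omega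
        · refine face_trans h4 (σ.2.2 _ _ ?_)
          rw [gt_iff_lt, Fin.lt_def] at hb; rw [Fin.le_def]; exact hb
    · have hjN : j = N := by omega
      have hE := ex2_top hL (σ.1 ⟨j - 1, by omega⟩).2 (by rw [σ.2.1]; simp only; omega)
      obtain ⟨p1, p2, hne, h⟩ := hE
      refine ⟨p1, p2, hne, fun p => ?_⟩
      rw [← h, σ.2.1]
      constructor
      · rintro ⟨h1, h2, h3, h4⟩
        exact ⟨h1, by simp only at h2 ⊢; omega, h3 _ (by rw [Fin.mk_lt_mk]; omega)⟩
      · rintro ⟨h1, h2, h3⟩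
        refine ⟨h1, by simp only at h2 ⊢; omega, fun a ha => ?_, fun b hb => ?_⟩
        · refine face_trans (σ.2.2 _ _ ?_) h3
          rw [Fin.lt_def] at ha; rw [Fin.le_def]; simp only at ha ⊢; omega
        · rw [gt_iff_lt, Fin.lt_def] at hb; simp only at hb; omega

theorem flag_nbr {n' N : ℕ} (hL : 1 ≤ L) (hN : N = k * n') (hN1 : 1 ≤ N) (j : Fin (N + 1))
    (σ : CFlag k (n' + 1) L N) :
    ∃ τ : CFlag k (n' + 1) L N, τ ≠ σ ∧ (∀ i, i ≠ j → τ.1 i = σ.1 i) ∧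
      ∀ τ' : CFlag k (n' + 1) L N, (∀ i, i ≠ j → τ'.1 i = σ.1 i) → τ' = σ ∨ τ' = τ := by
  obtain ⟨p1, p2, hne, h⟩ := flag_ex2 hL hN hN1 σ j
  have hval : ∀ τ' : CFlag k (n' + 1) L N, (∀ i, i ≠ j → τ'.1 i = σ.1 i) → 
      (τ'.1 j).1 = p1 ∨ (τ'.1 j).1 = p2 := by
    intro τ' hτ
    rw [← h]
    refine ⟨(τ'.1 j).2, τ'.2.1 j, fun a ha => ?_, fun b hb => ?_⟩
    · rw [← hτ a ha.ne]; exact τ'.2.2 _ _ ha.le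
    · rw [← hτ b (ne_of_gt hb)]; exact τ'.2.2 _ _ (le_of_lt hb)
  have hmk : ∀ p, (p = p1 ∨ p = p2) → ∃ τ : CFlag k (n' + 1) L N, (∀ i, i ≠ j → τ.1 i = σ.1 i) ∧ (τ.1 j).1 = p := by
    intro p hp
    obtain ⟨h1, h2, h3, h4⟩ := (h p).2 hp
    refine ⟨⟨Function.update σ.1 j ⟨p, h1⟩, ?_, ?_⟩, ?_, ?_⟩
    · intro i
      by_cases hi : i = j
      · subst hi; rw [Function.update_self]; exact h2
      · rw [Function.update_of_ne hi]; exact σ.2.1 i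
    · intro a b hab
      by_cases ha : a = j
      · subst ha
        rw [Function.update_self]
        by_cases hb : b = a
        · subst hb; rw [Function.update_self]; exact face_refl _
        · rw [Function.update_of_ne hb]; exact h4 b (lt_of_le_of_ne hab (Ne.symm hb))
      · rw [Function.update_of_ne ha]
        by_cases hb : b = j
        · subst hb; rw [Function.update_self]; exact h3 a (lt_of_le_of_ne hab ha)
        · rw [Function.update_of_ne hb]; exact σ.2.2 _ _ hab
    · intro i hi; simp only; rw [Function.update_of_ne hi]
    · simp only; rw [Function.update_self]
  have hext : ∀ τ τ' : CFlag k (n' + 1) L N, (∀ i, i ≠ j → τ.1 i = σ.1 i) → (∀ i, i ≠ j → τ'.1 i = σ.1 i) →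
      (τ.1 j).1 = (τ'.1 j).1 → τ = τ' := by
    intro τ τ' h1 h2 h3
    apply Subtype.ext
    funext i
    by_cases hi : i = j
    · subst hi; exact Subtype.ext h3
    · rw [h1 i hi, h2 i hi]
  have main : ∀ p p', (∀ z, (z = p1 ∨ z = p2) ↔ z = p ∨ z = p') → p ≠ p' → (σ.1 j).1 = p → 
      ∃ τ : CFlag k (n' + 1) L N, τ ≠ σ ∧ (∀ i, i ≠ j → τ.1 i = σ.1 i) ∧
      ∀ τ' : CFlag k (n' + 1) L N, (∀ i, i ≠ j → τ'.1 i = σ.1 i) → τ' = σ ∨ τ' = τ := by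
    intro p p' hpp hpne hσ
    obtain ⟨τ, hτ1, hτ2⟩ := hmk p' ((hpp p').2 (Or.inr rfl))
    refine ⟨τ, ?_, hτ1, ?_⟩
    · rintro rfl; exact hpne (hσ.symm.trans hτ2)
    · intro τ' hτ'
      rcases (hpp _).1 (hval τ' hτ') with h | h
      · left; exact hext _ _ hτ' (fun _ _ => rfl) (h.trans hσ.symm)
      · right; exact hext _ _ hτ' hτ1 (h.trans hτ2.symm)
  rcases hval σ (fun _ _ => rfl) with h' | h'
  · exact main p1 p2 (fun z => Iff.rfl) hne h'
  · exact main p2 p1 (fun z => or_comm) hne.symm h'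

/-- the chamber system of the subdivided product of cube boundaries -/
def flagChamb {n' N : ℕ} (hL : 1 ≤ L) (hN : N = k * n') (hN1 : 1 ≤ N) :
    Chamb N (SP k) (CFlag k (n' + 1) L N) (Cell k (n' + 1) L) where
  vert σ j := σ.1 j
  th j σ := (flag_nbr hL hN hN1 j σ).choose
  color c := (oddS c.1).card
  th_ne j σ := (flag_nbr hL hN hN1 j σ).choose_spec.1
  th_invol j σ := by
    have h1 := (flag_nbr hL hN hN1 j σ).choose_spec
    have h2 := (flag_nbr hL hN hN1 j (flag_nbr hL hN hN1 j σ).choose).choose_spec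
    rcases h1.2.2 _ (fun i hi => (h2.2.1 i hi).trans (h1.2.1 i hi)) with h | h
    · exact h
    · exact absurd h h2.1
  th_smul j g σ := by
    have h1 := (flag_nbr hL hN hN1 j σ).choose_spec
    have h2 := (flag_nbr hL hN hN1 j (g • σ)).choose_spec
    rcases h2.2.2 (g • (flag_nbr hL hN hN1 j σ).choose)
      (fun i hi => by rw [flag_smul_val, flag_smul_val, h1.2.1 i hi]) with h | h
    · exact absurd (MulAction.injective g h) h1.1
    · exact h.symm
  vert_th j σ i hi := (flag_nbr hL hN hN1 j σ).choose_spec.2.1 i hi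
  vert_smul g σ j := rfl
  color_vert σ j := σ.2.1 j
  color_smul g c := card_oddS_cact c.1 g
end

end

section

theorem hull_avoid {J V : Type*} [Fintype J] [NormedAddCommGroup V] [NormedSpace ℝ V] (w : J → V)
    (b : J → Bool) (v0 v1 : V) (δ : ℝ)
    (hv : ∀ s : ℝ, 0 ≤ s → s ≤ 1 → δ ≤ ‖(1 - s) • v0 + s • v1‖)
    (hw : ∀ j, ‖w j - (if b j then v1 else v0)‖ < δ) : ¬ InHull w := by
  rintro ⟨l, h0, hne, hs⟩
  obtain ⟨j0, hj0⟩ := Function.ne_iff.1 hne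
  have hj0' : 0 < l j0 := lt_of_le_of_ne (h0 j0) (Ne.symm hj0)
  have hpos : 0 < ∑ j, l j := Finset.sum_pos' (fun j _ => h0 j) ⟨j0, Finset.mem_univ _, hj0'⟩
  set S := ∑ j, l j with hS
  set S1 := ∑ j, if b j then l j else 0 with hS1
  have hS1_0 : 0 ≤ S1 := Finset.sum_nonneg fun j _ => by split_ifs <;> simp [h0 j]
  have hS1_S : S1 ≤ S := Finset.sum_le_sum fun j _ => by split_ifs <;> simp [h0 j]
  have h1 := hv (S1 / S) (by positivity) (by rw [div_le_one hpos]; exact hS1_S)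
  have h2 : ∑ j, l j • (if b j then v1 else v0) = S • ((1 - S1 / S) • v0 + (S1 / S) • v1) := by
    have : ∀ j, l j • (if b j then v1 else v0) = (l j - if b j then l j else 0) • v0 + (if b j then l j else 0) • v1 := by
      intro j; split_ifs <;> simp
    simp only [this, Finset.sum_add_distrib, ← Finset.sum_smul, Finset.sum_sub_distrib]
    rw [← hS, ← hS1, smul_add, smul_smul, smul_smul]
    congr 2 <;> field_simp
  have h3 : ∑ j, l j • (w j - (if b j then v1 else v0)) = - (S • ((1 - S1 / S) • v0 + (S1 / S) • v1)) := by
    simp only [smul_sub, Finset.sum_sub_distrib, hs, h2, zero_sub]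
  have h4 : ‖∑ j, l j • (w j - (if b j then v1 else v0))‖ < ∑ j, l j * δ := by
    refine (norm_sum_le _ _).trans_lt ?_
    apply Finset.sum_lt_sum
    · intro j _
      rw [norm_smul, Real.norm_of_nonneg (h0 j)]
      exact mul_le_mul_of_nonneg_left (hw j).le (h0 j)
    · refine ⟨j0, Finset.mem_univ _, ?_⟩
      rw [norm_smul, Real.norm_of_nonneg (h0 j0)]
      exact mul_lt_mul_of_pos_left (hw j0) hj0'
  rw [h3, norm_neg, norm_smul, Real.norm_of_nonneg hpos.le, ← Finset.sum_mul, ← hS] at h4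
  exact absurd (lt_of_mul_lt_mul_left h4 hpos.le) (not_lt.2 h1)

theorem hull_avoid1 {J V : Type*} [Fintype J] [NormedAddCommGroup V] [NormedSpace ℝ V] (w : J → V)
    (v : V) (hw : ∀ j, ‖w j - v‖ < ‖v‖) : ¬ InHull w := by
  apply hull_avoid w (fun _ => false) v v ‖v‖
  · intro s _ _
    rw [← add_smul]; simp
  · intro j; simpa using hw j

section
variable {k n' : ℕ} {L N : ℕ}

theorem flag_unique (en : Fin k × Fin (n' + 1) → ℕ)
    (hen_lt : ∀ x, x.2 ≠ 0 → en x < N)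
    (hen_inj : ∀ x y, x.2 ≠ 0 → y.2 ≠ 0 → en x = en y → x = y)
    (hN : N = k * n')
    (e : Fin k × Fin (n' + 1) → ℤ) (he : ∀ x, x.2 ≠ 0 → Odd (e x))
    (σ : CFlag k (n' + 1) L N) (hch : ∀ j i, (σ.1 j).1 (i, 0) = 2 * L)
    (l : Fin (N + 1) → ℝ) (hl0 : ∀ j, 0 ≤ l j) (hl1 : ∑ j, l j = 1)
    (h : ∀ x, x.2 ≠ 0 → ∑ j, l j * ((σ.1 j).1 x : ℝ) = e x + (en x + 1) / (2 * N + 2)) (j : Fin (N + 1))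
    (x : Fin k × Fin (n' + 1)) (hx : x.2 ≠ 0) :
    (σ.1 j).1 x = e x + if (j : ℕ) ≤ en x then 1 else 0 := by
  classical
  -- chart coordinates
  let I0 : Finset (Fin k × Fin (n' + 1)) := Finset.univ.filter fun x => x.2 ≠ 0
  have hI0 : I0.card = N := by
    have : I0 = Finset.univ ×ˢ (Finset.univ.erase 0) := by
      ext x; simp [I0]
    rw [this, Finset.card_product, Finset.card_erase_of_mem (Finset.mem_univ _)]
    simp [hN]
  have hsub : ∀ j, oddS (σ.1 j).1 ⊆ I0 := by
    intro j y hy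
    rw [mem_oddS] at hy
    simp only [I0, Finset.mem_filter, Finset.mem_univ, true_and]
    intro h0
    have : y = (y.1, 0) := by ext <;> simp [h0]
    rw [this, hch] at hy
    grind
  have htop : ∀ y, y.2 ≠ 0 → Odd ((σ.1 (Fin.last N)).1 y) := by
    have : oddS (σ.1 (Fin.last N)).1 = I0 := by
      apply Finset.eq_of_subset_of_card_le (hsub _)
      rw [hI0, σ.2.1]; simp
    intro y hy
    rw [← mem_oddS, this]; simp [I0, hy]
  have hOmono : ∀ a b : Fin (N + 1), a ≤ b → oddS (σ.1 a).1 ⊆ oddS (σ.1 b).1 := fun a b hab =>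
    face_sub (σ.2.2 a b hab)
  have hbot : ∀ y, y ∉ oddS (σ.1 0).1 := by
    intro y
    have := σ.2.1 0
    simp only [Fin.val_zero, Finset.card_eq_zero] at this
    rw [this]; simp
  -- every vertex is a mixture
  have hmix : ∀ j y, (σ.1 j).1 y = if y ∈ oddS (σ.1 j).1 then (σ.1 (Fin.last N)).1 y else (σ.1 0).1 y := by
    intro j y
    have := eq_mixc (σ.2.2 0 j (Fin.zero_le _)) (σ.2.2 j (Fin.last N) (Fin.le_last _))
    exact congrFun this y
  let th : Fin k × Fin (n' + 1) → ℝ := fun y => ∑ j, if y ∈ oddS (σ.1 j).1 then 0 else l j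
  have hth0 : ∀ y, 0 ≤ th y := fun y => Finset.sum_nonneg fun j _ => by split_ifs <;> simp [hl0 j]
  have hth1 : ∀ y, th y ≤ 1 := fun y => by
    rw [← hl1]
    exact Finset.sum_le_sum fun j _ => by split_ifs <;> simp [hl0 j]
  have hsum : ∀ y, ∑ j, l j * ((σ.1 j).1 y : ℝ) =
      (σ.1 (Fin.last N)).1 y + th y * (((σ.1 0).1 y : ℝ) - (σ.1 (Fin.last N)).1 y) := by
    intro y
    have h1 : ∀ j, l j * ((σ.1 j).1 y : ℝ) = l j * (σ.1 (Fin.last N)).1 y +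
        (if y ∈ oddS (σ.1 j).1 then 0 else l j) * (((σ.1 0).1 y : ℝ) - (σ.1 (Fin.last N)).1 y) := by
      intro j
      conv_lhs => rw [hmix j y]
      split_ifs <;> ring
    simp only [h1, Finset.sum_add_distrib, ← Finset.sum_mul, hl1, one_mul]
    rfl
  have hNp : (0 : ℝ) < 2 * N + 2 := by positivity
  have hmain : ∀ y, y.2 ≠ 0 → (σ.1 (Fin.last N)).1 y = e y ∧ (σ.1 0).1 y = e y + 1 ∧
      th y = (en y + 1) / (2 * N + 2) := by
    intro y hy
    have h1 := h y hy
    rw [hsum] at h1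
    set t : ℝ := ((en y : ℝ) + 1) / (2 * N + 2) with ht
    have ht0 : 0 < t := by positivity
    have ht1 : t < 1 := by
      rw [ht, div_lt_one hNp]
      have : (en y : ℝ) < N := by exact_mod_cast hen_lt y hy
      have : (0 : ℝ) ≤ N := Nat.cast_nonneg N
      linarith
    have hodd := htop y hy
    have heven : ¬ Odd ((σ.1 0).1 y) := fun h => hbot y (mem_oddS.2 h)
    rcases (σ.2.2 0 (Fin.last N) (Fin.zero_le _)) y with h2 | ⟨_, h2⟩
    · rw [h2] at heven; exact absurd hodd heven
    · have hb := hth0 y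
      have hb1 := hth1 y
      have hoe := he y hy
      generalize hA : (σ.1 (Fin.last N)).1 y = A at *
      generalize hB : (σ.1 0).1 y = B at *
      generalize e y = E at *
      rcases abs_one_cases h2 with h3 | h3
      · rw [h3] at h1
        push_cast at h1
        have h4 : (A : ℝ) - E < 1 := by linarith
        have h5 : (-1 : ℝ) < (A : ℝ) - E := by linarith
        have h4' : A - E < 1 := by exact_mod_cast h4
        have h5' : -1 < A - E := by exact_mod_cast h5
        have : A = E := by omega
        refine ⟨this, by omega, ?_⟩
        rw [this] at h1; linarith
      · rw [h3] at h1
        push_cast at h1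
        have h4 : (A : ℝ) - E < 2 := by linarith
        have h5 : (0 : ℝ) < (A : ℝ) - E := by linarith
        have h4' : A - E < 2 := by exact_mod_cast h4
        have h5' : 0 < A - E := by exact_mod_cast h5
        exfalso
        have : A = E + 1 := by omega
        rw [this] at hodd
        grind
  -- down-closed
  have hdown : ∀ j y z, y.2 ≠ 0 → z ∈ oddS (σ.1 j).1 → en y ≤ en z → y ∈ oddS (σ.1 j).1 := by
    intro j y z hy hz hyz
    by_contra hcon
    have hz0 : z.2 ≠ 0 := by
      have := hsub j hz
      simpa [I0] using this
    have hlt : th y ≤ th z := by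
      rw [(hmain y hy).2.2, (hmain z hz0).2.2]
      gcongr
    have hle : th z ≤ th y := by
      apply Finset.sum_le_sum
      intro i _
      rcases le_total i j with hij | hij
      · have : y ∉ oddS (σ.1 i).1 := fun h => hcon (hOmono i j hij h)
        rw [if_neg this]
        split_ifs <;> simp [hl0 i]
      · rw [if_pos (hOmono j i hij hz)]
        split_ifs <;> simp [hl0 i]
    have heq : en y = en z := by
      have h1 := le_antisymm hlt hle
      rw [(hmain y hy).2.2, (hmain z hz0).2.2, div_left_inj' hNp.ne'] at h1
      have : (en y : ℝ) = en z := by linarith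
      exact_mod_cast this
    rw [hen_inj y z hy hz0 heq] at hcon
    exact hcon hz
  let P : ℕ → Finset (Fin k × Fin (n' + 1)) := fun j => I0.filter fun y => en y < j
  have henI : Set.InjOn en I0 := by
    intro y hy z hz hyz
    simp only [I0, Finset.coe_filter, Finset.mem_univ, true_and] at hy hz
    exact hen_inj y z hy hz hyz
  have himg : I0.image en = Finset.range N := by
    apply Finset.eq_of_subset_of_card_le
    · intro a ha
      obtain ⟨y, hy, rfl⟩ := Finset.mem_image.1 ha
      rw [Finset.mem_range]
      apply hen_lt
      simpa [I0] using hy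
    · rw [Finset.card_range, Finset.card_image_of_injOn henI, hI0]
  have hO : ∀ j : Fin (N + 1), oddS (σ.1 j).1 = P j := by
    intro j
    apply Finset.eq_of_subset_of_card_le
    · intro z hz
      have hzI := hsub j hz
      rw [Finset.mem_filter]
      refine ⟨hzI, ?_⟩
      by_contra hge
      push Not at hge
      have hzlt : en z < N := hen_lt z (by simpa [I0] using hzI)
      -- the first (en z + 1) coordinates all belong to the odd set
      have h1 : P (en z + 1) ⊆ oddS (σ.1 j).1 := by
        intro y hy
        rw [Finset.mem_filter] at hy
        exact hdown j y z (by simpa [I0] using hy.1) hz (by omega)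
      have h2 : (P (en z + 1)).card = en z + 1 := by
        have : (P (en z + 1)).image en = Finset.range (en z + 1) := by
          ext a
          simp only [Finset.mem_image, Finset.mem_range, P, Finset.mem_filter]
          constructor
          · rintro ⟨y, hy, rfl⟩; exact hy.2
          · intro ha
            have : a ∈ I0.image en := by rw [himg, Finset.mem_range]; omega
            obtain ⟨y, hy, rfl⟩ := Finset.mem_image.1 this
            exact ⟨y, ⟨hy, ha⟩, rfl⟩
        have h9 := congrArg Finset.card this
        rwa [Finset.card_range, Finset.card_image_of_injOn
          (henI.mono (Finset.coe_subset.2 (Finset.filter_subset _ _)))] at h9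
      have h3 := Finset.card_le_card h1
      rw [h2, σ.2.1] at h3
      omega
    · rw [σ.2.1]
      have : (P j).image en ⊆ Finset.range j := by
        intro a ha
        obtain ⟨y, hy, rfl⟩ := Finset.mem_image.1 ha
        rw [Finset.mem_range]; exact (Finset.mem_filter.1 hy).2
      have h2 := Finset.card_le_card this
      rw [Finset.card_range, Finset.card_image_of_injOn] at h2
      · exact h2
      · exact henI.mono (Finset.coe_subset.2 (Finset.filter_subset _ _))
  rw [hmix j x, hO]
  obtain ⟨m1, m2, -⟩ := hmain x hx
  have hxI : x ∈ I0 := by simp [I0, hx]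
  by_cases hjx : (j : ℕ) ≤ en x
  · rw [if_neg, if_pos hjx, m2]
    rw [Finset.mem_filter]; omega
  · rw [if_pos, if_neg hjx, m1, add_zero]
    rw [Finset.mem_filter]; exact ⟨hxI, by omega⟩

/-- the standard cell chain -/
def stdCell (L : ℕ) (en : Fin k × Fin (n' + 1) → ℕ) (e : Fin k × Fin (n' + 1) → ℤ) (j : ℕ) :
    Fin k × Fin (n' + 1) → ℤ :=
  fun x => if x.2 = 0 then 2 * L else e x + if j ≤ en x then 1 else 0

theorem exists_stdFlag (en : Fin k × Fin (n' + 1) → ℕ)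
    (hen_lt : ∀ x, x.2 ≠ 0 → en x < N)
    (hen_inj : ∀ x y, x.2 ≠ 0 → y.2 ≠ 0 → en x = en y → x = y)
    (hN : N = k * n')
    (e : Fin k × Fin (n' + 1) → ℤ) (he : ∀ x, x.2 ≠ 0 → Odd (e x))
    (hb : ∀ x, x.2 ≠ 0 → |e x| + 1 ≤ 2 * L) :
    ∃ σ : CFlag k (n' + 1) L N, ∀ j, (σ.1 j).1 = stdCell L en e j := by
  classical
  have hX : ∀ j, InX L (stdCell L en e j) := by
    intro j
    refine ⟨fun x => ?_, fun i => ⟨0, ?_⟩⟩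
    · unfold stdCell
      by_cases hx : x.2 = 0
      · rw [if_pos hx]; simp
      · rw [if_neg hx]
        have h1 := hb x hx
        have h2 := abs_add_le (e x) (if j ≤ en x then 1 else 0)
        have h3 : |(if j ≤ en x then 1 else 0 : ℤ)| ≤ 1 := by split_ifs <;> simp
        omega
    · simp [stdCell]
  have hodd : ∀ j x, x ∈ oddS (stdCell L en e j) ↔ x.2 ≠ 0 ∧ en x < j := by
    intro j x
    rw [mem_oddS]
    unfold stdCell
    by_cases hx : x.2 = 0
    · simp [hx]
    · have := he x hx
      rw [if_neg hx]
      by_cases hj : j ≤ en x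
      · simp only [hj, if_true, hx, ne_eq, not_false_eq_true, true_and, not_lt.2 hj, iff_false]
        grind
      · simp only [hj, if_false, hx, ne_eq, not_false_eq_true, true_and, not_le.1 hj, iff_true]
        simpa using this
  let I0 : Finset (Fin k × Fin (n' + 1)) := Finset.univ.filter fun x => x.2 ≠ 0
  have hI0 : I0.card = N := by
    have : I0 = Finset.univ ×ˢ (Finset.univ.erase 0) := by
      ext x; simp [I0]
    rw [this, Finset.card_product, Finset.card_erase_of_mem (Finset.mem_univ _)]
    simp [hN]
  have henI : Set.InjOn en I0 := by
    intro y hy z hz hyz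
    simp only [I0, Finset.coe_filter, Finset.mem_univ, true_and] at hy hz
    exact hen_inj y z hy hz hyz
  have himg : I0.image en = Finset.range N := by
    apply Finset.eq_of_subset_of_card_le
    · intro a ha
      obtain ⟨y, hy, rfl⟩ := Finset.mem_image.1 ha
      rw [Finset.mem_range]
      apply hen_lt
      simpa [I0] using hy
    · rw [Finset.card_range, Finset.card_image_of_injOn henI, hI0]
  refine ⟨⟨fun j => ⟨stdCell L en e j, hX j⟩, ?_, ?_⟩, fun j => rfl⟩
  · intro j
    have : (oddS (stdCell L en e j)).image en = Finset.range j := by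
      ext a
      simp only [Finset.mem_image, Finset.mem_range, hodd]
      constructor
      · rintro ⟨y, hy, rfl⟩; exact hy.2
      · intro ha
        have : a ∈ I0.image en := by rw [himg, Finset.mem_range]; omega
        obtain ⟨y, hy, rfl⟩ := Finset.mem_image.1 this
        exact ⟨y, ⟨by simpa [I0] using hy, ha⟩, rfl⟩
    rw [← Finset.card_range (j : ℕ), ← this, Finset.card_image_of_injOn]
    exact henI.mono (by
      intro y hy
      have := (hodd j y).1 hy
      simp [I0, this.1])
  · intro a b hab x
    unfold stdCell
    by_cases hx : x.2 = 0
    · left; simp [hx]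
    · have hab' : (a : ℕ) ≤ b := hab
      simp only [hx, if_false]
      by_cases h1 : (a : ℕ) ≤ en x
      · by_cases h2 : (b : ℕ) ≤ en x
        · left; simp [h1, h2]
        · right; simp [h1, h2, he x hx]
      · have h2 : ¬ (b : ℕ) ≤ en x := by omega
        left; simp [h1, h2]

end

end

section

section
variable {k n : ℕ}

/-- signed permutation action on real arrays -/
def xact (g : SP k) (p : Fin k × Fin n → ℝ) : Fin k × Fin n → ℝ :=
  fun x => ((g.sgn x.1 : ℤ) : ℝ) * p (g.perm x.1, x.2)

theorem xact_one (p : Fin k × Fin n → ℝ) : xact 1 p = p := by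
  funext x; simp [xact, SP.one_sgn, SP.one_perm]

theorem xact_mul (g h : SP k) (p : Fin k × Fin n → ℝ) : xact (g * h) p = xact g (xact h p) := by
  funext x; simp [xact, SP.mul_sgn, SP.mul_perm, mul_assoc]

theorem xact_sub (g : SP k) (p q : Fin k × Fin n → ℝ) : xact g (p - q) = xact g p - xact g q := by
  funext x; simp [xact, mul_sub]

theorem xact_continuous (g : SP k) : Continuous (xact (n := n) g) := by
  unfold xact; fun_prop

theorem abs_sgn (u : ℤˣ) : |((u : ℤ) : ℝ)| = 1 := by
  rcases Int.units_eq_one_or u with h | h <;> simp [h]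

theorem xact_norm_le (g : SP k) (p : Fin k × Fin n → ℝ) : ‖xact g p‖ ≤ ‖p‖ := by
  rw [pi_norm_le_iff_of_nonneg (norm_nonneg _)]
  intro x
  unfold xact
  rw [norm_mul, Real.norm_eq_abs, abs_sgn, one_mul]
  exact norm_le_pi_norm p _

theorem xact_norm (g : SP k) (p : Fin k × Fin n → ℝ) : ‖xact g p‖ = ‖p‖ := by
  apply le_antisymm (xact_norm_le g p)
  have := xact_norm_le g⁻¹ (xact g p)
  rwa [← xact_mul, inv_mul_cancel, xact_one] at this

/-- the product of cube boundaries -/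
def InXR (p : Fin k × Fin n → ℝ) : Prop := (∀ x, |p x| ≤ 1) ∧ ∀ i, ∃ s, |p (i, s)| = 1

theorem InXR_xact (g : SP k) {p : Fin k × Fin n → ℝ} (h : InXR p) : InXR (xact g p) := by
  refine ⟨fun x => ?_, fun i => ?_⟩
  · unfold xact; rw [abs_mul, abs_sgn, one_mul]; exact h.1 _
  · obtain ⟨s, hs⟩ := h.2 (g.perm i)
    exact ⟨s, by unfold xact; rw [abs_mul, abs_sgn, one_mul]; exact hs⟩

theorem isCompact_InXR : IsCompact {p : Fin k × Fin n → ℝ | InXR p} := by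
  apply IsCompact.of_isClosed_subset (isCompact_closedBall (0 : Fin k × Fin n → ℝ) 1)
  · have : {p : Fin k × Fin n → ℝ | InXR p} = (⋂ x, {p | |p x| ≤ 1}) ∩ ⋂ i, ⋃ s, {p | |p (i, s)| = 1} := by
      ext p; simp [InXR]
    rw [this]
    apply IsClosed.inter
    · exact isClosed_iInter fun x => isClosed_le (by fun_prop) continuous_const
    · exact isClosed_iInter fun i => isClosed_iUnion_of_finite fun s =>
        isClosed_eq (by fun_prop) continuous_const
  · intro p hp
    rw [mem_closedBall_zero_iff, pi_norm_le_iff_of_nonneg zero_le_one]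
    exact fun x => hp.1 x

/-- geometric position of a cell -/
def pt (L : ℕ) (c : Fin k × Fin n → ℤ) : Fin k × Fin n → ℝ := fun x => (c x : ℝ) / (2 * L)

theorem pt_cact (L : ℕ) (g : SP k) (c : Fin k × Fin n → ℤ) : pt L (cact g c) = xact g (pt L c) := by
  funext x; simp [pt, cact, xact]; ring

theorem pt_InXR {L : ℕ} (hL : 1 ≤ L) {c : Fin k × Fin n → ℤ} (h : InX L c) : InXR (pt L c) := by
  have hL' : (0 : ℝ) < 2 * L := by have : (1 : ℝ) ≤ L := by exact_mod_cast hL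
                                   linarith
  refine ⟨fun x => ?_, fun i => ?_⟩
  · unfold pt; rw [abs_div, abs_of_pos hL', div_le_one hL']
    have := h.1 x
    exact_mod_cast this
  · obtain ⟨s, hs⟩ := h.2 i
    refine ⟨s, ?_⟩
    unfold pt; rw [abs_div, abs_of_pos hL', div_eq_one_iff_eq hL'.ne']
    exact_mod_cast hs

theorem pt_face {L : ℕ} (hL : 1 ≤ L) {c c' : Fin k × Fin n → ℤ} (h : face c c') :
    ‖pt L c - pt L c'‖ ≤ 1 / (2 * L) := by
  have hL' : (0 : ℝ) < 2 * L := by have : (1 : ℝ) ≤ L := by exact_mod_cast hL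
                                   linarith
  rw [pi_norm_le_iff_of_nonneg (by positivity)]
  intro x
  simp only [pt, Pi.sub_apply, ← sub_div]
  rw [norm_div, Real.norm_eq_abs, Real.norm_eq_abs, abs_of_pos hL']
  gcongr
  rcases h x with h | ⟨-, h⟩
  · simp [h]
  · have : |(c x - c' x : ℤ)| ≤ 1 := h.le
    exact_mod_cast this

theorem pt_flag {L N : ℕ} (hL : 1 ≤ L) (σ : CFlag k n L N) (a b : Fin (N + 1)) :
    ‖pt L (σ.1 a).1 - pt L (σ.1 b).1‖ ≤ 1 / (2 * L) := by
  rcases le_total a b with h | h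
  · exact pt_face hL (σ.2.2 a b h)
  · rw [norm_sub_rev]; exact pt_face hL (σ.2.2 b a h)

theorem isFree_pt {L : ℕ} {c : Cell k n L} (h : ¬ IsFree (SP k) c) :
    ∃ g : SP k, g ≠ 1 ∧ xact g (pt L c.1) = pt L c.1 := by
  unfold IsFree at h
  push Not at h
  obtain ⟨g, h1, h2⟩ := h
  refine ⟨g, h2, ?_⟩
  rw [← pt_cact, ← cell_smul_val, h1]

/-- existence of the piecewise linearised vertex map -/
theorem exists_b0 {L : ℕ} {V R : Type} [AddCommGroup V] [Module ℝ V] (ρ : SP k →* (V →ₗ[ℝ] V))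
    (f0 : (Fin k × Fin n → ℝ) → V) (hf0 : ∀ g x, f0 (xact g x) = ρ g (f0 x))
    (r : R → Fin k × Fin n → ℝ) (T : R → (Fin k × Fin n → ℝ) → V) (δ : ℝ)
    (hsep : ∀ (g h : SP k) a b, ‖xact g (r a) - xact h (r b)‖ ≤ 2 * δ → g = h ∧ a = b) :
    ∃ b0 : Cell k n L → V, (∀ (g : SP k) c, b0 (g • c) = ρ g (b0 c)) ∧
      (∀ a c, ‖pt L c.1 - r a‖ ≤ δ → b0 c = T a (pt L c.1)) ∧
      (∀ c, (∀ g a, δ < ‖pt L c.1 - xact g (r a)‖) → b0 c = f0 (pt L c.1)) := by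
  classical
  let Q : Cell k n L → SP k × R → Prop := fun c z => ‖pt L c.1 - xact z.1 (r z.2)‖ ≤ δ
  have hQ1 : ∀ c z z', Q c z → Q c z' → z = z' := by
    intro c z z' h h'
    have : ‖xact z.1 (r z.2) - xact z'.1 (r z'.2)‖ ≤ 2 * δ := by
      have e : xact z.1 (r z.2) - xact z'.1 (r z'.2) =
        (pt L c.1 - xact z'.1 (r z'.2)) - (pt L c.1 - xact z.1 (r z.2)) := by abel
      rw [e]
      refine (norm_sub_le _ _).trans ?_
      simp only [Q] at h h'
      linarith
    obtain ⟨h1, h2⟩ := hsep _ _ _ _ this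
    exact Prod.ext h1 h2
  have hQ2 : ∀ g c z, Q c z → Q (g • c) (g * z.1, z.2) := by
    intro g c z h
    simp only [Q, cell_smul_val, pt_cact, xact_mul, ← xact_sub, xact_norm] at h ⊢
    exact h
  let b0 : Cell k n L → V := fun c => if h : ∃ z, Q c z then
    ρ h.choose.1 (T h.choose.2 (xact h.choose.1⁻¹ (pt L c.1))) else f0 (pt L c.1)
  have hb : ∀ c z, Q c z → b0 c = ρ z.1 (T z.2 (xact z.1⁻¹ (pt L c.1))) := by
    intro c z hz
    have hex : ∃ z, Q c z := ⟨z, hz⟩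
    simp only [b0, dif_pos hex]
    rw [hQ1 c _ _ hex.choose_spec hz]
  have hb' : ∀ c, (¬ ∃ z, Q c z) → b0 c = f0 (pt L c.1) := fun c h => dif_neg h
  refine ⟨b0, ?_, ?_, ?_⟩
  · intro g c
    by_cases h : ∃ z, Q c z
    · obtain ⟨z, hz⟩ := h
      rw [hb _ _ (hQ2 g c z hz), hb _ _ hz, map_mul, cell_smul_val, pt_cact, ← xact_mul]
      simp
    · have : ¬ ∃ z, Q (g • c) z := by
        rintro ⟨z, hz⟩
        exact h ⟨_, by simpa using hQ2 g⁻¹ _ z hz⟩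
      rw [hb' _ this, hb' _ h, cell_smul_val, pt_cact, hf0]
  · intro a c h
    rw [hb c (1, a) (by simpa only [Q, xact_one] using h)]
    simp [xact_one]
  · intro c h
    apply hb'
    rintro ⟨z, hz⟩
    exact absurd (h z.1 z.2) (not_lt.2 hz)

end

section
variable {k n' L N : ℕ} {V : Type} [AddCommGroup V] [Module ℝ V]

/-- the base point, slightly moved to generic position -/
def ppt (L N : ℕ) (en : Fin k × Fin (n' + 1) → ℕ) (e : Fin k × Fin (n' + 1) → ℤ) :
    Fin k × Fin (n' + 1) → ℝ :=
  fun x => if x.2 = 0 then 1 else (e x + (en x + 1) / (2 * N + 2)) / (2 * L)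

theorem chart_flag_eq (hL : 1 ≤ L) (en : Fin k × Fin (n' + 1) → ℕ)
    (hen_lt : ∀ x, x.2 ≠ 0 → en x < N)
    (hen_inj : ∀ x y, x.2 ≠ 0 → y.2 ≠ 0 → en x = en y → x = y)
    (hN : N = k * n')
    (e : Fin k × Fin (n' + 1) → ℤ) (he : ∀ x, x.2 ≠ 0 → Odd (e x))
    (T : (Fin k × Fin (n' + 1) → ℝ) →ₗ[ℝ] V) (hT : ∀ y, (∀ i, y (i, 0) = 0) → T y = 0 → y = 0)
    (σ : CFlag k (n' + 1) L N) (hch : ∀ j i, pt L (σ.1 j).1 (i, 0) = 1)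
    (hh : InHull (fun j => T (pt L (σ.1 j).1 - ppt L N en e))) (j : Fin (N + 1)) :
    (σ.1 j).1 = stdCell L en e j := by
  have hL' : (0 : ℝ) < 2 * L := by have : (1 : ℝ) ≤ L := by exact_mod_cast hL
                                   linarith
  have hch' : ∀ j i, (σ.1 j).1 (i, 0) = 2 * L := by
    intro j i
    have := hch j i
    unfold pt at this
    rw [div_eq_one_iff_eq hL'.ne'] at this
    exact_mod_cast this
  obtain ⟨l, h0, hne, hs⟩ := hh
  obtain ⟨j0, hj0⟩ := Function.ne_iff.1 hne
  have hj0' : 0 < l j0 := lt_of_le_of_ne (h0 j0) (Ne.symm hj0)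
  have hpos : 0 < ∑ j, l j := Finset.sum_pos' (fun j _ => h0 j) ⟨j0, Finset.mem_univ _, hj0'⟩
  set S := ∑ j, l j with hS
  have h1 : ∑ j, l j • (pt L (σ.1 j).1 - ppt L N en e) = 0 := by
    apply hT
    · intro i
      simp [Finset.sum_apply, hch, ppt]
    · simpa only [map_sum, map_smul] using hs
  have h2 : ∀ x, x.2 ≠ 0 → ∑ j, (l j / S) * ((σ.1 j).1 x : ℝ) = e x + (en x + 1) / (2 * N + 2) := by
    intro x hx
    have := congrFun h1 x
    simp only [Finset.sum_apply, Pi.smul_apply, Pi.sub_apply, smul_eq_mul, Pi.zero_apply, pt, ppt, hx,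
      if_false, ← sub_div, mul_sub, mul_div_assoc', ← Finset.sum_div, Finset.sum_sub_distrib,
      ← Finset.sum_mul, ← hS] at this
    rw [div_eq_zero_iff, or_iff_left hL'.ne', sub_eq_zero] at this
    have e1 : ∑ j, (l j / S) * ((σ.1 j).1 x : ℝ) = (∑ j, l j * ((σ.1 j).1 x : ℝ)) / S := by
      rw [Finset.sum_div]; exact Finset.sum_congr rfl fun j _ => by ring
    rw [e1, this, mul_div_cancel_left₀ _ hpos.ne']
  funext x
  unfold stdCell
  by_cases hx : x.2 = 0
  · rw [if_pos hx]
    have : x = (x.1, 0) := by ext <;> simp [hx]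
    rw [this, hch']
  · rw [if_neg hx]
    exact flag_unique en hen_lt hen_inj hN e he σ hch' (fun j => l j / S)
      (fun j => div_nonneg (h0 j) hpos.le) (by rw [← Finset.sum_div, div_self hpos.ne']) h2 j x hx

theorem std_nonDeg (hL : 1 ≤ L) (en : Fin k × Fin (n' + 1) → ℕ)
    (hen_lt : ∀ x, x.2 ≠ 0 → en x < N)
    (hen_surj : ∀ m < N, ∃ x, x.2 ≠ 0 ∧ en x = m)
    (e : Fin k × Fin (n' + 1) → ℤ)
    (T : (Fin k × Fin (n' + 1) → ℝ) →ₗ[ℝ] V) (hT : ∀ y, (∀ i, y (i, 0) = 0) → T y = 0 → y = 0) :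
    NonDeg (fun j : Fin (N + 1) => T (pt L (stdCell L en e j) - ppt L N en e)) := by
  have hL' : (0 : ℝ) < 2 * L := by have : (1 : ℝ) ≤ L := by exact_mod_cast hL
                                   linarith
  have hNp : (0 : ℝ) < 2 * N + 2 := by positivity
  have hval : ∀ (j : Fin (N + 1)) x, x.2 ≠ 0 → (pt L (stdCell L en e j) - ppt L N en e) x =
      ((if (j : ℕ) ≤ en x then 1 else 0) - (en x + 1) / (2 * N + 2)) / (2 * L) := by
    intro j x hx
    simp only [pt, ppt, stdCell, Pi.sub_apply, hx, if_false]
    push_cast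
    rw [← sub_div]
    congr 1
    split_ifs <;> simp
  have hval0 : ∀ (j : Fin (N + 1)) i, (pt L (stdCell L en e j) - ppt L N en e) (i, 0) = 0 := by
    intro j i
    simp [pt, ppt, stdCell, div_self hL'.ne']
  constructor
  · let l : Fin (N + 1) → ℝ := fun j => if (j : ℕ) < N then 1 else N + 2
    have hl : ∑ j, l j = 2 * N + 2 := by
      rw [Fin.sum_univ_castSucc]
      simp [l]; ring
    have hl2 : ∀ m < N, ∑ j, l j * (if (j : ℕ) ≤ m then (1 : ℝ) else 0) = m + 1 := by
      intro m hm
      rw [Fin.sum_univ_castSucc]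
      simp only [l, Fin.val_castSucc, Fin.is_lt, if_true, one_mul, Fin.val_last, lt_irrefl, if_false,
        not_le.2 hm, mul_zero, add_zero]
      rw [Fin.sum_univ_eq_sum_range (fun j => if j ≤ m then (1 : ℝ) else 0) N, Finset.sum_boole]
      have : Finset.filter (fun j => j ≤ m) (Finset.range N) = Finset.range (m + 1) := by
        ext j; simp; omega
      rw [this]; simp
    refine ⟨l, fun j => by simp only [l]; split_ifs <;> positivity, ?_⟩
    have : ∑ j, l j • (pt L (stdCell L en e j) - ppt L N en e) = 0 := by
      funext x
      simp only [Finset.sum_apply, Pi.smul_apply, smul_eq_mul, Pi.zero_apply]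
      by_cases hx : x.2 = 0
      · have hx' : x = (x.1, 0) := by ext <;> simp [hx]
        rw [hx']; simp [-Pi.sub_apply, hval0]
      · simp only [hval _ _ hx, mul_div_assoc', ← Finset.sum_div, mul_sub, Finset.sum_sub_distrib,
          ← Finset.sum_mul, hl, hl2 _ (hen_lt x hx)]
        rw [mul_div_cancel_left₀ _ hNp.ne']; simp
    rw [← map_zero T, ← this, map_sum]
    simp only [map_smul]
  · intro l h1 h2
    have h3 : ∑ j, l j • (pt L (stdCell L en e j) - ppt L N en e) = 0 := by
      apply hT
      · intro i
        simp [Finset.sum_apply, -Pi.sub_apply, hval0]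
      · simpa only [map_sum, map_smul] using h1
    have h4 : ∀ m : ℕ, m < N → ∑ j : Fin (N + 1), l j * (if (j : ℕ) ≤ m then (1 : ℝ) else 0) = 0 := by
      intro m hm
      obtain ⟨x, hx, rfl⟩ := hen_surj m hm
      have := congrFun h3 x
      simp only [Finset.sum_apply, Pi.smul_apply, smul_eq_mul, Pi.zero_apply, hval _ _ hx,
        mul_div_assoc', ← Finset.sum_div, mul_sub, Finset.sum_sub_distrib, h2, zero_div, sub_zero,
          ← Finset.sum_mul, zero_mul] at this
      rwa [div_eq_zero_iff, or_iff_left hL'.ne'] at this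
    have h4' : ∀ m : ℕ, m ≤ N → ∑ j : Fin (N + 1), l j * (if (j : ℕ) ≤ m then (1 : ℝ) else 0) = 0 := by
      intro m hm
      rcases hm.lt_or_eq with h | h
      · exact h4 m h
      · rw [← h2]
        apply Finset.sum_congr rfl
        intro j _
        rw [if_pos (by have := j.2; omega), mul_one]
    funext j
    have key : l j = ∑ i : Fin (N + 1), l i * (if (i : ℕ) ≤ j then (1 : ℝ) else 0) -
        ∑ i : Fin (N + 1), l i * (if (i : ℕ) < j then (1 : ℝ) else 0) := by
      rw [← Finset.sum_sub_distrib, Finset.sum_eq_single j]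
      · simp
      · intro i _ hij
        have : (i : ℕ) ≠ j := fun h => hij (Fin.ext h)
        have : (i : ℕ) ≤ j ↔ (i : ℕ) < j := by omega
        simp [this]
      · simp
    rw [key, h4' j (by have := j.2; omega)]
    rcases Nat.eq_zero_or_pos (j : ℕ) with h | h
    · simp [h]
    · have := h4' (j - 1) (by have := j.2; omega)
      have e1 : ∀ i : ℕ, i < (j : ℕ) ↔ i ≤ j - 1 := fun i => by omega
      simp only [e1, this]; simp

end
end

section

set_option linter.unusedSectionVars false
section
variable {k n' : ℕ} {V R : Type} [NormedAddCommGroup V] [NormedSpace ℝ V] [FiniteDimensional ℝ V]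
  [Fintype R]

theorem compact_pos {α : Type*} [TopologicalSpace α] {K : Set α} (hK : IsCompact K) {F : α → V}
    (hF : Continuous F) (h : ∀ x ∈ K, F x ≠ 0) : ∃ δ > 0, ∀ x ∈ K, δ ≤ ‖F x‖ := by
  obtain ⟨δ, h1, h2⟩ := hK.exists_forall_le' (f := fun x => ‖F x‖) (a := 0) hF.norm.continuousOn
    (fun x hx => norm_pos_iff.2 (h x hx))
  exact ⟨δ, h1, h2⟩

theorem chart_bound (T : (Fin k × Fin (n' + 1) → ℝ) →L[ℝ] V)
    (hT : ∀ y, (∀ i, y (i, 0) = 0) → T y = 0 → y = 0) :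
    ∃ lam > 0, ∀ y, (∀ i, y (i, 0) = 0) → lam * ‖y‖ ≤ ‖T y‖ := by
  let K : Set (Fin k × Fin (n' + 1) → ℝ) := Metric.sphere 0 1 ∩ {y | ∀ i, y (i, 0) = 0}
  have hK : IsCompact K := (isCompact_sphere 0 1).inter_right (by
    have : {y : Fin k × Fin (n' + 1) → ℝ | ∀ i, y (i, 0) = 0} = ⋂ i, {y | y (i, 0) = 0} := by
      ext; simp
    rw [this]
    exact isClosed_iInter fun i => isClosed_eq (by fun_prop) continuous_const)
  obtain ⟨lam, h1, h2⟩ := compact_pos hK T.continuous (by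
    intro y hy h
    have := hT y hy.2 h
    have h3 := hy.1
    simp [this] at h3)
  refine ⟨lam, h1, fun y hy => ?_⟩
  by_cases h0 : y = 0
  · simp [h0]
  · have hn : 0 < ‖y‖ := norm_pos_iff.2 h0
    have := h2 (‖y‖⁻¹ • y) ⟨by simp [norm_smul, hn.ne'], fun i => by simp [hy i]⟩
    rw [map_smul, norm_smul, norm_inv, norm_norm, inv_mul_eq_div, le_div_iff₀ hn] at this
    exact this

open Filter Topology in
theorem top_consts (f0 : (Fin k × Fin (n' + 1) → ℝ) → V)
    (r : R → Fin k × Fin (n' + 1) → ℝ) (hr0 : ∀ a i, r a (i, 0) = 1)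
    (hr1 : ∀ a x, x.2 ≠ 0 → |r a x| < 1)
    (hsep : ∀ g h a b, xact g (r a) = xact h (r b) → g = h ∧ a = b)
    (T : R → (Fin k × Fin (n' + 1) → ℝ) →L[ℝ] V) (hr : ∀ a, f0 (r a) = 0)
    (hT : ∀ a, HasFDerivAt f0 (T a) (r a))
    (hTi : ∀ a y, (∀ i, y (i, 0) = 0) → T a y = 0 → y = 0) :
    ∃ lam A δ : ℝ, 0 < lam ∧ 0 < A ∧ 0 < δ ∧
      (∀ a y, (∀ i, y (i, 0) = 0) → lam * ‖y‖ ≤ ‖T a y‖) ∧ (∀ a y, ‖T a y‖ ≤ A * ‖y‖) ∧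
      (∀ g h a b, ‖xact g (r a) - xact h (r b)‖ ≤ 6 * δ → g = h ∧ a = b) ∧
      (∀ a x, x.2 ≠ 0 → |r a x| + 3 * δ < 1) ∧ 3 * δ < 1 ∧
      (∀ a x, ‖x - r a‖ ≤ 3 * δ → ‖f0 x - T a (x - r a)‖ ≤ lam / 8 * ‖x - r a‖) := by
  choose lam0 hl0 hl1 using fun a => chart_bound (T a) (hTi a)
  obtain ⟨lam, hlam, hlam'⟩ : ∃ lam > 0, ∀ a, lam ≤ lam0 a := by
    have : ∀ᶠ x in 𝓝[>] (0 : ℝ), ∀ a, x ≤ lam0 a := by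
      rw [eventually_all]
      intro a
      filter_upwards [Ioo_mem_nhdsGT (hl0 a)] with x hx using hx.2.le
    obtain ⟨x, hx, hx0⟩ := (this.and self_mem_nhdsWithin).exists
    exact ⟨x, hx0, hx⟩
  have hA : ∃ A : ℝ, 0 < A ∧ ∀ a, ‖T a‖ ≤ A := by
    refine ⟨1 + ∑ a, ‖T a‖, ?_, fun a => ?_⟩
    · have : 0 ≤ ∑ a, ‖T a‖ := Finset.sum_nonneg fun a _ => norm_nonneg _
      linarith
    · have := Finset.single_le_sum (f := fun a => ‖T a‖) (fun a _ => norm_nonneg _) (Finset.mem_univ a)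
      linarith
  obtain ⟨A, hA, hA'⟩ := hA
  have ht : Tendsto (fun δ : ℝ => 6 * δ) (𝓝[>] 0) (𝓝 0) := by
    have : Tendsto (fun δ : ℝ => 6 * δ) (𝓝 0) (𝓝 (6 * 0)) := (continuous_const.mul continuous_id).tendsto 0
    rw [mul_zero] at this
    exact this.mono_left nhdsWithin_le_nhds
  have ht3 : Tendsto (fun δ : ℝ => 3 * δ) (𝓝[>] 0) (𝓝 0) := by
    have : Tendsto (fun δ : ℝ => 3 * δ) (𝓝 0) (𝓝 (3 * 0)) := (continuous_const.mul continuous_id).tendsto 0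
    rw [mul_zero] at this
    exact this.mono_left nhdsWithin_le_nhds
  have e1 : ∀ᶠ δ in 𝓝[>] (0 : ℝ), ∀ g h a b, ‖xact g (r a) - xact h (r b)‖ ≤ 6 * δ → g = h ∧ a = b := by
    simp only [eventually_all]
    intro g h a b
    by_cases heq : xact g (r a) = xact h (r b)
    · exact Eventually.of_forall fun δ _ => hsep _ _ _ _ heq
    · have : 0 < ‖xact g (r a) - xact h (r b)‖ := norm_pos_iff.2 (sub_ne_zero.2 heq)
      filter_upwards [ht.eventually_lt_const this] with δ hδ h'
      exact absurd h' (not_le.2 hδ)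
  have e2 : ∀ᶠ δ in 𝓝[>] (0 : ℝ), ∀ a x, x.2 ≠ 0 → |r a x| + 3 * δ < 1 := by
    simp only [eventually_all]
    intro a x hx
    have : 0 < 1 - |r a x| := by linarith [hr1 a x hx]
    filter_upwards [ht3.eventually_lt_const this] with δ hδ
    linarith
  have e3 : ∀ᶠ δ in 𝓝[>] (0 : ℝ), 3 * δ < 1 := ht3.eventually_lt_const zero_lt_one
  have e4 : ∀ᶠ δ in 𝓝[>] (0 : ℝ), ∀ a x, ‖x - r a‖ ≤ 3 * δ →
      ‖f0 x - T a (x - r a)‖ ≤ lam / 8 * ‖x - r a‖ := by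
    rw [eventually_all]
    intro a
    have h1 := (hT a).isLittleO.def (show 0 < lam / 8 by positivity)
    simp only [hr, sub_zero] at h1
    rw [Metric.eventually_nhds_iff] at h1
    obtain ⟨η, hη, h1⟩ := h1
    filter_upwards [ht3.eventually_lt_const hη] with δ hδ x hx
    exact h1 (by rw [dist_eq_norm]; exact hx.trans_lt hδ)
  obtain ⟨δ, ⟨⟨⟨h1, h2⟩, h3⟩, h4⟩, h5⟩ := ((((e1.and e2).and e3).and e4).and self_mem_nhdsWithin).exists
  refine ⟨lam, A, δ, hlam, hA, h5, ?_, ?_, h1, h2, h3, h4⟩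
  · intro a y hy
    exact (mul_le_mul_of_nonneg_right (hlam' a) (norm_nonneg _)).trans (hl1 a y hy)
  · intro a y
    exact ((T a).le_opNorm y).trans (mul_le_mul_of_nonneg_right (hA' a) (norm_nonneg _))

theorem exists_en {N : ℕ} (hN : N = k * n') : ∃ en : Fin k × Fin (n' + 1) → ℕ,
    (∀ x, x.2 ≠ 0 → en x < N) ∧ (∀ x y, x.2 ≠ 0 → y.2 ≠ 0 → en x = en y → x = y) ∧
    (∀ m < N, ∃ x, x.2 ≠ 0 ∧ en x = m) := by
  classical
  have hc : Fintype.card {x : Fin k × Fin (n' + 1) // x.2 ≠ 0} = N := by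
    rw [Fintype.card_subtype]
    have : (Finset.univ.filter fun x : Fin k × Fin (n' + 1) => x.2 ≠ 0) =
        Finset.univ ×ˢ (Finset.univ.erase 0) := by
      ext x; simp
    rw [this, Finset.card_product, Finset.card_erase_of_mem (Finset.mem_univ _)]
    simp [hN]
  let E := Fintype.equivFinOfCardEq hc
  refine ⟨fun x => if h : x.2 ≠ 0 then E ⟨x, h⟩ else 0, ?_, ?_, ?_⟩
  · intro x hx; simp only [hx, dif_pos, ne_eq, not_false_eq_true]; exact (E _).2
  · intro x y hx hy h
    simp only [hx, hy, dif_pos, ne_eq, not_false_eq_true] at h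
    have := E.injective (Fin.ext h)
    exact congrArg Subtype.val this
  · intro m hm
    refine ⟨(E.symm ⟨m, hm⟩).1, (E.symm ⟨m, hm⟩).2, ?_⟩
    beta_reduce
    rw [dif_pos (E.symm ⟨m, hm⟩).2]
    simp

theorem nonDeg_map {J V : Type*} [Fintype J] [AddCommGroup V] [Module ℝ V] {w w' : J → V}
    (h : NonDeg w) (T : V →ₗ[ℝ] V) (hT : Function.Injective T) (hw : ∀ j, w' j = T (w j)) : NonDeg w' := by
  obtain ⟨⟨l, h1, h2⟩, h3⟩ := h
  have key : ∀ l : J → ℝ, ∑ j, l j • w' j = T (∑ j, l j • w j) := by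
    intro l; rw [map_sum]; simp [hw]
  refine ⟨⟨l, h1, by rw [key, h2, map_zero]⟩, fun l h4 h5 => h3 l ?_ h5⟩
  rw [key, ← map_zero T] at h4
  exact hT h4

theorem NonDeg.inHull {J V : Type*} [Fintype J] [Nonempty J] [AddCommGroup V] [Module ℝ V] {w : J → V}
    (h : NonDeg w) : InHull w := by
  obtain ⟨⟨l, h1, h2⟩, -⟩ := h
  refine ⟨l, fun j => (h1 j).le, ?_, h2⟩
  intro h
  obtain ⟨j⟩ := ‹Nonempty J›
  exact (h1 j).ne' (congrFun h j)

end
end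

section

set_option linter.unusedSectionVars false
section
variable {k n' : ℕ} {V R : Type} [NormedAddCommGroup V] [NormedSpace ℝ V] [FiniteDimensional ℝ V]
  [Fintype R]

theorem near_ppt {L N : ℕ} (hL : 1 ≤ L) (en : Fin k × Fin (n' + 1) → ℕ)
    (hen_lt : ∀ x, x.2 ≠ 0 → en x < N)
    (r : Fin k × Fin (n' + 1) → ℝ) (hr0 : ∀ i, r (i, 0) = 1)
    (e : Fin k × Fin (n' + 1) → ℤ) (he : ∀ x, e x = 2 * ⌊L * r x⌋ + 1) :
    ‖ppt L N en e - r‖ ≤ 2 * (1 / (2 * L)) ∧ ∀ j, ‖pt L (stdCell L en e j) - r‖ ≤ 2 * (1 / (2 * L)) := by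
  have hL' : (0 : ℝ) < L := by have : (1 : ℝ) ≤ L := by exact_mod_cast hL
                               linarith
  have gen : ∀ x (u : ℝ), 0 ≤ u → u ≤ 1 → ‖(e x + u) / (2 * L) - r x‖ ≤ 2 * (1 / (2 * L)) := by
    intro x u h0 h1
    have h2 := Int.floor_le (L * r x)
    have h3 := Int.lt_floor_add_one (L * r x)
    have e1 : (e x + u) / (2 * L) - r x = (e x + u - 2 * (L * r x)) * (1 / (2 * L)) := by
      field_simp
    rw [e1, norm_mul, Real.norm_of_nonneg (show (0 : ℝ) ≤ 1 / (2 * L) by positivity)]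
    gcongr
    rw [he, Real.norm_eq_abs, abs_le]
    push_cast
    constructor <;> linarith
  have hx0 : ∀ x : Fin k × Fin (n' + 1), x.2 = 0 → r x = 1 := by
    intro x hx
    have : x = (x.1, 0) := by ext <;> simp [hx]
    rw [this, hr0]
  constructor
  · rw [pi_norm_le_iff_of_nonneg (by positivity)]
    intro x
    rw [Pi.sub_apply]
    unfold ppt
    by_cases hx : x.2 = 0
    · rw [if_pos hx, hx0 x hx]; simp
    · rw [if_neg hx]
      apply gen
      · positivity
      · have : (en x : ℝ) < N := by exact_mod_cast hen_lt x hx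
        have h2 : (0 : ℝ) ≤ N := Nat.cast_nonneg N
        rw [div_le_one (by positivity)]; linarith
  · intro j
    rw [pi_norm_le_iff_of_nonneg (by positivity)]
    intro x
    rw [Pi.sub_apply]
    unfold pt stdCell
    by_cases hx : x.2 = 0
    · rw [if_pos hx, hx0 x hx]; push_cast; rw [div_self (by positivity)]; simp
    · rw [if_neg hx]
      have := gen x (if j ≤ en x then 1 else 0) (by split_ifs <;> simp) (by split_ifs <;> simp)
      push_cast
      exact this

theorem top_thm {N : ℕ} (hN : N = k * n') (hN1 : 1 ≤ N) (hV : Module.finrank ℝ V = N)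
    (ρ : SP k →* (V →ₗ[ℝ] V)) (f0 f1 : (Fin k × Fin (n' + 1) → ℝ) → V)
    (c0 : Continuous f0) (c1 : Continuous f1)
    (q0 : ∀ g x, f0 (xact g x) = ρ g (f0 x)) (q1 : ∀ g x, f1 (xact g x) = ρ g (f1 x))
    (hnf : ∀ x, InXR x → ∀ g : SP k, g ≠ 1 → xact g x = x → ∀ s : ℝ, 0 ≤ s → s ≤ 1 →
      (1 - s) • f0 x + s • f1 x ≠ 0)
    (r : R → Fin k × Fin (n' + 1) → ℝ) (hr0 : ∀ a i, r a (i, 0) = 1)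
    (hr1 : ∀ a x, x.2 ≠ 0 → |r a x| < 1)
    (hsep : ∀ g h a b, xact g (r a) = xact h (r b) → g = h ∧ a = b)
    (hz : ∀ x, InXR x → f0 x = 0 → ∃ g a, x = xact g (r a))
    (T : R → (Fin k × Fin (n' + 1) → ℝ) →L[ℝ] V) (hr : ∀ a, f0 (r a) = 0)
    (hT : ∀ a, HasFDerivAt f0 (T a) (r a))
    (hTi : ∀ a y, (∀ i, y (i, 0) = 0) → T a y = 0 → y = 0)
    (hodd : Odd (Fintype.card R)) : ∃ x, InXR x ∧ f1 x = 0 := by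
  classical
  by_contra hcon
  push Not at hcon
  obtain ⟨lam, A, δ, hlam, hA, hδ, hlow, hup, hsep6, hr3, hδ1, hder⟩ :=
    top_consts f0 r hr0 hr1 hsep T hr hT hTi
  obtain ⟨en, en1, en2, en3⟩ := exists_en (k := k) (n' := n') hN
  have hX := isCompact_InXR (k := k) (n := n' + 1)
  -- chart
  have hchart : ∀ a x, InXR x → ‖x - r a‖ ≤ 3 * δ → ∀ i, x (i, 0) = 1 := by
    intro a x hx hxr i
    have hc : ∀ y, |x y - r a y| ≤ 3 * δ := fun y => (norm_le_pi_norm (x - r a) y).trans hxr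
    obtain ⟨s, hs⟩ := hx.2 i
    by_cases h0 : s = 0
    · subst h0
      have h1 := hc (i, 0)
      rw [hr0] at h1
      rcases (abs_eq zero_le_one).1 hs with h | h
      · exact h
      · rw [h] at h1; norm_num at h1; linarith
    · have h1 := hc (i, s)
      have h2 := hr3 a (i, s) h0
      have h3 := abs_sub_abs_le_abs_sub (x (i, s)) (r a (i, s))
      rw [hs] at h3
      linarith
  -- lower bounds
  obtain ⟨d1, hd1, hd1'⟩ : ∃ d > 0, ∀ x, InXR x → (∀ g a, δ / 2 ≤ ‖x - xact g (r a)‖) → d ≤ ‖f0 x‖ := by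
    have hK : IsCompact ({x | InXR x} ∩ ⋂ g : SP k, ⋂ a, {x | δ / 2 ≤ ‖x - xact g (r a)‖}) := by
      apply hX.inter_right
      exact isClosed_iInter fun g => isClosed_iInter fun a =>
        isClosed_le continuous_const (by fun_prop)
    obtain ⟨d, h1, h2⟩ := compact_pos hK c0 (by
      rintro x ⟨hx, hx2⟩ h0
      obtain ⟨g, a, h⟩ := hz x hx h0
      simp only [Set.mem_iInter] at hx2
      have h3 : δ / 2 ≤ ‖x - xact g (r a)‖ := hx2 g a
      rw [h, sub_self, norm_zero] at h3
      linarith)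
    refine ⟨d, h1, fun x hx hx2 => h2 x ⟨hx, ?_⟩⟩
    simp only [Set.mem_iInter]
    exact hx2
  obtain ⟨d2, hd2, hd2'⟩ : ∃ d > 0, ∀ x, InXR x → (∃ g : SP k, g ≠ 1 ∧ xact g x = x) →
      ∀ s : ℝ, 0 ≤ s → s ≤ 1 → d ≤ ‖(1 - s) • f0 x + s • f1 x‖ := by
    have hK : IsCompact (({x | InXR x} ∩ ⋃ g : {g : SP k // g ≠ 1},
        {x : Fin k × Fin (n' + 1) → ℝ | xact g.1 x = x}) ×ˢ Set.Icc (0 : ℝ) 1) := by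
      apply IsCompact.prod _ isCompact_Icc
      apply hX.inter_right
      exact isClosed_iUnion_of_finite fun g => isClosed_eq (xact_continuous _) continuous_id
    obtain ⟨d, h1, h2⟩ := compact_pos hK (F := fun y => (1 - y.2) • f0 y.1 + y.2 • f1 y.1)
      (by fun_prop) (by
      rintro ⟨x, s⟩ ⟨⟨hx, hx2⟩, hs⟩
      simp only [Set.mem_iUnion] at hx2
      obtain ⟨g, hg⟩ := hx2
      exact hnf x hx g.1 g.2 hg s hs.1 hs.2)
    refine ⟨d, h1, fun x hx ⟨g, hg, hgx⟩ s hs0 hs1 => h2 (x, s) ⟨⟨hx, ?_⟩, hs0, hs1⟩⟩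
    simp only [Set.mem_iUnion]
    exact ⟨⟨g, hg⟩, hgx⟩
  obtain ⟨d3, hd3, hd3'⟩ := compact_pos hX c1 hcon
  -- uniform continuity
  obtain ⟨η0, hη0, hu0⟩ := Metric.uniformContinuousOn_iff.1
    (hX.uniformContinuousOn_of_continuous c0.continuousOn) (min d1 d2) (lt_min hd1 hd2)
  obtain ⟨η1, hη1, hu1⟩ := Metric.uniformContinuousOn_iff.1
    (hX.uniformContinuousOn_of_continuous c1.continuousOn) (min d3 d2) (lt_min hd3 hd2)
  -- the mesh
  obtain ⟨L, hL, hLε⟩ : ∃ L : ℕ, 1 ≤ L ∧ 1 / (2 * (L : ℝ)) < min (min η0 η1) (min (δ / 2) (lam * δ / (32 * A))) := by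
    have hm : 0 < min (min η0 η1) (min (δ / 2) (lam * δ / (32 * A))) := by positivity
    obtain ⟨L, hL⟩ := exists_nat_gt (1 / min (min η0 η1) (min (δ / 2) (lam * δ / (32 * A))))
    have hLp : (0 : ℝ) < L := lt_of_le_of_lt (by positivity) hL
    refine ⟨L, by exact_mod_cast hLp, ?_⟩
    rw [div_lt_iff₀ hm] at hL
    rw [div_lt_iff₀ (by positivity)]
    nlinarith
  simp only [lt_min_iff] at hLε
  obtain ⟨⟨hε0, hε1⟩, hε2, hε3⟩ := hLε
  rw [lt_div_iff₀ (by positivity)] at hε3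
  set ε : ℝ := 1 / (2 * (L : ℝ)) with hε
  have hLp : (0 : ℝ) < L := by exact_mod_cast hL
  have hεp : 0 < ε := by positivity
  have hLε : L * ε = 1 / 2 := by rw [hε]; field_simp
  let e : R → Fin k × Fin (n' + 1) → ℤ := fun a x => 2 * ⌊L * r a x⌋ + 1
  have heo : ∀ a x, x.2 ≠ 0 → Odd (e a x) := fun a x _ => ⟨_, rfl⟩
  have heb : ∀ a x, x.2 ≠ 0 → |e a x| + 1 ≤ 2 * L := by
    intro a x hx
    have h1 := hr3 a x hx
    have h2 := Int.floor_le (L * r a x)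
    have h3 := Int.lt_floor_add_one (L * r a x)
    have h4 : |r a x| < 1 - 2 * (2 * ε) := by linarith
    rw [abs_lt] at h4
    have h5 : (⌊L * r a x⌋ : ℝ) < L - 1 := by nlinarith
    have h6 : -(L : ℝ) < ⌊L * r a x⌋ := by nlinarith
    have h5' : (⌊L * r a x⌋ : ℤ) < L - 1 := by exact_mod_cast h5
    have h6' : -(L : ℤ) < ⌊L * r a x⌋ := by exact_mod_cast h6
    simp only [e]
    rw [← le_sub_iff_add_le, abs_le]
    constructor <;> omega
  choose σs hσs using fun a => exists_stdFlag (L := L) en en1 en2 hN (e a) (heo a) (heb a)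
  let p : R → Fin k × Fin (n' + 1) → ℝ := fun a => ppt L N en (e a)
  have hnear : ∀ a, ‖p a - r a‖ ≤ 2 * ε ∧ ∀ j, ‖pt L (stdCell L en (e a) j) - r a‖ ≤ 2 * ε := fun a =>
    near_ppt hL en en1 (r a) (hr0 a) (e a) (fun x => rfl)
  obtain ⟨b0, B0, B1, B2⟩ := exists_b0 (L := L) ρ f0 q0 r (fun a x => T a (x - p a)) δ
    (fun g h a b hh => hsep6 g h a b (hh.trans (by linarith)))
  have hρ : ∀ g : SP k, Function.Injective (ρ g) := by
    intro g
    apply Function.LeftInverse.injective (g := ρ g⁻¹)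
    intro v
    have : (ρ g⁻¹ * ρ g) v = v := by rw [← map_mul]; simp
    exact this
  let C := flagChamb (k := k) (n' := n') (L := L) hL hN hN1
  have : Fintype (CFlag k (n' + 1) L N) := Fintype.ofFinite _
  have hin : ∀ (σ : CFlag k (n' + 1) L N) j, InXR (pt L (σ.1 j).1) := fun σ j => pt_InXR hL (σ.1 j).2
  have hfl := fun (σ : CFlag k (n' + 1) L N) a b => pt_flag hL σ a b
  have tri : ∀ x y z : Fin k × Fin (n' + 1) → ℝ, ‖x - z‖ ≤ ‖x - y‖ + ‖y - z‖ := by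
    intro x y z
    simpa [dist_eq_norm] using dist_triangle x y z
  -- transport
  have htr : ∀ (σ : CFlag k (n' + 1) L N) (g : SP k), InHull (fun j => b0 (σ.1 j)) → InHull (fun j => b0 ((g • σ).1 j)) := by
    intro σ g h
    exact h.map (ρ g) (fun j => by rw [flag_smul_val, B0])
  -- main classification near a root
  have near : ∀ (σ : CFlag k (n' + 1) L N) a j0, InHull (fun j => b0 (σ.1 j)) → ‖pt L (σ.1 j0).1 - r a‖ ≤ δ →
      σ = σs a := by
    intro σ a j0 hh hj0
    have h3 : ∀ j, ‖pt L (σ.1 j).1 - r a‖ ≤ 3 / 2 * δ := by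
      intro j
      have := tri (pt L (σ.1 j).1) (pt L (σ.1 j0).1) (r a)
      have := hfl σ j j0
      linarith
    have hch : ∀ j i, pt L (σ.1 j).1 (i, 0) = 1 := fun j =>
      hchart a _ (hin σ j) ((h3 j).trans (by linarith))
    by_cases hall : ∀ j, ‖pt L (σ.1 j).1 - r a‖ ≤ δ
    · have : InHull (fun j => (T a : (Fin k × Fin (n' + 1) → ℝ) →ₗ[ℝ] V) (pt L (σ.1 j).1 - ppt L N en (e a))) := by
        convert hh using 2 with j
        rw [B1 a _ (hall j)]
        rfl
      have h5 := chart_flag_eq hL en en1 en2 hN (e a) (heo a) _ (hTi a) σ hch this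
      apply Subtype.ext
      funext j
      apply Subtype.ext
      rw [h5, hσs]
    · exfalso
      push Not at hall
      obtain ⟨j1, hj1⟩ := hall
      set y0 := pt L (σ.1 j1).1 - r a with hy0
      have hlow0 := hlow a y0 (fun i => by simp [hy0, hch, hr0])
      refine hull_avoid1 _ (T a y0) ?_ hh
      intro j
      refine lt_of_lt_of_le ?_ ((mul_le_mul_of_nonneg_left hj1.le hlam.le).trans hlow0)
      have hdiff := hfl σ j j1
      by_cases hj : ‖pt L (σ.1 j).1 - r a‖ ≤ δ
      · rw [B1 a _ hj, ← map_sub]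
        have e1 : pt L (σ.1 j).1 - p a - y0 = (pt L (σ.1 j).1 - pt L (σ.1 j1).1) - (p a - r a) := by
          rw [hy0]; abel
        have h6 : ‖pt L (σ.1 j).1 - p a - y0‖ ≤ 3 * ε := by
          rw [e1]
          refine (norm_sub_le _ _).trans ?_
          have := (hnear a).1
          linarith
        have h7 := (hup a (pt L (σ.1 j).1 - p a - y0)).trans (mul_le_mul_of_nonneg_left h6 hA.le)
        nlinarith
      · have hB2 : b0 (σ.1 j) = f0 (pt L (σ.1 j).1) := by
          apply B2
          intro g b
          by_contra hlt
          push Not at hlt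
          have h8 : ‖xact 1 (r a) - xact g (r b)‖ ≤ 6 * δ := by
            rw [xact_one]
            have h9 := tri (r a) (pt L (σ.1 j).1) (xact g (r b))
            rw [norm_sub_rev (r a) (pt L (σ.1 j).1)] at h9
            have := h3 j
            linarith
          obtain ⟨h10, h11⟩ := hsep6 _ _ _ _ h8
          subst h11
          rw [← h10, xact_one] at hlt
          exact hj hlt
        rw [hB2]
        have h6 := hder a (pt L (σ.1 j).1) ((h3 j).trans (by linarith))
        have h7 : ‖T a (pt L (σ.1 j).1 - r a) - T a y0‖ ≤ A * ε := by
          rw [← map_sub]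
          refine (hup a _).trans (mul_le_mul_of_nonneg_left ?_ hA.le)
          have e1 : pt L (σ.1 j).1 - r a - y0 = pt L (σ.1 j).1 - pt L (σ.1 j1).1 := by rw [hy0]; abel
          rw [e1]; exact hdiff
        have h8 : ‖f0 (pt L (σ.1 j).1) - T a y0‖ ≤ ‖f0 (pt L (σ.1 j).1) - T a (pt L (σ.1 j).1 - r a)‖ +
            ‖T a (pt L (σ.1 j).1 - r a) - T a y0‖ := by
          simpa [dist_eq_norm] using dist_triangle (f0 (pt L (σ.1 j).1)) (T a (pt L (σ.1 j).1 - r a)) (T a y0)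
        have h9 : lam / 8 * ‖pt L (σ.1 j).1 - r a‖ ≤ lam / 8 * (3 / 2 * δ) :=
          mul_le_mul_of_nonneg_left (h3 j) (by positivity)
        nlinarith
  have key : ∀ σ : CFlag k (n' + 1) L N, InHull (fun j => b0 (σ.1 j)) → ∃ (g : SP k) (a : R), σ = g • σs a := by
    intro σ hh
    by_cases h1 : ∃ j g a, ‖pt L (σ.1 j).1 - xact g (r a)‖ ≤ δ
    · obtain ⟨j, g, a, h⟩ := h1
      refine ⟨g, a, ?_⟩
      rw [← inv_smul_eq_iff]
      apply near _ a j (htr σ g⁻¹ hh)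
      rw [flag_smul_val, cell_smul_val, pt_cact, ← xact_norm g, xact_sub, ← xact_mul, mul_inv_cancel, xact_one]
      exact h
    · exfalso
      push Not at h1
      have h2 : ∀ j, b0 (σ.1 j) = f0 (pt L (σ.1 j).1) := fun j => B2 _ (h1 j)
      refine hull_avoid1 _ (f0 (pt L (σ.1 0).1)) ?_ hh
      intro j
      rw [h2]
      have h3 := hd1' _ (hin σ 0) (fun g a => (by linarith : δ / 2 ≤ δ).trans (h1 0 g a).le)
      have h4 := hu0 _ (hin σ j) _ (hin σ 0) (by rw [dist_eq_norm]; exact (hfl σ j 0).trans_lt hε0)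
      rw [dist_eq_norm] at h4
      exact (h4.trans_le (min_le_left _ _)).trans_le h3
  have hσnd : ∀ a, NonDeg (fun j => b0 ((σs a).1 j)) := by
    intro a
    have h1 := std_nonDeg hL en en1 en3 (e a) (T a : (Fin k × Fin (n' + 1) → ℝ) →ₗ[ℝ] V) (hTi a)
    convert h1 using 2 with j
    rw [B1 a _ (by rw [hσs]; exact ((hnear a).2 j).trans (by linarith)), hσs]
    rfl
  have h0 : ∀ σ : CFlag k (n' + 1) L N, InHull (fun j => b0 (σ.1 j)) → NonDeg (fun j => b0 (σ.1 j)) := by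
    intro σ hh
    obtain ⟨g, a, rfl⟩ := key σ hh
    exact nonDeg_map (hσnd a) (ρ g) (hρ g) (fun j => by rw [flag_smul_val, B0])
  have hfin := parity_robust C hV hN1 ρ b0 (fun c => f1 (pt L c.1)) B0
    (fun g c => by rw [cell_smul_val, pt_cact, q1]) (by
      rintro σ ⟨j0, hj0⟩
      obtain ⟨g, hg, hgx⟩ := isFree_pt (c := σ.1 j0) hj0
      have hB2 : ∀ j, b0 (σ.1 j) = f0 (pt L (σ.1 j).1) := by
        intro j
        apply B2
        intro h a
        by_contra hlt
        push Not at hlt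
        have h5 : ‖pt L (σ.1 j0).1 - xact h (r a)‖ ≤ 3 / 2 * δ := by
          have := tri (pt L (σ.1 j0).1) (pt L (σ.1 j).1) (xact h (r a))
          have := hfl σ j0 j
          linarith
        have h6 : ‖pt L (σ.1 j0).1 - xact (g * h) (r a)‖ ≤ 3 / 2 * δ := by
          rw [← hgx, xact_mul, ← xact_sub, xact_norm]; exact h5
        have h7 := tri (xact (g * h) (r a)) (pt L (σ.1 j0).1) (xact h (r a))
        rw [norm_sub_rev (xact (g * h) (r a)) (pt L (σ.1 j0).1)] at h7
        have h8 := (hsep6 (g * h) h a a (by linarith)).1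
        exact hg (by simpa using h8)
      apply hull_avoid _ (fun x => x.2) (f0 (pt L (σ.1 j0).1)) (f1 (pt L (σ.1 j0).1)) d2
        (hd2' _ (hin σ j0) ⟨g, hg, hgx⟩)
      rintro ⟨j, b⟩
      have hd : dist (pt L (σ.1 j).1) (pt L (σ.1 j0).1) ≤ ε := by
        rw [dist_eq_norm]; exact hfl σ j j0
      cases b
      · change ‖b0 (σ.1 j) - f0 (pt L (σ.1 j0).1)‖ < d2
        rw [hB2, ← dist_eq_norm]
        exact (hu0 _ (hin σ j) _ (hin σ j0) (hd.trans_lt hε0)).trans_le (min_le_right _ _)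
      · change ‖f1 (pt L (σ.1 j).1) - f1 (pt L (σ.1 j0).1)‖ < d2
        rw [← dist_eq_norm]
        exact (hu1 _ (hin σ j) _ (hin σ j0) (hd.trans_lt hε1)).trans_le (min_le_right _ _))
    h0 (by
      intro σ
      apply hull_avoid1 _ (f1 (pt L (σ.1 0).1))
      intro j
      rw [← dist_eq_norm]
      refine lt_of_lt_of_le ?_ (hd3' _ (hin σ 0))
      exact (hu1 _ (hin σ j) _ (hin σ 0) (by rw [dist_eq_norm]; exact (hfl σ j 0).trans_lt hε1)).trans_le
        (min_le_left _ _))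
  -- the count
  let Q := Quotient (MulAction.orbitRel (SP k) (CFlag k (n' + 1) L N))
  let F : R → Q := fun a => ⟦σs a⟧
  have hFinj : Function.Injective F := by
    intro a b hab
    have h1 : ∃ g : SP k, g • σs b = σs a := Quotient.exact hab
    obtain ⟨g, hg⟩ := h1
    have h2 : pt L ((σs a).1 0).1 = xact g (pt L ((σs b).1 0).1) := by
      rw [← hg, flag_smul_val, cell_smul_val, pt_cact]
    have h3 : ‖pt L ((σs a).1 0).1 - r a‖ ≤ δ := by
      rw [hσs]; exact ((hnear a).2 _).trans (by linarith)
    have h4 : ‖pt L ((σs a).1 0).1 - xact g (r b)‖ ≤ δ := by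
      rw [h2, ← xact_sub, xact_norm, hσs]; exact ((hnear b).2 _).trans (by linarith)
    have h5 := tri (r a) (pt L ((σs a).1 0).1) (xact g (r b))
    rw [norm_sub_rev (r a) (pt L ((σs a).1 0).1)] at h5
    exact (hsep6 1 g a b (by rw [xact_one]; linarith)).2
  have hmem : ∀ q : Q, InHull (fun j => b0 (C.vert q.out j)) ↔ ∃ a, F a = q := by
    intro q
    constructor
    · intro h
      obtain ⟨g, a, hga⟩ := key q.out h
      refine ⟨a, ?_⟩
      rw [← Quotient.out_eq q, hga]
      exact (mk_smul g (σs a)).symm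
    · rintro ⟨a, rfl⟩
      obtain ⟨g, hg⟩ := orb_exists (G := SP k) (σs a)
      have h1 : (F a).out = g⁻¹ • σs a := by rw [eq_inv_smul_iff]; exact hg
      change InHull (fun j => b0 ((F a).out.1 j))
      rw [h1]
      exact htr _ _ (hσnd a).inHull
  have hcount : Tcount C b0 = (Fintype.card R : ZMod 2) := by
    unfold Tcount
    have h1 : ∀ q : Q, (if InHull (fun j => b0 (C.vert q.out j)) then (1 : ZMod 2) else 0) =
        if q ∈ Finset.univ.image F then 1 else 0 := by
      intro q
      congr 1
      rw [hmem]; simp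
    refine (Finset.sum_congr rfl fun q _ => h1 q).trans ?_
    rw [Finset.sum_ite_mem, Finset.univ_inter, Finset.sum_const, Finset.card_image_of_injective _ hFinj,
      Finset.card_univ]
    simp
  rw [hfin] at hcount
  obtain ⟨m, hm⟩ := hodd
  rw [hm] at hcount
  push_cast at hcount
  have h2 : (2 : ZMod 2) = 0 := rfl
  rw [h2] at hcount
  simp at hcount

end
end

section

section
open Polynomial
variable {K : ℕ} (z : Fin K → ℝ) (hz : Function.Injective z)

theorem orth_of_moments {M : ℕ} (F : Fin K → ℝ) (h : ∀ r < M, ∑ s, z s ^ r * F s = 0) (g : ℝ[X])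
    (hg : g.natDegree < M) : ∑ s, g.eval (z s) * F s = 0 := by
  have : ∀ s, g.eval (z s) * F s = ∑ i ∈ Finset.range M, g.coeff i * (z s ^ i * F s) := by
    intro s
    rw [eval_eq_sum_range' hg, Finset.sum_mul]
    exact Finset.sum_congr rfl fun i _ => by ring
  simp only [this]
  rw [Finset.sum_comm]
  apply Finset.sum_eq_zero
  intro i hi
  rw [← Finset.mul_sum, h i (Finset.mem_range.1 hi), mul_zero]

include hz in
theorem zero_of_nodes (p : ℝ[X]) (A : Finset (Fin K)) (h : ∀ s ∈ A, p.eval (z s) = 0)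
    (hc : p.natDegree < A.card) : p = 0 := by
  apply eq_zero_of_natDegree_lt_card_of_eval_eq_zero' p (A.image z)
  · intro x hx
    obtain ⟨s, hs, rfl⟩ := Finset.mem_image.1 hx
    exact h s hs
  · rwa [Finset.card_image_of_injective _ hz]

include hz in
/-- a function supported on few nodes with vanishing moments is zero -/
theorem supp_zero {M : ℕ} (F : Fin K → ℝ) (h : ∀ r < M, ∑ s, z s ^ r * F s = 0)
    (A : Finset (Fin K)) (hA : ∀ s, F s ≠ 0 → s ∈ A) (hc : A.card ≤ M) (s : Fin K) : F s = 0 := by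
  by_contra hs
  have hsA := hA s hs
  let g : ℝ[X] := ∏ u ∈ A.erase s, (X - C (z u))
  have hg : g.natDegree < M := by
    rw [natDegree_prod_of_monic _ _ (fun u _ => monic_X_sub_C _)]
    simp only [natDegree_X_sub_C, Finset.sum_const, smul_eq_mul, mul_one]
    exact lt_of_lt_of_le (Finset.card_erase_lt_of_mem hsA) hc
  have h1 := orth_of_moments z F h g hg
  rw [Finset.sum_eq_single s] at h1
  · rcases mul_eq_zero.1 h1 with h2 | h2
    · rw [eval_prod, Finset.prod_eq_zero_iff] at h2
      obtain ⟨u, hu, h3⟩ := h2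
      rw [Finset.mem_erase] at hu
      simp only [eval_sub, eval_X, eval_C] at h3
      exact hu.1 (hz (sub_eq_zero.1 h3).symm)
    · exact hs h2
  · intro u _ hu
    by_cases hF : F u = 0
    · rw [hF, mul_zero]
    · have : g.eval (z u) = 0 := by
        rw [eval_prod]
        apply Finset.prod_eq_zero (Finset.mem_erase.2 ⟨hu, hA u hF⟩)
        simp
      rw [this, zero_mul]
  · simp

include hz in
theorem classify {k B : ℕ} (hK : K = k * B) (hB : 1 ≤ B) (p : Fin k → ℝ[X]) (hp0 : ∀ i, p i ≠ 0)
    (hdeg : ∀ i, (p i).natDegree + B ≤ K)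
    (H : ∀ i j, i ≠ j → ∀ r < 2 * B, ∑ s, z s ^ r * ((p i).eval (z s) * (p j).eval (z s)) = 0) :
    ∃ β : Fin K → Fin k, (∀ i, (Finset.univ.filter fun s => β s = i).card = B) ∧
      ∀ i s, (p i).eval (z s) ≠ 0 ↔ β s = i := by
  classical
  have H' : ∀ i j, i ≠ j → ∀ g : ℝ[X], g.natDegree < 2 * B →
      ∑ s, g.eval (z s) * ((p i).eval (z s) * (p j).eval (z s)) = 0 := fun i j hij g hg =>
    orth_of_moments z _ (H i j hij) g hg
  let S : Fin k → Finset (Fin K) := fun i => Finset.univ.filter fun s => (p i).eval (z s) ≠ 0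
  have hS : ∀ i s, s ∈ S i ↔ (p i).eval (z s) ≠ 0 := fun i s => by simp [S]
  have hSge : ∀ i, B ≤ (S i).card := by
    intro i
    by_contra hlt
    push Not at hlt
    apply hp0 i
    apply zero_of_nodes z hz (p i) (S i)ᶜ
    · intro s hs
      rw [Finset.mem_compl, hS] at hs
      exact not_not.1 hs
    · rw [Finset.card_compl, Fintype.card_fin]
      have := hdeg i
      omega
  -- key vanishing lemma
  have hvan : ∀ (l : Fin k) (g : Fin k → ℝ[X]) (h : Fin K → ℝ), (∀ i, (g i).natDegree < B) →
      (∀ s, ∑ i, (g i).eval (z s) * (p i).eval (z s) = h s) →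
      (∑ s, (g l).eval (z s) * (h s * (p l).eval (z s)) = 0) → ∀ s, (g l).eval (z s) * (p l).eval (z s) = 0 := by
    intro l g h hg hh h0
    have h1 : ∑ s, ((g l).eval (z s) * (p l).eval (z s)) ^ 2 = 0 := by
      rw [← h0]
      have h2 : ∀ s, (g l).eval (z s) * (h s * (p l).eval (z s)) =
          ∑ i, (g i * g l).eval (z s) * ((p i).eval (z s) * (p l).eval (z s)) := by
        intro s
        rw [← hh s, Finset.sum_mul, Finset.mul_sum]
        exact Finset.sum_congr rfl fun i _ => by rw [eval_mul]; ring
      simp only [h2]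
      rw [Finset.sum_comm, Finset.sum_eq_single l]
      · exact Finset.sum_congr rfl fun s _ => by rw [eval_mul]; ring
      · intro i _ hi
        apply H' i l hi
        have := hg i
        have := hg l
        exact lt_of_le_of_lt natDegree_mul_le (by omega)
      · simp
    intro s
    have := (Finset.sum_eq_zero_iff_of_nonneg (fun s _ => sq_nonneg _)).1 h1 s (Finset.mem_univ _)
    exact pow_eq_zero_iff (two_ne_zero) |>.1 this
  have hlt : ∀ g : degreeLT ℝ B, (g : ℝ[X]).natDegree < B := by
    intro g
    have h1 := mem_degreeLT.1 g.2
    by_cases h0 : (g : ℝ[X]) = 0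
    · rw [h0, natDegree_zero]; omega
    · exact (natDegree_lt_iff_degree_lt h0).2 h1
  let Φ : (Fin k → degreeLT ℝ B) →ₗ[ℝ] (Fin K → ℝ) :=
    { toFun := fun g s => ∑ i, (g i : ℝ[X]).eval (z s) * (p i).eval (z s)
      map_add' := by
        intro g h; funext s
        simp [add_mul, Finset.sum_add_distrib]
      map_smul' := by
        intro c g; funext s
        simp [Finset.mul_sum, mul_assoc] }
  have hΦ : Function.Injective Φ := by
    rw [injective_iff_map_eq_zero]
    intro g hg
    funext l
    apply Subtype.ext
    have h1 := hvan l (fun i => g i) 0 (fun i => hlt _) (fun s => congrFun hg s) (by simp)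
    apply zero_of_nodes z hz _ (S l)
    · intro s hs
      exact (mul_eq_zero.1 (h1 s)).resolve_right ((hS _ _).1 hs)
    · exact (hlt _).trans_le (hSge l)
  have hfr : Module.finrank ℝ (Fin k → degreeLT ℝ B) = Module.finrank ℝ (Fin K → ℝ) := by
    rw [Module.finrank_pi_fintype]
    simp [(degreeLTEquiv ℝ B).finrank_eq, hK]
  have : FiniteDimensional ℝ (degreeLT ℝ B) := (degreeLTEquiv ℝ B).symm.finiteDimensional
  have hsurj : Function.Surjective Φ :=
    (LinearMap.injective_iff_surjective_of_finrank_eq_finrank hfr).1 hΦ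
  have hSle : ∀ i, (S i).card ≤ B := by
    intro i
    obtain ⟨g, hg⟩ := hsurj (fun s => z s ^ B * (p i).eval (z s))
    have hg' : ∀ s, ∑ l, (g l : ℝ[X]).eval (z s) * (p l).eval (z s) = z s ^ B * (p i).eval (z s) :=
      fun s => congrFun hg s
    have h1 : ∀ l, l ≠ i → ∀ s, (g l : ℝ[X]).eval (z s) * (p l).eval (z s) = 0 := by
      intro l hl
      apply hvan l (fun i => g i) _ (fun i => hlt _) hg'
      have := H' i l hl.symm ((g l : ℝ[X]) * X ^ B) (by
        refine lt_of_le_of_lt natDegree_mul_le ?_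
        have := hlt (g l)
        rw [natDegree_X_pow]; omega)
      rw [← this]
      exact Finset.sum_congr rfl fun s _ => by simp; ring
    have h2 : ∀ s ∈ S i, (X ^ B - (g i : ℝ[X])).eval (z s) = 0 := by
      intro s hs
      have h3 := hg' s
      rw [Finset.sum_eq_single i (fun l _ hl => h1 l hl s) (by simp)] at h3
      have := mul_right_cancel₀ ((hS _ _).1 hs) h3
      simp [this]
    by_contra hc
    push Not at hc
    have hd : (X ^ B - (g i : ℝ[X])).natDegree = B := by
      rw [natDegree_sub_eq_left_of_natDegree_lt, natDegree_X_pow]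
      rw [natDegree_X_pow]; exact hlt _
    have h4 := zero_of_nodes z hz _ (S i) h2 (by rw [hd]; exact hc)
    rw [h4, natDegree_zero] at hd
    omega
  have hScard : ∀ i, (S i).card = B := fun i => le_antisymm (hSle i) (hSge i)
  have hdisj : ∀ i j, i ≠ j → Disjoint (S i) (S j) := by
    intro i j hij
    rw [Finset.disjoint_left]
    intro s hi hj
    have := supp_zero z hz _ (H i j hij) (S i) (fun s hs => (hS i s).2 (left_ne_zero_of_mul hs))
      (by rw [hScard]; omega) s
    exact mul_ne_zero ((hS _ _).1 hi) ((hS _ _).1 hj) this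
  have hun : Finset.univ.biUnion S = Finset.univ := by
    apply Finset.eq_univ_of_card
    rw [Finset.card_biUnion (fun i _ j _ hij => hdisj i j hij)]
    simp [hScard, hK]
  have hex : ∀ s, ∃ i, s ∈ S i := by
    intro s
    have : s ∈ Finset.univ.biUnion S := by rw [hun]; simp
    simpa using this
  choose β hβ using hex
  have hiff : ∀ i s, (p i).eval (z s) ≠ 0 ↔ β s = i := by
    intro i s
    constructor
    · intro h
      by_contra hne
      exact Finset.disjoint_left.1 (hdisj _ _ hne) (hβ s) ((hS _ _).2 h)
    · rintro rfl
      exact (hS _ _).1 (hβ s)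
  refine ⟨β, fun i => ?_, hiff⟩
  rw [← hScard i]
  congr 1
  ext s
  simp [S, hiff]

include hz in
theorem deriv_inj {k B : ℕ} (hk : 2 ≤ k) (hz0 : ∀ s, z s ≠ 0) (p y : Fin k → ℝ[X])
    (β : Fin K → Fin k) (hβ : ∀ i, (Finset.univ.filter fun s => β s = i).card = B)
    (hp : ∀ i s, (p i).eval (z s) ≠ 0 ↔ β s = i)
    (hdeg : ∀ i, (y i).natDegree + B ≤ K) (hy0 : ∀ i, (y i).eval 0 = 0)
    (H : ∀ i j, i ≠ j → ∀ r < 2 * B, ∑ s, z s ^ r * ((p i).eval (z s) * (y j).eval (z s) +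
      (y i).eval (z s) * (p j).eval (z s)) = 0) (j : Fin k) : y j = 0 := by
  classical
  have h1 : ∀ s, β s ≠ j → (y j).eval (z s) = 0 := by
    intro s hs
    have h2 := supp_zero z hz _ (H (β s) j hs)
      ((Finset.univ.filter fun u => β u = β s) ∪ (Finset.univ.filter fun u => β u = j)) (by
        intro u hu
        simp only [Finset.mem_union, Finset.mem_filter, Finset.mem_univ, true_and]
        by_contra hcon
        push Not at hcon
        apply hu
        have e1 : (p (β s)).eval (z u) = 0 := by
          by_contra h; exact hcon.1 ((hp _ _).1 h)
        have e2 : (p j).eval (z u) = 0 := by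
          by_contra h; exact hcon.2 ((hp _ _).1 h)
        rw [e1, e2]; ring) (by
        refine (Finset.card_union_le _ _).trans ?_
        rw [hβ, hβ]; omega) s
    have e2 : (p j).eval (z s) = 0 := by
      by_contra h; exact hs ((hp _ _).1 h)
    rw [e2, mul_zero, add_zero] at h2
    exact (mul_eq_zero.1 h2).resolve_left ((hp _ _).2 rfl)
  apply eq_zero_of_natDegree_lt_card_of_eval_eq_zero' (y j)
    (insert 0 ((Finset.univ.filter fun u => β u = j)ᶜ.image z))
  · intro x hx
    rw [Finset.mem_insert] at hx
    rcases hx with rfl | hx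
    · exact hy0 j
    · obtain ⟨s, hs, rfl⟩ := Finset.mem_image.1 hx
      exact h1 s (by simpa using hs)
  · rw [Finset.card_insert_of_notMem, Finset.card_image_of_injective _ hz, Finset.card_compl, hβ,
      Fintype.card_fin]
    · have := hdeg j
      omega
    · intro h
      obtain ⟨s, -, hs⟩ := Finset.mem_image.1 h
      exact hz0 s hs

/-- root polynomials -/
def rpoly {k : ℕ} (w : Fin K → ℝ) (β : Fin K → Fin k) (i : Fin k) : ℝ[X] :=
  ∏ s ∈ Finset.univ.filter (fun s => β s ≠ i), (1 - C (w s) * X)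

theorem coeff_bound (w : Fin K → ℝ) (hw : ∀ s, 0 ≤ w s) (A : Finset (Fin K)) (hA : ∑ s ∈ A, w s < 1) :
    (∏ s ∈ A, (1 - C (w s) * X)).coeff 0 = 1 ∧
      ∀ c, c ≠ 0 → |(∏ s ∈ A, (1 - C (w s) * X)).coeff c| ≤ ∑ s ∈ A, w s := by
  classical
  induction A using Finset.induction_on with
  | empty => simp [coeff_one]
  | insert a A ha ih =>
    rw [Finset.sum_insert ha] at hA ⊢
    obtain ⟨h0, h1⟩ := ih (by linarith [hw a])
    rw [Finset.prod_insert ha, sub_mul, one_mul]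
    constructor
    · rw [coeff_sub, h0, mul_assoc, coeff_C_mul, coeff_X_mul_zero]; simp
    · intro c hc
      obtain ⟨c, rfl⟩ := Nat.exists_eq_succ_of_ne_zero hc
      rw [coeff_sub, mul_assoc, coeff_C_mul, Nat.succ_eq_add_one, coeff_X_mul]
      have h2 : |(∏ s ∈ A, (1 - C (w s) * X)).coeff c| ≤ 1 := by
        by_cases hc0 : c = 0
        · rw [hc0, h0]; simp
        · exact (h1 c hc0).trans (by linarith [hw a])
      refine (abs_sub _ _).trans ?_
      rw [abs_mul, abs_of_nonneg (hw a)]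
      have := h1 (c + 1) (by omega)
      nlinarith [hw a]

theorem rpoly_eval {k : ℕ} (w : Fin K → ℝ) (hw : ∀ s, w s * z s = 1) (hz : Function.Injective z)
    (β : Fin K → Fin k) (i : Fin k) (s : Fin K) : (rpoly w β i).eval (z s) ≠ 0 ↔ β s = i := by
  unfold rpoly
  rw [eval_prod, Finset.prod_ne_zero_iff]
  simp only [Finset.mem_filter, Finset.mem_univ, true_and, eval_sub, eval_one, eval_mul, eval_C, eval_X]
  constructor
  · intro h
    by_contra hne
    exact h s hne (by rw [hw, sub_self])
  · rintro rfl u hu h0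
    have h1 : w u * z s = w u * z u := by rw [hw]; linarith
    have hwu : w u ≠ 0 := left_ne_zero_of_mul_eq_one (hw u)
    exact hu (by rw [hz (mul_left_cancel₀ hwu h1)])

theorem rpoly_deg {k B : ℕ} (w : Fin K → ℝ) (β : Fin K → Fin k) (i : Fin k)
    (hβ : (Finset.univ.filter fun s => β s = i).card = B) : (rpoly w β i).natDegree + B ≤ K := by
  classical
  have h1 : (rpoly w β i).natDegree ≤ (Finset.univ.filter (fun s => β s ≠ i)).card := by
    refine (natDegree_prod_le _ _).trans ?_
    have : ∀ s ∈ Finset.univ.filter (fun s => β s ≠ i), (1 - C (w s) * X).natDegree ≤ 1 := by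
      intro s _
      refine (natDegree_sub_le _ _).trans ?_
      simp only [natDegree_one, zero_le, sup_of_le_right]
      exact (natDegree_C_mul_le _ _).trans natDegree_X_le
    simpa using Finset.sum_le_sum this
  have h2 := Finset.card_filter_add_card_filter_not (s := (Finset.univ : Finset (Fin K))) (fun s => β s = i)
  simp only [Finset.card_univ, Fintype.card_fin] at h2
  rw [hβ] at h2
  have h3 : (rpoly w β i).natDegree ≤ (Finset.univ.filter (fun s => ¬ β s = i)).card := h1
  omega

theorem rpoly_unique {k B : ℕ} (w : Fin K → ℝ) (hw : ∀ s, w s * z s = 1) (hz : Function.Injective z)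
    (β : Fin K → Fin k) (i : Fin k) (hβ : (Finset.univ.filter fun s => β s = i).card = B)
    (hr0 : (rpoly w β i).coeff 0 = 1)
    (p : ℝ[X]) (hdeg : p.natDegree + B ≤ K) (hp : ∀ s, β s ≠ i → p.eval (z s) = 0) :
    p = C (p.coeff 0) * rpoly w β i := by
  classical
  rw [← sub_eq_zero]
  have hz0 : ∀ s, z s ≠ 0 := fun s => right_ne_zero_of_mul_eq_one (hw s)
  apply eq_zero_of_natDegree_lt_card_of_eval_eq_zero' _
    (insert 0 ((Finset.univ.filter fun u => β u = i)ᶜ.image z))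
  · intro x hx
    rw [Finset.mem_insert] at hx
    rcases hx with rfl | hx
    · simp only [eval_sub, eval_mul, eval_C, ← coeff_zero_eq_eval_zero, hr0]; ring
    · obtain ⟨s, hs, rfl⟩ := Finset.mem_image.1 hx
      have hs' : β s ≠ i := by simpa using hs
      have h2 : (rpoly w β i).eval (z s) = 0 := by
        by_contra h; exact hs' ((rpoly_eval z w hw hz β i s).1 h)
      simp [hp s hs', h2]
  · rw [Finset.card_insert_of_notMem, Finset.card_image_of_injective _ hz, Finset.card_compl, hβ,
      Fintype.card_fin]
    · have h3 := natDegree_sub_le p (C (p.coeff 0) * rpoly w β i)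
      have h4 := natDegree_C_mul_le (p.coeff 0) (rpoly w β i)
      have h5 := rpoly_deg w β i hβ
      rcases max_le_iff.1 (le_refl (max p.natDegree (C (p.coeff 0) * rpoly w β i).natDegree)) with ⟨h6, h7⟩
      have : max p.natDegree (C (p.coeff 0) * rpoly w β i).natDegree ≤ K - B := max_le (by omega) (by omega)
      omega
    · intro h
      obtain ⟨s, -, hs⟩ := Finset.mem_image.1 h
      exact hz0 s hs

end
end

section

section
variable {k n m1 b2 : ℕ}

/-- target space -/
abbrev VV (k m1 b2 : ℕ) : Type :=
  (Fin m1 → Fin k → ℝ) × (Fin b2 → {z : Sym2 (Fin k) // ¬ z.IsDiag} → ℝ)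

theorem finrank_VV : Module.finrank ℝ (VV k m1 b2) = m1 * k + b2 * k.choose 2 := by
  have h : Fintype.card {z : Sym2 (Fin k) // ¬ z.IsDiag} = k.choose 2 := by
    rw [Sym2.card_subtype_not_diag, Fintype.card_fin]
  have e2 : Module.finrank ℝ (Fin b2 → {z : Sym2 (Fin k) // ¬ z.IsDiag} → ℝ) = b2 * k.choose 2 := by
    rw [Module.finrank_pi_fintype]
    simp only [Module.finrank_fintype_fun_eq_card]
    rw [Finset.sum_const, Finset.card_univ, Fintype.card_fin, smul_eq_mul, ← h]
  rw [Module.finrank_prod, e2, Module.finrank_pi_fintype]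
  simp

theorem isDiag_map_perm (σ : Equiv.Perm (Fin k)) (z : Sym2 (Fin k)) :
    ¬ z.IsDiag → ¬ (z.map σ).IsDiag := by
  induction z using Sym2.ind with
  | _ i j => simp

/-- sign of an unordered pair -/
def psg (g : SP k) : Sym2 (Fin k) → ℝ :=
  Sym2.lift ⟨fun i j => ((g.sgn i : ℤ) : ℝ) * ((g.sgn j : ℤ) : ℝ), fun _ _ => mul_comm _ _⟩

/-- one operator of the target representation -/
def rho1 (g : SP k) : VV k m1 b2 →ₗ[ℝ] VV k m1 b2 where
  toFun F := (fun l i => ((g.sgn i : ℤ) : ℝ) * F.1 l (g.perm i),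
    fun r z => psg g z.1 * F.2 r ⟨z.1.map g.perm, isDiag_map_perm _ _ z.2⟩)
  map_add' F G := by
    ext <;> simp [mul_add]
  map_smul' c F := by
    ext <;> simp [mul_left_comm]

/-- the target representation -/
def rho : SP k →* (VV k m1 b2 →ₗ[ℝ] VV k m1 b2) where
  toFun := rho1
  map_one' := by
    apply LinearMap.ext
    intro F
    refine Prod.ext ?_ ?_
    · funext l i; simp [rho1, SP.one_sgn, SP.one_perm]
    · funext r ⟨z, hz⟩
      induction z using Sym2.ind with
      | _ i j => simp [rho1, SP.one_sgn, SP.one_perm, psg]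
  map_mul' g h := by
    apply LinearMap.ext
    intro F
    refine Prod.ext ?_ ?_
    · funext l i; simp [rho1, SP.mul_sgn, SP.mul_perm]; ring
    · funext r ⟨z, hz⟩
      induction z using Sym2.ind with
      | _ i j => simp [rho1, SP.mul_sgn, SP.mul_perm, psg]; ring

/-- rows of an array -/
def row (x : Fin k × Fin n → ℝ) (i : Fin k) : Fin n → ℝ := fun c => x (i, c)

/-- the map to the target space given by one-row and two-row functions -/
def mkf (u : Fin m1 → (Fin n → ℝ) → ℝ) (h : Fin b2 → (Fin n → ℝ) → (Fin n → ℝ) → ℝ)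
    (hs : ∀ r v w, h r v w = h r w v) (x : Fin k × Fin n → ℝ) : VV k m1 b2 :=
  (fun l i => u l (row x i),
   fun r z => Sym2.lift ⟨fun i j => h r (row x i) (row x j), fun _ _ => hs _ _ _⟩ z.1)

variable (u : Fin m1 → (Fin n → ℝ) → ℝ) (h : Fin b2 → (Fin n → ℝ) → (Fin n → ℝ) → ℝ)
    (hs : ∀ r v w, h r v w = h r w v)

theorem row_continuous (i : Fin k) : Continuous (fun x : Fin k × Fin n → ℝ => row x i) := by
  unfold row; fun_prop

theorem mkf_continuous (hu : ∀ l, Continuous (u l))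
    (hh : ∀ r, Continuous fun p : (Fin n → ℝ) × (Fin n → ℝ) => h r p.1 p.2) :
    Continuous (mkf (k := k) u h hs) := by
  refine Continuous.prodMk ?_ ?_
  · exact continuous_pi fun l => continuous_pi fun i => (hu l).comp (row_continuous i)
  · refine continuous_pi fun r => continuous_pi ?_
    rintro ⟨z, hz⟩
    induction z using Sym2.ind with
    | _ i j =>
      exact (hh r).comp ((row_continuous i).prodMk (row_continuous j))

theorem mkf_equiv (hu : ∀ l v, u l (-v) = - u l v) (hh : ∀ r v w, h r (-v) w = - h r v w)
    (g : SP k) (x : Fin k × Fin n → ℝ) : mkf u h hs (xact g x) = rho g (mkf u h hs x) := by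
  have hrow : ∀ i, row (xact g x) i = row x (g.perm i) ∧ g.sgn i = 1 ∨
      row (xact g x) i = - row x (g.perm i) ∧ g.sgn i = -1 := by
    intro i
    rcases Int.units_eq_one_or (g.sgn i) with h | h
    · left; refine ⟨?_, h⟩; funext c; simp [row, xact, h]
    · right; refine ⟨?_, h⟩; funext c; simp [row, xact, h]
  have hh' : ∀ r v w, h r v (-w) = - h r v w := fun r v w => by rw [hs, hh, hs]
  refine Prod.ext ?_ ?_
  · funext l i
    rcases hrow i with ⟨h1, h2⟩ | ⟨h1, h2⟩ <;> simp [rho, rho1, mkf, h1, h2, hu]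
  · funext r ⟨z, hz⟩
    induction z using Sym2.ind with
    | _ i j =>
      rcases hrow i with ⟨h1, h2⟩ | ⟨h1, h2⟩ <;> rcases hrow j with ⟨h3, h4⟩ | ⟨h3, h4⟩ <;>
        simp [rho, rho1, mkf, psg, h1, h2, h3, h4, hh, hh']

theorem mkf_zero_iff (x : Fin k × Fin n → ℝ) : mkf u h hs x = 0 ↔
    (∀ l i, u l (row x i) = 0) ∧ ∀ r i j, i ≠ j → h r (row x i) (row x j) = 0 := by
  constructor
  · intro H
    refine ⟨fun l i => congrFun (congrFun (congrArg Prod.fst H) l) i, fun r i j hij => ?_⟩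
    exact congrFun (congrFun (congrArg Prod.snd H) r) ⟨s(i, j), by simpa using hij⟩
  · rintro ⟨h1, h2⟩
    refine Prod.ext ?_ ?_
    · funext l i; exact h1 l i
    · funext r ⟨z, hz⟩
      induction z using Sym2.ind with
      | _ i j => exact h2 r i j (by simpa using hz)

/-- combination of two such maps is again one -/
theorem mkf_comb (u' : Fin m1 → (Fin n → ℝ) → ℝ) (h' : Fin b2 → (Fin n → ℝ) → (Fin n → ℝ) → ℝ)
    (hs' : ∀ r v w, h' r v w = h' r w v) (a b : ℝ) (x : Fin k × Fin n → ℝ)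
    (H : a • mkf u h hs x + b • mkf u' h' hs' x = 0) :
    (∀ l i, a * u l (row x i) + b * u' l (row x i) = 0) ∧
      ∀ r i j, i ≠ j → a * h r (row x i) (row x j) + b * h' r (row x i) (row x j) = 0 := by
  refine ⟨fun l i => congrFun (congrFun (congrArg Prod.fst H) l) i, fun r i j hij => ?_⟩
  exact congrFun (congrFun (congrArg Prod.snd H) r) ⟨s(i, j), by simpa using hij⟩

/-- fixed points of nontrivial elements have two proportional rows -/
theorem xact_fixed {g : SP k} (hg : g ≠ 1) {x : Fin k × Fin n → ℝ} (hx : InXR x)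
    (hf : xact g x = x) : ∃ i j, i ≠ j ∧ (row x i = row x j ∨ row x i = - row x j) := by
  have hrow : ∀ i c, x (i, c) = ((g.sgn i : ℤ) : ℝ) * x (g.perm i, c) := fun i c =>
    (congrFun hf (i, c)).symm
  by_cases hp : ∀ i, g.perm i = i
  · exfalso
    apply hg
    apply SP.ext'
    · intro i; rw [hp, SP.one_perm]
    · intro i
      rw [SP.one_sgn]
      rcases Int.units_eq_one_or (g.sgn i) with h | h
      · exact h
      · obtain ⟨c, hc⟩ := hx.2 i
        have := hrow i c
        rw [hp, h] at this
        have h0 : x (i, c) = 0 := by push_cast at this; linarith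
        rw [h0] at hc; simp at hc
  · push Not at hp
    obtain ⟨i, hi⟩ := hp
    refine ⟨i, g.perm i, hi.symm, ?_⟩
    rcases Int.units_eq_one_or (g.sgn i) with h | h
    · left; funext c; simp [row, hrow i c, h]
    · right; funext c; simp [row, hrow i c, h]

end
end

section

section
open Nat

theorem odd_choose (q : ℕ) : ∀ p, Odd (choose (p * 2 ^ q + 2 ^ q - 1) (2 ^ q - 1)) := by
  induction q with
  | zero => intro p; simp
  | succ q ih =>
    intro p
    have h1 : 1 ≤ 2 ^ q := Nat.one_le_two_pow
    have hp2 : Fact (Nat.Prime 2) := ⟨Nat.prime_two⟩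
    have h := Choose.choose_modEq_choose_mod_mul_choose_div_nat (p := 2)
      (n := p * 2 ^ (q + 1) + 2 ^ (q + 1) - 1) (k := 2 ^ (q + 1) - 1)
    have hP : p * 2 ^ (q + 1) = 2 * (p * 2 ^ q) := by rw [pow_succ]; ring
    have hQ : 2 ^ (q + 1) = 2 * 2 ^ q := by rw [pow_succ]; ring
    have e1 : (p * 2 ^ (q + 1) + 2 ^ (q + 1) - 1) % 2 = 1 := by rw [hP]; omega
    have e2 : (2 ^ (q + 1) - 1) % 2 = 1 := by omega
    have e3 : (p * 2 ^ (q + 1) + 2 ^ (q + 1) - 1) / 2 = p * 2 ^ q + 2 ^ q - 1 := by rw [hP]; omega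
    have e4 : (2 ^ (q + 1) - 1) / 2 = 2 ^ q - 1 := by omega
    rw [e1, e2, e3, e4, choose_self, one_mul] at h
    rw [Nat.odd_iff] at *
    have := ih p
    rw [Nat.odd_iff] at this
    have h' : _ % 2 = _ % 2 := h
    rw [h', this]

theorem odd_uniformBell (q k : ℕ) : Odd (uniformBell k (2 ^ q)) := by
  rw [uniformBell_eq]
  apply Finset.prod_induction _ Odd (fun a b => Odd.mul) odd_one
  intro p _
  exact odd_choose q p

/-- labelled balanced partitions -/
@[ext] structure Lab (k B K : ℕ) where
  /-- the labelling -/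
  fn : Fin K → Fin k
  /-- balance -/
  bal : ∀ i, (Finset.univ.filter fun s => fn s = i).card = B

instance (k B K : ℕ) : Finite (Lab k B K) :=
  Finite.of_injective (fun β : Lab k B K => β.fn) (fun _ _ h => Lab.ext h)

instance (k B K : ℕ) : Fintype (Lab k B K) := Fintype.ofFinite _

variable {k B K : ℕ}

instance : MulAction (Equiv.Perm (Fin k)) (Lab k B K) where
  smul τ β := ⟨fun s => τ (β.1 s), fun i => by
    have h := β.2 (τ.symm i)
    simp only [Equiv.eq_symm_apply] at h
    exact h⟩
  one_smul β := rfl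
  mul_smul σ τ β := rfl

theorem smul_lab (τ : Equiv.Perm (Fin k)) (β : Lab k B K) (s : Fin K) : (τ • β).1 s = τ (β.1 s) := rfl

theorem lab_surj (hB : 1 ≤ B) (β : Lab k B K) (i : Fin k) : ∃ s, β.1 s = i := by
  have : (Finset.univ.filter fun s => β.1 s = i).Nonempty := by
    rw [← Finset.card_pos, β.2]; omega
  obtain ⟨s, hs⟩ := this
  exact ⟨s, by simpa using hs⟩

/-- balanced partitions -/
abbrev RR (k B K : ℕ) : Type := Quotient (MulAction.orbitRel (Equiv.Perm (Fin k)) (Lab k B K))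

instance : Fintype (RR k B K) := Fintype.ofFinite _

theorem card_lab_RR (hB : 1 ≤ B) : Nat.card (Lab k B K) = Nat.card (RR k B K) * k ! := by
  have h : ∀ β : Lab k B K, MulAction.stabilizer (Equiv.Perm (Fin k)) β = ⊥ := by
    intro β
    rw [eq_bot_iff]
    intro τ hτ
    rw [MulAction.mem_stabilizer_iff] at hτ
    rw [Subgroup.mem_bot]
    apply Equiv.ext
    intro i
    obtain ⟨s, rfl⟩ := lab_surj hB β i
    rw [← smul_lab, hτ]; rfl
  rw [Nat.card_congr (MulAction.selfEquivOrbitsQuotientProd h), Nat.card_prod, Nat.card_perm]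
  simp

theorem card_lab (hK : K = k * B) : Nat.card (Lab k B K) * (B ! ^ k) = K ! := by
  classical
  let f : (Fin K ≃ Fin k × Fin B) → Lab k B K := fun e => ⟨fun s => (e s).1, fun i => by
    have inj : ∀ i, Function.Injective fun b => e.symm (i, b) := fun i b c h => by simpa using h
    have : (Finset.univ.filter fun s => (e s).1 = i) =
        ((Finset.univ : Finset (Fin B)).map ⟨fun b => e.symm (i, b), inj i⟩) := by
      ext s
      simp only [Finset.mem_filter, Finset.mem_univ, true_and, Finset.mem_map, Function.Embedding.coeFn_mk]
      constructor
      · rintro rfl; exact ⟨(e s).2, by simp⟩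
      · rintro ⟨b, rfl⟩; simp
    rw [this]; simp⟩
  have hcard : ∀ β : Lab k B K, ∀ i, Fintype.card {s // β.1 s = i} = B := by
    intro β i
    rw [Fintype.card_subtype, β.2]
  have hfib : ∀ β : Lab k B K, Nat.card {e // f e = β} = B ! ^ k := by
    intro β
    let e0 : Fin K ≃ Fin k × Fin B :=
      (Equiv.sigmaFiberEquiv β.1).symm.trans
        ((Equiv.sigmaCongrRight fun i => Fintype.equivFinOfCardEq (hcard β i)).trans
          (Equiv.sigmaEquivProd _ _))
    have he0 : ∀ s, (e0 s).1 = β.1 s := fun s => rfl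
    have E : {e // f e = β} ≃ {g : Equiv.Perm (Fin K) // β.1 ∘ g = β.1} :=
      { toFun := fun e => ⟨e.1.trans e0.symm, by
          funext s
          have h1 := congrFun (congrArg Lab.fn e.2) s
          change (e.1 s).1 = β.1 s at h1
          simp [← he0] at h1 ⊢
          exact h1⟩
        invFun := fun g => ⟨g.1.trans e0, by
          apply Lab.ext
          funext s
          have h1 := congrFun g.2 s
          change (e0 (g.1 s)).1 = β.1 s
          rw [he0]; exact h1⟩
        left_inv := fun e => by
          apply Subtype.ext; ext s <;> simp
        right_inv := fun g => by
          apply Subtype.ext; ext s; simp }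
    rw [Nat.card_congr E, Nat.card_eq_fintype_card, DomMulAct.stabilizer_card]
    simp [hcard]
  have h1 : Nat.card (Fin K ≃ Fin k × Fin B) = K ! := by
    rw [Nat.card_eq_fintype_card, Fintype.card_equiv ((finCongr hK).trans finProdFinEquiv.symm)]
    simp
  rw [← h1, Nat.card_congr (Equiv.sigmaFiberEquiv f).symm, Nat.card_sigma]
  simp only [hfib, Finset.sum_const, Finset.card_univ, smul_eq_mul, Nat.card_eq_fintype_card]

theorem odd_RR (q : ℕ) (hK : K = k * 2 ^ q) : Odd (Fintype.card (RR k (2 ^ q) K)) := by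
  have h1 : 1 ≤ 2 ^ q := Nat.one_le_two_pow
  have h2 := card_lab hK
  rw [card_lab_RR h1, hK, ← uniformBell_mul_eq k (n := 2 ^ q) (by omega), ← hK] at h2
  have h3 : 0 < (2 ^ q)! ^ k * k ! := Nat.mul_pos (Nat.pow_pos (Nat.factorial_pos _)) (Nat.factorial_pos _)
  have h4 : Nat.card (RR k (2 ^ q) K) = uniformBell k (2 ^ q) := by
    apply Nat.eq_of_mul_eq_mul_right h3
    linarith
  rw [← Nat.card_eq_fintype_card, h4]
  exact odd_uniformBell q k

end
end

section

section
open Polynomial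
variable {n D : ℕ}

/-- polynomial whose coefficients are the first `D` coordinates -/
def polyL (D : ℕ) : (Fin n → ℝ) →ₗ[ℝ] ℝ[X] where
  toFun v := ∑ c : Fin n, if c.1 < D then C (v c) * X ^ c.1 else 0
  map_add' v w := by
    rw [← Finset.sum_add_distrib]
    refine Finset.sum_congr rfl fun c _ => ?_
    split_ifs <;> simp [add_mul]
  map_smul' a v := by
    rw [Finset.smul_sum]
    refine Finset.sum_congr rfl fun c _ => ?_
    split_ifs <;> simp [smul_eq_C_mul, mul_assoc]

theorem polyL_coeff (v : Fin n → ℝ) (c : ℕ) :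
    (polyL D v).coeff c = if h : c < n ∧ c < D then v ⟨c, h.1⟩ else 0 := by
  have e : (polyL D v).coeff c = ∑ c' : Fin n, if c = c'.1 then (if c'.1 < D then v c' else 0) else 0 := by
    change (∑ c : Fin n, if c.1 < D then C (v c) * X ^ c.1 else 0).coeff c = _
    rw [finsetSum_coeff]
    refine Finset.sum_congr rfl fun c' _ => ?_
    split_ifs <;> simp_all [coeff_X_pow]
  rw [e]
  by_cases h1 : c < n
  · rw [Finset.sum_eq_single (⟨c, h1⟩ : Fin n)]
    · by_cases h2 : c < D <;> simp [h1, h2]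
    · intro b _ hb
      rw [if_neg]
      rintro rfl; exact hb rfl
    · simp
  · rw [dif_neg (by tauto)]
    apply Finset.sum_eq_zero
    intro b _
    rw [if_neg]; rintro rfl; exact h1 b.2

theorem polyL_deg (hD : 1 ≤ D) (v : Fin n → ℝ) : (polyL D v).natDegree < D := by
  have : (polyL D v).natDegree ≤ D - 1 := by
    rw [natDegree_le_iff_coeff_eq_zero]
    intro N hN
    rw [polyL_coeff, dif_neg]; omega
  omega

/-- node values as continuous functionals -/
def phiL (D : ℕ) (z : ℝ) : (Fin n → ℝ) →L[ℝ] ℝ :=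
  LinearMap.toContinuousLinearMap ((Polynomial.leval z).comp (polyL D))

theorem phiL_apply (z : ℝ) (v : Fin n → ℝ) : phiL D z v = (polyL D v).eval z := rfl

end

section
open Polynomial
variable {k n K m1 b2 : ℕ}

/-- row as a continuous linear map -/
def rowL (i : Fin k) : (Fin k × Fin n → ℝ) →L[ℝ] (Fin n → ℝ) :=
  ContinuousLinearMap.pi fun c => ContinuousLinearMap.proj (i, c)

theorem rowL_apply (i : Fin k) (x : Fin k × Fin n → ℝ) : rowL i x = row x i := rfl

theorem quad_deriv (u : Fin m1 → (Fin n → ℝ) →L[ℝ] ℝ) (φ : Fin K → (Fin n → ℝ) →L[ℝ] ℝ)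
    (c : Fin b2 → Fin K → ℝ) (h : Fin b2 → (Fin n → ℝ) → (Fin n → ℝ) → ℝ)
    (hh : ∀ r v w, h r v w = ∑ s, c r s * (φ s v * φ s w))
    (hs : ∀ r v w, h r v w = h r w v) (x : Fin k × Fin n → ℝ) :
    ∃ T : (Fin k × Fin n → ℝ) →L[ℝ] VV k m1 b2,
      HasFDerivAt (mkf (fun l v => u l v) h hs) T x ∧
      ∀ y, T y = 0 → (∀ l i, u l (row y i) = 0) ∧ ∀ r i j, i ≠ j →
        ∑ s, c r s * (φ s (row x i) * φ s (row y j) + φ s (row y i) * φ s (row x j)) = 0 := by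
  have hA : ∀ (r : Fin b2) (z : {z : Sym2 (Fin k) // ¬ z.IsDiag}),
      ∃ A : (Fin k × Fin n → ℝ) →L[ℝ] ℝ,
        HasFDerivAt (fun x : Fin k × Fin n → ℝ =>
          Sym2.lift ⟨fun i j => h r (row x i) (row x j), fun _ _ => hs _ _ _⟩ z.1) A x ∧
        ∀ i j, z.1 = s(i, j) → ∀ y, A y =
          ∑ s, c r s * (φ s (row x i) * φ s (row y j) + φ s (row y i) * φ s (row x j)) := by
    rintro r ⟨z, hz⟩
    induction z using Sym2.ind with
    | _ i j =>
      have h1 := HasFDerivAt.fun_sum (u := Finset.univ) (x := x) (fun s _ =>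
        ((((φ s).comp (rowL i)).hasFDerivAt (x := x)).mul
          (((φ s).comp (rowL j)).hasFDerivAt (x := x))).const_mul (c r s))
      refine ⟨_, h1.congr_of_eventuallyEq (Filter.Eventually.of_forall fun y => ?_), ?_⟩
      · simp only [Sym2.lift_mk, hh]
        rfl
      · intro i' j' hij y
        simp only [ContinuousLinearMap.sum_apply, ContinuousLinearMap.smul_apply,
          ContinuousLinearMap.add_apply, ContinuousLinearMap.comp_apply, rowL_apply, smul_eq_mul]
        apply Finset.sum_congr rfl
        intro s _
        rcases Sym2.eq_iff.1 hij with ⟨rfl, rfl⟩ | ⟨rfl, rfl⟩ <;> ring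
  choose A hA1 hA2 using hA
  refine ⟨(ContinuousLinearMap.pi fun l => ContinuousLinearMap.pi fun i => (u l).comp (rowL i)).prod
    (ContinuousLinearMap.pi fun r => ContinuousLinearMap.pi fun z => A r z), ?_, ?_⟩
  · refine HasFDerivAt.prodMk ?_ ?_
    · exact hasFDerivAt_pi.2 fun l => hasFDerivAt_pi.2 fun i => ((u l).comp (rowL i)).hasFDerivAt
    · exact hasFDerivAt_pi.2 fun r => hasFDerivAt_pi.2 fun z => hA1 r z
  · intro y hy
    refine ⟨fun l i => congrFun (congrFun (congrArg Prod.fst hy) l) i, fun r i j hij => ?_⟩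
    rw [← hA2 r ⟨s(i, j), by simpa using hij⟩ i j rfl y]
    exact congrFun (congrFun (congrArg Prod.snd hy) r) ⟨s(i, j), by simpa using hij⟩

end
end

section

section
open Polynomial
variable {k K : ℕ}

/-- nodes -/
def zn (K : ℕ) (s : Fin K) : ℝ := (K : ℝ) + 1 + s.1

/-- inverse nodes -/
def wn (K : ℕ) (s : Fin K) : ℝ := 1 / zn K s

theorem zn_pos (s : Fin K) : 0 < zn K s := by unfold zn; positivity

theorem zn_inj : Function.Injective (zn K) := by
  intro s t h
  unfold zn at h
  have : (s.1 : ℝ) = t.1 := by linarith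
  exact Fin.ext (by exact_mod_cast this)

theorem wn_zn (s : Fin K) : wn K s * zn K s = 1 := by
  unfold wn; field_simp [(zn_pos s).ne']

theorem wn_nonneg (s : Fin K) : 0 ≤ wn K s := by unfold wn; have := zn_pos s; positivity

theorem wn_sum (A : Finset (Fin K)) : ∑ s ∈ A, wn K s < 1 := by
  have h1 : ∀ s, wn K s ≤ 1 / ((K : ℝ) + 1) := by
    intro s
    unfold wn
    apply one_div_le_one_div_of_le (by positivity)
    unfold zn; have : (0 : ℝ) ≤ s.1 := by positivity
    linarith
  calc ∑ s ∈ A, wn K s ≤ ∑ s, wn K s :=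
        Finset.sum_le_sum_of_subset_of_nonneg (Finset.subset_univ _) fun s _ _ => wn_nonneg s
    _ ≤ ∑ _s : Fin K, 1 / ((K : ℝ) + 1) := Finset.sum_le_sum fun s _ => h1 s
    _ = K / (K + 1) := by simp; ring
    _ < 1 := by rw [div_lt_one (by positivity)]; linarith

theorem rp_coeff0 (β : Fin K → Fin k) (i : Fin k) : (rpoly (wn K) β i).coeff 0 = 1 :=
  (coeff_bound _ wn_nonneg _ (wn_sum _)).1

theorem rp_coeff (β : Fin K → Fin k) (i : Fin k) (c : ℕ) (hc : c ≠ 0) :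
    |(rpoly (wn K) β i).coeff c| < 1 :=
  ((coeff_bound _ wn_nonneg _ (wn_sum _)).2 c hc).trans_lt (wn_sum _)

/-- standard zeros -/
def rr (n : ℕ) (β : Fin K → Fin k) : Fin k × Fin n → ℝ := fun x => (rpoly (wn K) β x.1).coeff x.2.1

variable {B D n' m1 : ℕ}

theorem polyL_rr (hD : D + B = K + 1) (hn : n' + 1 = D + m1) (β : Lab k B K) (i : Fin k) :
    polyL D (row (rr (n' + 1) β.1) i) = rpoly (wn K) β.1 i := by
  ext c
  rw [polyL_coeff]
  split_ifs with h
  · rfl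
  · symm
    apply coeff_eq_zero_of_natDegree_lt
    have := rpoly_deg (wn K) β.1 i (β.2 i)
    omega

theorem rr_large (hD : D + B = K + 1) (β : Lab k B K) (i : Fin k) (c : Fin (n' + 1))
    (hc : D ≤ c.1) : rr (n' + 1) β.1 (i, c) = 0 := by
  apply coeff_eq_zero_of_natDegree_lt
  have := rpoly_deg (wn K) β.1 i (β.2 i)
  simp only at *
  omega

theorem rr_sep (hB : 1 ≤ B) (hD : D + B = K + 1) (hn : n' + 1 = D + m1) (g h : SP k)
    (a b : RR k B K) (H : xact g (rr (n' + 1) a.out.1) = xact h (rr (n' + 1) b.out.1)) :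
    g = h ∧ a = b := by
  have hsgn : ∀ i, g.sgn i = h.sgn i := by
    intro i
    have := congrFun H (i, 0)
    simp only [xact, rr, Fin.val_zero, rp_coeff0, mul_one] at this
    exact Units.ext (by exact_mod_cast this)
  have hrow : ∀ i, row (rr (n' + 1) a.out.1) (g.perm i) = row (rr (n' + 1) b.out.1) (h.perm i) := by
    intro i
    funext c
    have := congrFun H (i, c)
    simp only [xact, hsgn] at this
    exact mul_left_cancel₀ (by exact_mod_cast (h.sgn i).ne_zero) this
  have hpol : ∀ i, rpoly (wn K) a.out.1 (g.perm i) = rpoly (wn K) b.out.1 (h.perm i) := by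
    intro i
    rw [← polyL_rr hD hn, ← polyL_rr hD hn, hrow]
  have hβ : ∀ i s, a.out.1 s = g.perm i ↔ b.out.1 s = h.perm i := by
    intro i s
    rw [← rpoly_eval (zn K) (wn K) wn_zn zn_inj, ← rpoly_eval (zn K) (wn K) wn_zn zn_inj, hpol]
  have hab : a = b := by
    rw [← Quotient.out_eq a, ← Quotient.out_eq b]
    apply Quotient.sound
    refine ⟨g.perm * h.perm⁻¹, ?_⟩
    apply Lab.ext
    funext s
    change g.perm (h.perm⁻¹ (b.out.1 s)) = a.out.1 s
    symm
    rw [hβ]; simp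
  refine ⟨SP.ext' (fun i => ?_) hsgn, hab⟩
  obtain ⟨s, hs⟩ := lab_surj hB a.out (g.perm i)
  have := (hβ i s).1 hs
  rw [← hs, ← this, hab]

theorem rr_zeros (hB : 1 ≤ B) (hK : K = k * B) (hD : D + B = K + 1) (hn : n' + 1 = D + m1)
    (x : Fin k × Fin (n' + 1) → ℝ) (hx : InXR x)
    (h1 : ∀ i (c : Fin (n' + 1)), D ≤ c.1 → x (i, c) = 0)
    (h2 : ∀ i j, i ≠ j → ∀ r < 2 * B,
      ∑ s, zn K s ^ r * ((polyL D (row x i)).eval (zn K s) * (polyL D (row x j)).eval (zn K s)) = 0) :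
    ∃ (g : SP k) (a : RR k B K), x = xact g (rr (n' + 1) a.out.1) := by
  have hKB : k ≠ 0 → B ≤ K := fun h => by rw [hK]; exact Nat.le_mul_of_pos_left _ (by omega)
  have hcoef : ∀ i (c : Fin (n' + 1)), c.1 < D → (polyL D (row x i)).coeff c.1 = x (i, c) := by
    intro i c hc
    rw [polyL_coeff, dif_pos ⟨c.2, hc⟩]; rfl
  have hdeg : ∀ i, (polyL D (row x i)).natDegree + B ≤ K := by
    intro i
    have := hKB (by have := i.2; omega)
    have := polyL_deg (D := D) (by omega) (row x i)
    omega
  have hD0 : ∀ _ : Fin k, 0 < D := fun i => by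
    have := hKB (by have := i.2; omega)
    omega
  obtain ⟨β, hβ1, hβ2⟩ := classify (zn K) zn_inj hK hB (fun i => polyL D (row x i)) (by
    intro i h0
    obtain ⟨c, hc⟩ := hx.2 i
    by_cases hcD : c.1 < D
    · have := hcoef i c hcD
      rw [h0, coeff_zero] at this
      rw [← this] at hc; simp at hc
    · rw [h1 i c (by omega)] at hc; simp at hc) hdeg h2
  have huniq : ∀ i, polyL D (row x i) = C (x (i, 0)) * rpoly (wn K) β i := by
    intro i
    have := rpoly_unique (zn K) (wn K) wn_zn zn_inj β i (hβ1 i) (rp_coeff0 β i) (polyL D (row x i))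
      (hdeg i) (fun s hs => by
        by_contra h; exact hs ((hβ2 i s).1 h))
    rw [← hcoef i 0 (hD0 i)]
    exact this
  have hval : ∀ i c, x (i, c) = x (i, 0) * (rpoly (wn K) β i).coeff c.1 := by
    intro i c
    by_cases hcD : c.1 < D
    · rw [← hcoef i c hcD, huniq, coeff_C_mul]
    · rw [h1 i c (by omega), coeff_eq_zero_of_natDegree_lt, mul_zero]
      have := rpoly_deg (wn K) β i (hβ1 i)
      omega
  have habs : ∀ i, |x (i, 0)| = 1 := by
    intro i
    obtain ⟨c, hc⟩ := hx.2 i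
    by_cases hc0 : c = 0
    · rw [← hc0]; exact hc
    · exfalso
      rw [hval, abs_mul] at hc
      have h3 := rp_coeff β i c.1 (by intro h; exact hc0 (Fin.ext h))
      have h4 := hx.1 (i, 0)
      have h5 := abs_nonneg ((rpoly (wn K) β i).coeff c.1)
      nlinarith [abs_nonneg (x (i, 0))]
  have hsg : ∀ i, ∃ u : ℤˣ, x (i, 0) = ((u : ℤ) : ℝ) := by
    intro i
    rcases eq_or_eq_neg_of_abs_eq (habs i) with h | h
    · exact ⟨1, by simp [h]⟩
    · exact ⟨-1, by simp [h]⟩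
  choose sg hsg using hsg
  let L : Lab k B K := ⟨β, hβ1⟩
  let a : RR k B K := Quotient.mk _ L
  obtain ⟨τ, hτ⟩ : ∃ τ : Equiv.Perm (Fin k), τ • L = a.out :=
    (Quotient.mk_out (s := MulAction.orbitRel (Equiv.Perm (Fin k)) (Lab k B K)) L)
  refine ⟨⟨τ, sg⟩, a, ?_⟩
  funext ⟨i, c⟩
  rw [← hτ]
  have hrp : rpoly (wn K) (τ • L).1 (τ i) = rpoly (wn K) β i := by
    unfold rpoly
    simp only [smul_lab, ne_eq, EmbeddingLike.apply_eq_iff_eq]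
    rfl
  simp only [xact, rr]
  rw [hrp, hval, hsg]

end
end

section

section
open Polynomial

/-- reference pair map -/
def h0 (K D n b2 : ℕ) (r : Fin b2) (v w : Fin n → ℝ) : ℝ :=
  ∑ s : Fin K, zn K s ^ r.1 * (phiL D (zn K s) v * phiL D (zn K s) w)

theorem top2 {q k B K D n' m1 : ℕ} (hk : 2 ≤ k) (hBq : B = 2 ^ q) (hK : K = k * B)
    (hD : D + B = K + 1) (hn : n' + 1 = D + m1) (hm1 : m1 + 1 = 2 * B)
    (u : Fin m1 → (Fin (n' + 1) → ℝ) → ℝ)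
    (h : Fin (2 * B) → (Fin (n' + 1) → ℝ) → (Fin (n' + 1) → ℝ) → ℝ)
    (hs : ∀ r v w, h r v w = h r w v)
    (hu : ∀ l, Continuous (u l))
    (hh : ∀ r, Continuous fun p : (Fin (n' + 1) → ℝ) × (Fin (n' + 1) → ℝ) => h r p.1 p.2)
    (huo : ∀ l v, u l (-v) = - u l v) (hho : ∀ r v w, h r (-v) w = - h r v w)
    (r0 : Fin (2 * B)) (hr0 : r0.1 = 0)
    (hn1 : ∀ v, 0 ≤ h r0 v v)
    (hn2 : ∀ v, v ≠ 0 → h r0 v v = 0 → ∀ s : ℝ, 0 < s → s ≤ 1 →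
      ∃ (l : Fin m1), (1 - s) * v ⟨D + l, by omega⟩ + s * u l v ≠ 0) :
    ∃ x : Fin k × Fin (n' + 1) → ℝ, InXR x ∧ (∀ l i, u l (row x i) = 0) ∧
      ∀ r i j, i ≠ j → h r (row x i) (row x j) = 0 := by
  classical
  have hB : 1 ≤ B := by rw [hBq]; exact Nat.one_le_two_pow
  have hKB : 2 * B ≤ K := by rw [hK]; exact Nat.mul_le_mul_right _ hk
  have hD1 : 1 ≤ D := by omega
  let u0 : Fin m1 → (Fin (n' + 1) → ℝ) →L[ℝ] ℝ := fun l =>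
    ContinuousLinearMap.proj ⟨D + l, by omega⟩
  let hh0 := h0 K D (n' + 1) (2 * B)
  have hs0 : ∀ r v w, hh0 r v w = hh0 r w v := by
    intro r v w
    exact Finset.sum_congr rfl fun s _ => by ring
  let f0 : (Fin k × Fin (n' + 1) → ℝ) → VV k m1 (2 * B) := mkf (fun l v => u0 l v) hh0 hs0
  let f1 : (Fin k × Fin (n' + 1) → ℝ) → VV k m1 (2 * B) := mkf u h hs
  have hzero0 : ∀ v : Fin (n' + 1) → ℝ, hh0 r0 v v = 0 → ∀ c : Fin (n' + 1), c.1 < D → v c = 0 := by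
    intro v hv c hc
    have hpz : ∀ s, (polyL D v).eval (zn K s) = 0 := by
      intro s
      have h1 := (Finset.sum_eq_zero_iff_of_nonneg (fun s _ => by
        rw [hr0, pow_zero, one_mul]; exact mul_self_nonneg _)).1 hv s (Finset.mem_univ _)
      rw [hr0, pow_zero, one_mul] at h1
      exact mul_self_eq_zero.1 h1
    have hp : polyL D v = 0 := zero_of_nodes (zn K) zn_inj _ Finset.univ (fun s _ => hpz s) (by
      have := polyL_deg hD1 v
      simp only [Finset.card_univ, Fintype.card_fin]; omega)
    have := polyL_coeff (D := D) v c.1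
    rw [hp, dif_pos ⟨c.2, hc⟩] at this
    simpa using this.symm
  have hpos0 : ∀ v, 0 ≤ hh0 r0 v v := by
    intro v
    apply Finset.sum_nonneg
    intro s _
    rw [hr0, pow_zero, one_mul]; exact mul_self_nonneg _
  have hchoose : 2 * k.choose 2 = k * (k - 1) := by
    rw [Nat.choose_two_right, Nat.two_mul_div_two_of_even (Nat.even_mul_pred_self k)]
  have hT : ∀ a : RR k B K, ∃ T : (Fin k × Fin (n' + 1) → ℝ) →L[ℝ] VV k m1 (2 * B),
      HasFDerivAt f0 T (rr (n' + 1) a.out.1) ∧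
      ∀ y, T y = 0 → (∀ l i, u0 l (row y i) = 0) ∧ ∀ (r : Fin (2 * B)) i j, i ≠ j →
        ∑ s, zn K s ^ r.1 * (phiL D (zn K s) (row (rr (n' + 1) a.out.1) i) * phiL D (zn K s) (row y j) +
          phiL D (zn K s) (row y i) * phiL D (zn K s) (row (rr (n' + 1) a.out.1) j)) = 0 := fun a =>
    quad_deriv u0 (fun s => phiL D (zn K s)) (fun (r : Fin (2 * B)) s => zn K s ^ r.1) hh0
      (fun r v w => rfl) hs0 _
  choose T hT1 hT2 using hT
  have key := top_thm (k := k) (n' := n') (N := k * n') (V := VV k m1 (2 * B)) (R := RR k B K) rfl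
    (Nat.one_le_iff_ne_zero.2 (Nat.mul_ne_zero (by omega) (by omega)))
    (by
      rw [finrank_VV]
      have h1 : n' + 1 = k * B + B := by omega
      obtain ⟨k', rfl⟩ : ∃ k', k = k' + 1 := ⟨k - 1, by omega⟩
      have h2 : 2 * B * (k' + 1).choose 2 = B * ((k' + 1) * k') := by
        rw [Nat.add_sub_cancel] at hchoose
        rw [← hchoose]; ring
      rw [h2]
      have h3 : m1 + B * k' = n' := by
        have : (k' + 1) * B = B * k' + B := by ring
        omega
      rw [← h3]; ring)
    rho f0 f1
    (mkf_continuous _ _ _ (fun l => (u0 l).continuous) (fun r => by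
      change Continuous fun p : (Fin (n' + 1) → ℝ) × (Fin (n' + 1) → ℝ) =>
        ∑ s : Fin K, zn K s ^ r.1 * (phiL D (zn K s) p.1 * phiL D (zn K s) p.2)
      fun_prop))
    (mkf_continuous _ _ _ hu hh)
    (mkf_equiv _ _ _ (fun l v => by simp) (fun r v w => by
      change ∑ s : Fin K, zn K s ^ r.1 * (phiL D (zn K s) (-v) * phiL D (zn K s) w) =
        -∑ s : Fin K, zn K s ^ r.1 * (phiL D (zn K s) v * phiL D (zn K s) w)
      rw [← Finset.sum_neg_distrib]
      exact Finset.sum_congr rfl fun s _ => by rw [map_neg]; ring))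
    (mkf_equiv _ _ _ huo hho)
    (by
      intro x hx g hg hgx s hs0' hs1 H
      obtain ⟨H1, H2⟩ := mkf_comb _ _ _ _ _ _ _ _ _ H
      obtain ⟨i, j, hij, hrow⟩ := xact_fixed hg hx hgx
      have hv : row x j ≠ 0 := by
        obtain ⟨c, hc⟩ := hx.2 j
        intro h
        have := congrFun h c
        simp only [row, Pi.zero_apply] at this
        rw [this] at hc; simp at hc
      have h3 : (1 - s) * hh0 r0 (row x j) (row x j) + s * h r0 (row x j) (row x j) = 0 := by
        have h4 := H2 r0 i j hij
        rcases hrow with h5 | h5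
        · rwa [h5] at h4
        · rw [h5, hho] at h4
          have h6 : hh0 r0 (-row x j) (row x j) = - hh0 r0 (row x j) (row x j) := by
            change ∑ s : Fin K, _ = -∑ s : Fin K, _
            rw [← Finset.sum_neg_distrib]
            exact Finset.sum_congr rfl fun s _ => by rw [map_neg]; ring
          rw [h6] at h4
          linarith
      rcases hs0'.eq_or_lt with h0s | h0s
      · rw [← h0s] at h3 H1
        simp only [sub_zero, one_mul, zero_mul, add_zero] at h3 H1
        apply hv
        funext c
        by_cases hc : c.1 < D
        · exact hzero0 _ h3 c hc
        · have h7 := H1 ⟨c.1 - D, by omega⟩ j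
          change row x j ⟨D + (c.1 - D), _⟩ = 0 at h7
          have h8 : (⟨D + (c.1 - D), by omega⟩ : Fin (n' + 1)) = c := Fin.ext (by simp only; omega)
          rw [h8] at h7
          exact h7
      · have h4 := hpos0 (row x j)
        have h5 := hn1 (row x j)
        have h6 : h r0 (row x j) (row x j) = 0 := by
          have a1 : 0 ≤ (1 - s) * hh0 r0 (row x j) (row x j) := mul_nonneg (by linarith) h4
          have a2 : 0 ≤ s * h r0 (row x j) (row x j) := mul_nonneg h0s.le h5
          have a3 : s * h r0 (row x j) (row x j) = 0 := by linarith
          exact (mul_eq_zero.1 a3).resolve_left h0s.ne'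
        obtain ⟨l, hl⟩ := hn2 _ hv h6 s h0s hs1
        exact hl (H1 l j))
    (fun a => rr (n' + 1) a.out.1)
    (fun a i => rp_coeff0 _ _)
    (fun a x hx => rp_coeff _ _ _ (by intro h; exact hx (Fin.ext h)))
    (fun g h a b H => rr_sep hB hD hn g h a b H)
    (by
      intro x hx hfx
      obtain ⟨H1, H2⟩ := (mkf_zero_iff _ _ _ _).1 hfx
      refine rr_zeros hB hK hD hn x hx ?_ ?_
      · intro i c hc
        have h7 := H1 ⟨c.1 - D, by omega⟩ i
        change row x i ⟨D + (c.1 - D), _⟩ = 0 at h7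
        have h8 : (⟨D + (c.1 - D), by omega⟩ : Fin (n' + 1)) = c := Fin.ext (by simp only; omega)
        rw [h8] at h7
        exact h7
      · intro i j hij r hr
        exact H2 ⟨r, hr⟩ i j hij)
    T
    (by
      intro a
      refine (mkf_zero_iff _ _ _ _).2 ⟨?_, ?_⟩
      · intro l i
        exact rr_large hD a.out i _ (by simp)
      · intro r i j hij
        apply Finset.sum_eq_zero
        intro s _
        rw [phiL_apply, phiL_apply, polyL_rr hD hn, polyL_rr hD hn]
        by_cases hi : a.out.1 s = i
        · have : (rpoly (wn K) a.out.1 j).eval (zn K s) = 0 := by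
            by_contra hc
            exact hij (hi.symm.trans ((rpoly_eval _ _ wn_zn zn_inj _ _ _).1 hc))
          rw [this]; ring
        · have : (rpoly (wn K) a.out.1 i).eval (zn K s) = 0 := by
            by_contra hc
            exact hi ((rpoly_eval _ _ wn_zn zn_inj _ _ _).1 hc)
          rw [this]; ring)
    hT1
    (by
      intro a y hy0 hTy
      obtain ⟨H1, H2⟩ := hT2 a y hTy
      have hcoef : ∀ i (c : Fin (n' + 1)), c.1 < D → (polyL D (row y i)).coeff c.1 = y (i, c) := by
        intro i c hc
        rw [polyL_coeff, dif_pos ⟨c.2, hc⟩]; rfl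
      have hpol := deriv_inj (zn K) zn_inj hk (fun s => (zn_pos s).ne')
        (fun i => rpoly (wn K) a.out.1 i) (fun i => polyL D (row y i)) a.out.1 a.out.2
        (fun i s => rpoly_eval _ _ wn_zn zn_inj _ _ _)
        (fun i => by have := polyL_deg hD1 (row y i); omega)
        (fun i => by
          rw [← coeff_zero_eq_eval_zero]
          exact (hcoef i 0 hD1).trans (hy0 i))
        (by
          intro i j hij r hr
          have := H2 ⟨r, hr⟩ i j hij
          simp only [phiL_apply, polyL_rr hD hn] at this
          exact this)
      funext ⟨i, c⟩
      by_cases hc : c.1 < D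
      · rw [← hcoef i c hc, hpol i]; simp
      · have h7 := H1 ⟨c.1 - D, by omega⟩ i
        change row y i ⟨D + (c.1 - D), _⟩ = 0 at h7
        have h8 : (⟨D + (c.1 - D), by omega⟩ : Fin (n' + 1)) = c := Fin.ext (by simp only; omega)
        rw [h8] at h7
        exact h7)
    (by subst hBq; exact odd_RR q hK)
  obtain ⟨x, hx, hfx⟩ := key
  obtain ⟨H1, H2⟩ := (mkf_zero_iff _ _ _ _).1 hfx
  exact ⟨x, hx, H1, H2⟩

end
end

section

section
variable {d : ℕ}

theorem hyper_null (a : EuclideanSpace ℝ (Fin d)) (b : ℝ) (h : ‖a‖ + |b| ≠ 0) :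
    volume {x : EuclideanSpace ℝ (Fin d) | b - ⟪a, x⟫ = 0} = 0 := by
  by_cases ha : a = 0
  · subst ha
    have hb : b ≠ 0 := by intro hb; simp [hb] at h
    simp [hb]
  · let x0 : EuclideanSpace ℝ (Fin d) := (b / ⟪a, a⟫) • a
    have haa : (⟪a, a⟫ : ℝ) ≠ 0 := inner_self_ne_zero.2 ha
    have hx0 : (⟪a, x0⟫ : ℝ) = b := by
      simp only [x0, inner_smul_right]; field_simp
    let A : AffineSubspace ℝ (EuclideanSpace ℝ (Fin d)) :=
      AffineSubspace.mk' x0 (LinearMap.ker (innerₛₗ ℝ a))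
    have hA : {x : EuclideanSpace ℝ (Fin d) | b - ⟪a, x⟫ = 0} = (A : Set _) := by
      ext x
      simp only [Set.mem_ofPred_eq, A, SetLike.mem_coe, AffineSubspace.mem_mk', vsub_eq_sub,
        LinearMap.mem_ker, map_sub, innerₛₗ_apply_apply, hx0]
      constructor <;> intro h <;> linarith
    rw [hA]
    apply Measure.addHaar_affineSubspace
    intro htop
    have : x0 + a ∈ A := by rw [htop]; trivial
    simp only [A, AffineSubspace.mem_mk', vsub_eq_sub, add_sub_cancel_left,
        LinearMap.mem_ker, innerₛₗ_apply_apply] at this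
    exact haa this

theorem measurable_rsign : Measurable Real.sign := by
  unfold Real.sign
  exact Measurable.ite measurableSet_Iio measurable_const
    (Measurable.ite measurableSet_Ioi measurable_const measurable_const)

theorem abs_rsign_le (r : ℝ) : |Real.sign r| ≤ 1 := by
  rcases Real.sign_apply_eq r with h | h | h <;> rw [h] <;> simp

theorem continuousAt_rsign {r : ℝ} (hr : r ≠ 0) : ContinuousAt Real.sign r := by
  rcases lt_or_gt_of_ne hr with h | h
  · have : Real.sign =ᶠ[nhds r] fun _ => -1 := by
      filter_upwards [Iio_mem_nhds h] with y hy using Real.sign_of_neg hy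
    exact continuousAt_const.congr this.symm
  · have : Real.sign =ᶠ[nhds r] fun _ => 1 := by
      filter_upwards [Ioi_mem_nhds h] with y hy using Real.sign_of_pos hy
    exact continuousAt_const.congr this.symm

theorem param_cont {X : Type} [TopologicalSpace X] [FirstCountableTopology X]
    (μ : Measure (EuclideanSpace ℝ (Fin d))) [IsFiniteMeasure μ]
    (c : X → ℝ) (hc : Continuous c) (G : X → EuclideanSpace ℝ (Fin d) → ℝ)
    (hG : ∀ x, Measurable (G x)) (hG1 : ∀ x z, |G x z| ≤ 1)
    (hG2 : ∀ x, c x ≠ 0 → ∀ᵐ z ∂μ, ContinuousAt (fun x => G x z) x) :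
    Continuous fun x => c x * ∫ z, G x z ∂μ := by
  rw [continuous_iff_continuousAt]
  intro x
  by_cases hx : c x = 0
  · have hb : ∀ y, |∫ z, G y z ∂μ| ≤ μ.real Set.univ := by
      intro y
      have := norm_integral_le_of_norm_le_const (μ := μ) (f := G y) (C := 1)
        (Filter.Eventually.of_forall fun z => hG1 y z)
      simpa using this
    change Filter.Tendsto _ _ (nhds (c x * ∫ z, G x z ∂μ))
    rw [hx, zero_mul]
    have h1 : Filter.Tendsto (fun y => |c y| * μ.real Set.univ) (nhds x) (nhds 0) := by
      have : Continuous fun y => |c y| * μ.real Set.univ := by fun_prop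
      have h2 := this.tendsto x
      simpa [hx] using h2
    apply squeeze_zero_norm (fun y => ?_) h1
    rw [norm_mul]
    exact mul_le_mul_of_nonneg_left (hb y) (abs_nonneg _)
  · apply ContinuousAt.mul hc.continuousAt
    apply continuousAt_of_dominated (bound := fun _ => 1)
    · exact Filter.Eventually.of_forall fun y => (hG y).aestronglyMeasurable
    · exact Filter.Eventually.of_forall fun y => Filter.Eventually.of_forall fun z => hG1 y z
    · exact integrable_const _
    · exact hG2 x hx

variable {n : ℕ}

/-- normal vector part -/
def av (hd : d < n) (v : Fin n → ℝ) : EuclideanSpace ℝ (Fin d) :=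
  WithLp.toLp 2 fun c : Fin d => v ⟨c.1, c.2.trans hd⟩

/-- offset part -/
def bv (hd : d < n) (v : Fin n → ℝ) : ℝ := v ⟨n - 1, by omega⟩

variable (hd : d < n)

/-- side function -/
def sd (v : Fin n → ℝ) (x : EuclideanSpace ℝ (Fin d)) : ℝ := Real.sign (bv hd v - ⟪av hd v, x⟫)

/-- size -/
def nrm (v : Fin n → ℝ) : ℝ := ‖av hd v‖ + |bv hd v|

theorem av_continuous : Continuous (av hd) := by
  unfold av
  exact (PiLp.continuous_toLp 2 _).comp (by fun_prop)

theorem av_neg (v : Fin n → ℝ) : av hd (-v) = - av hd v := by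
  ext c; simp [av]

theorem bv_continuous : Continuous (bv hd) := by unfold bv; fun_prop

theorem nrm_continuous : Continuous (nrm hd) := by
  have := av_continuous hd
  have := bv_continuous hd
  unfold nrm; fun_prop

theorem nrm_neg (v : Fin n → ℝ) : nrm hd (-v) = nrm hd v := by
  unfold nrm; rw [av_neg]; simp [bv]

theorem sd_neg (v : Fin n → ℝ) (x) : sd hd (-v) x = - sd hd v x := by
  unfold sd; rw [av_neg, ← Real.sign_neg]
  congr 1
  rw [inner_neg_left]; simp only [bv, Pi.neg_apply]; ring

theorem sd_measurable (v : Fin n → ℝ) : Measurable (sd hd v) := by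
  unfold sd
  apply measurable_rsign.comp
  fun_prop

theorem sd_abs (v : Fin n → ℝ) (x) : |sd hd v x| ≤ 1 := abs_rsign_le _

theorem ae_ne {μ : Measure (EuclideanSpace ℝ (Fin d))} (hac : μ ≪ volume) (v : Fin n → ℝ)
    (hv : nrm hd v ≠ 0) : ∀ᵐ x ∂μ, bv hd v - ⟪av hd v, x⟫ ≠ 0 := by
  have h : ∀ᵐ x ∂(volume : Measure (EuclideanSpace ℝ (Fin d))), bv hd v - ⟪av hd v, x⟫ ≠ 0 := by
    rw [ae_iff]
    simp only [ne_eq, not_not]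
    exact hyper_null _ _ hv
  exact hac.ae_le h

theorem sd_cont {μ : Measure (EuclideanSpace ℝ (Fin d))} (hac : μ ≪ volume) (v : Fin n → ℝ)
    (hv : nrm hd v ≠ 0) : ∀ᵐ x ∂μ, ContinuousAt (fun v => sd hd v x) v := by
  filter_upwards [ae_ne hd hac v hv] with x hx
  unfold sd
  have h1 : ContinuousAt (fun v => bv hd v - ⟪av hd v, x⟫) v := by
    have := av_continuous hd
    have := bv_continuous hd
    fun_prop
  exact ContinuousAt.comp (g := Real.sign) (f := fun v => bv hd v - ⟪av hd v, x⟫)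
    (continuousAt_rsign hx) h1

/-- one-plane functional -/
def UU (μ : Measure (EuclideanSpace ℝ (Fin d))) (v : Fin n → ℝ) : ℝ :=
  nrm hd v * ∫ x, sd hd v x ∂μ

/-- two-plane functional -/
def HH (μ : Measure (EuclideanSpace ℝ (Fin d))) (v w : Fin n → ℝ) : ℝ :=
  (nrm hd v * nrm hd w) * ∫ x, sd hd v x * sd hd w x ∂μ

theorem UU_cont (μ : Measure (EuclideanSpace ℝ (Fin d))) [IsFiniteMeasure μ] (hac : μ ≪ volume) :
    Continuous (UU hd μ) :=
  param_cont μ (nrm hd) (nrm_continuous hd) (sd hd) (sd_measurable hd) (sd_abs hd)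
    (fun v hv => sd_cont hd hac v hv)

theorem HH_cont (μ : Measure (EuclideanSpace ℝ (Fin d))) [IsFiniteMeasure μ] (hac : μ ≪ volume) :
    Continuous fun p : (Fin n → ℝ) × (Fin n → ℝ) => HH hd μ p.1 p.2 := by
  refine param_cont μ (fun p : (Fin n → ℝ) × (Fin n → ℝ) => nrm hd p.1 * nrm hd p.2) ?_
    (fun p x => sd hd p.1 x * sd hd p.2 x) ?_ ?_ ?_
  · exact ((nrm_continuous hd).comp continuous_fst).mul ((nrm_continuous hd).comp continuous_snd)
  · exact fun p => (sd_measurable hd _).mul (sd_measurable hd _)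
  · intro p x
    rw [abs_mul]
    exact mul_le_one₀ (sd_abs hd _ _) (abs_nonneg _) (sd_abs hd _ _)
  · intro p hp
    have hp1 := left_ne_zero_of_mul hp
    have hp2 := right_ne_zero_of_mul hp
    filter_upwards [sd_cont hd hac p.1 hp1, sd_cont hd hac p.2 hp2] with x h1 h2
    exact ContinuousAt.mul (ContinuousAt.comp (g := fun v => sd hd v x) h1 continuousAt_fst)
      (ContinuousAt.comp (g := fun v => sd hd v x) h2 continuousAt_snd)

theorem UU_neg (μ : Measure (EuclideanSpace ℝ (Fin d))) (v : Fin n → ℝ) :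
    UU hd μ (-v) = - UU hd μ v := by
  unfold UU
  simp only [nrm_neg, sd_neg, integral_neg]; ring

theorem HH_neg (μ : Measure (EuclideanSpace ℝ (Fin d))) (v w : Fin n → ℝ) :
    HH hd μ (-v) w = - HH hd μ v w := by
  unfold HH
  simp only [nrm_neg, sd_neg, neg_mul, integral_neg]; ring

theorem HH_symm (μ : Measure (EuclideanSpace ℝ (Fin d))) (v w : Fin n → ℝ) :
    HH hd μ v w = HH hd μ w v := by
  unfold HH
  simp only [mul_comm]

theorem UU_of_zero (μ : Measure (EuclideanSpace ℝ (Fin d))) (v : Fin n → ℝ) (ha : av hd v = 0) :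
    UU hd μ v = bv hd v * μ.real Set.univ := by
  unfold UU nrm sd
  simp only [ha, inner_zero_left, sub_zero, norm_zero, zero_add, integral_const, smul_eq_mul]
  rcases lt_trichotomy (bv hd v) 0 with h | h | h
  · rw [Real.sign_of_neg h, abs_of_neg h]; ring
  · rw [h]; simp
  · rw [Real.sign_of_pos h, abs_of_pos h]; ring

end
end

section
variable {d n : ℕ} (hd : d < n)

theorem halfSpace_meas (a : EuclideanSpace ℝ (Fin d)) (b : ℝ) (ε : Bool) :
    MeasurableSet (halfSpace a b ε) := by
  unfold halfSpace
  split_ifs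
  · exact (isClosed_le continuous_const (by fun_prop)).measurableSet
  · exact (isClosed_le (by fun_prop) continuous_const).measurableSet

/-- sign of a side -/
def esg (ε : Bool) : ℝ := if ε then -1 else 1

theorem half_ind (v : Fin n → ℝ) (ε : Bool) (x : EuclideanSpace ℝ (Fin d))
    (hx : bv hd v - ⟪av hd v, x⟫ ≠ 0) :
    (halfSpace (av hd v) (bv hd v) ε).indicator (fun _ => (1 : ℝ)) x = (1 + esg ε * sd hd v x) / 2 := by
  unfold sd halfSpace esg
  rcases lt_or_gt_of_ne hx with h | h
  · rw [Real.sign_of_neg h]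
    cases ε
    · rw [Set.indicator_of_notMem]
      · norm_num
      · simp; linarith
    · rw [Set.indicator_of_mem]
      · norm_num
      · simp; linarith
  · rw [Real.sign_of_pos h]
    cases ε
    · rw [Set.indicator_of_mem]
      · norm_num
      · simp; linarith
    · rw [Set.indicator_of_notMem]
      · norm_num
      · simp; linarith

theorem quarter (μ : Measure (EuclideanSpace ℝ (Fin d))) [IsFiniteMeasure μ] (hac : μ ≪ volume)
    (v w : Fin n → ℝ) (hv : nrm hd v ≠ 0) (hw : nrm hd w ≠ 0)
    (h1 : UU hd μ v = 0) (h2 : UU hd μ w = 0) (h3 : HH hd μ v w = 0) (ε ε' : Bool) :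
    μ (halfSpace (av hd v) (bv hd v) ε ∩ halfSpace (av hd w) (bv hd w) ε') = μ Set.univ / 2 ^ 2 := by
  have i1 : ∫ x, sd hd v x ∂μ = 0 := (mul_eq_zero.1 h1).resolve_left hv
  have i2 : ∫ x, sd hd w x ∂μ = 0 := (mul_eq_zero.1 h2).resolve_left hw
  have i3 : ∫ x, sd hd v x * sd hd w x ∂μ = 0 := (mul_eq_zero.1 h3).resolve_left (mul_ne_zero hv hw)
  have b1 : Integrable (sd hd v) μ := Integrable.of_bound (sd_measurable hd v).aestronglyMeasurable 1
    (Filter.Eventually.of_forall fun x => sd_abs hd v x)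
  have b2 : Integrable (sd hd w) μ := Integrable.of_bound (sd_measurable hd w).aestronglyMeasurable 1
    (Filter.Eventually.of_forall fun x => sd_abs hd w x)
  have b3 : Integrable (fun x => sd hd v x * sd hd w x) μ :=
    Integrable.of_bound ((sd_measurable hd v).mul (sd_measurable hd w)).aestronglyMeasurable 1
    (Filter.Eventually.of_forall fun x => by
      rw [norm_mul]
      exact mul_le_one₀ (sd_abs hd _ _) (abs_nonneg _) (sd_abs hd _ _))
  set A := halfSpace (av hd v) (bv hd v) ε ∩ halfSpace (av hd w) (bv hd w) ε' with hA
  have mA : MeasurableSet A := (halfSpace_meas _ _ _).inter (halfSpace_meas _ _ _)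
  have hreal : μ.real A = μ.real Set.univ / 4 := by
    have e1 : μ.real A = ∫ x, A.indicator (fun _ => (1 : ℝ)) x ∂μ := by
      rw [integral_indicator_const _ mA]; simp
    have e2 : ∫ x, A.indicator (fun _ => (1 : ℝ)) x ∂μ =
        ∫ x, (1 / 4 + esg ε / 4 * sd hd v x + esg ε' / 4 * sd hd w x +
          esg ε * esg ε' / 4 * (sd hd v x * sd hd w x)) ∂μ := by
      apply integral_congr_ae
      filter_upwards [ae_ne hd hac v hv, ae_ne hd hac w hw] with x hx hy
      have := Set.inter_indicator_mul (s := halfSpace (av hd v) (bv hd v) ε)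
        (t := halfSpace (av hd w) (bv hd w) ε') (fun _ => (1 : ℝ)) (fun _ => (1 : ℝ)) x
      simp only [mul_one] at this
      rw [hA, this, half_ind hd v ε x hx, half_ind hd w ε' x hy]
      ring
    rw [e1, e2, integral_add, integral_add, integral_add, integral_const_mul, integral_const_mul,
      integral_const_mul, i1, i2, i3]
    · simp; ring
    · exact integrable_const _
    · exact b1.const_mul _
    · exact (integrable_const _).add (b1.const_mul _)
    · exact b2.const_mul _
    · exact ((integrable_const _).add (b1.const_mul _)).add (b2.const_mul _)
    · exact b3.const_mul _
  rw [← ENNReal.toReal_eq_toReal_iff' (measure_ne_top _ _)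
    (ENNReal.div_ne_top (measure_ne_top _ _) (by norm_num))]
  rw [ENNReal.toReal_div]
  change μ.real A = μ.real Set.univ / _
  rw [hreal]
  norm_num

end

section

theorem masses_main {q k B m d e : ℕ} (hk : 2 ≤ k) (hBq : B = 2 ^ q) (hm : m + (e + 1) = 2 * B)
    (he : e + 1 ≤ B)
    (hd : d + (e + 1) = B * (k + 1))
    (ν : Fin m → Measure (EuclideanSpace ℝ (Fin d))) (hfin : ∀ r, IsFiniteMeasure (ν r))
    (hac : ∀ r, ν r ≪ volume) (hne : ∀ r, ν r ≠ 0) :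
    ∃ (a : Fin k → EuclideanSpace ℝ (Fin d)) (b : Fin k → ℝ),
      (∀ i, a i ≠ 0) ∧
      (∀ i j, i ≠ j → ⟪a i, a j⟫ = (0 : ℝ)) ∧
      ∀ r : Fin m, ∀ s : Finset (Fin k), s.card = 2 → ∀ ε : Fin k → Bool,
        ν r (region a b s ε) = ν r Set.univ / 2 ^ 2 := by
  classical
  have hB : 1 ≤ B := by omega
  have hkB : 2 * B ≤ k * B := Nat.mul_le_mul_right _ hk
  have hkB' : B * (k + 1) = k * B + B := by ring
  have hdn : d < d + e + 1 := by omega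
  let u : Fin (e + m) → (Fin (d + e + 1) → ℝ) → ℝ := fun l v =>
    if hl : l.1 < e then v ⟨d + l.1, by omega⟩ else UU hdn (ν ⟨l.1 - e, by omega⟩) v
  let h : Fin (2 * B) → (Fin (d + e + 1) → ℝ) → (Fin (d + e + 1) → ℝ) → ℝ := fun r v w =>
    if r.1 = 0 then ∑ c : Fin (d + e), v c.castSucc * w c.castSucc
    else if hr : r.1 - 1 < m then HH hdn (ν ⟨r.1 - 1, hr⟩) v w else 0
  have hmass : ∀ r, 0 < (ν r).real Set.univ := by
    intro r
    have := hfin r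
    rw [measureReal_def, ENNReal.toReal_pos_iff]
    exact ⟨by rw [Measure.measure_univ_pos]; exact hne r, measure_lt_top _ _⟩
  have hav0 : ∀ v : Fin (d + e + 1) → ℝ, (∀ c : Fin (d + e), v c.castSucc = 0) → av hdn v = 0 := by
    intro v hv
    ext c
    exact hv ⟨c.1, by omega⟩
  have hbv : ∀ v : Fin (d + e + 1) → ℝ, bv hdn v = v (Fin.last _) := fun v => rfl
  have hbne : ∀ v : Fin (d + e + 1) → ℝ, v ≠ 0 → (∀ c : Fin (d + e), v c.castSucc = 0) →
      bv hdn v ≠ 0 := by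
    intro v hv hc hb
    apply hv
    funext c
    induction c using Fin.lastCases with
    | last => exact hb
    | cast c => exact hc c
  obtain ⟨x, hx, H1, H2⟩ := top2 (q := q) (k := k) (B := B) (K := k * B) (D := k * B + 1 - B)
    (n' := d + e) (m1 := e + m) hk hBq rfl (by omega) (by omega) (by omega) u h
    (by
      intro r v w
      simp only [h]
      split_ifs
      · exact Finset.sum_congr rfl fun c _ => mul_comm _ _
      · exact HH_symm _ _ _ _
      · rfl)
    (by
      intro l
      simp only [u]
      split_ifs
      · fun_prop
      · have := hfin ⟨l.1 - e, by omega⟩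
        exact UU_cont hdn _ (hac _))
    (by
      intro r
      simp only [h]
      split_ifs with h1 h2
      · fun_prop
      · have := hfin ⟨r.1 - 1, h2⟩
        exact HH_cont hdn _ (hac _)
      · fun_prop)
    (by
      intro l v
      simp only [u]
      split_ifs
      · rfl
      · exact UU_neg _ _ _)
    (by
      intro r v w
      simp only [h]
      split_ifs
      · rw [← Finset.sum_neg_distrib]
        exact Finset.sum_congr rfl fun c _ => by simp
      · exact HH_neg _ _ _ _
      · simp)
    ⟨0, by omega⟩ rfl
    (by
      intro v
      simp only [h, if_true]
      exact Finset.sum_nonneg fun c _ => mul_self_nonneg _)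
    (by
      intro v hv hvv s hs0 hs1
      simp only [h, if_true] at hvv
      have hc : ∀ c : Fin (d + e), v c.castSucc = 0 := fun c =>
        mul_self_eq_zero.1 ((Finset.sum_eq_zero_iff_of_nonneg (fun c _ => mul_self_nonneg _)).1 hvv c
          (Finset.mem_univ _))
      refine ⟨⟨e + m - 1, by omega⟩, ?_⟩
      have hidx : (⟨k * B + 1 - B + (e + m - 1), by omega⟩ : Fin (d + e + 1)) = Fin.last _ :=
        Fin.ext (by simp only [Fin.val_last]; omega)
      have h1 : ¬ e + m - 1 < e := by omega
      simp only [hidx, u, h1, dif_neg, not_false_eq_true]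
      rw [UU_of_zero hdn _ v (hav0 v hc), hbv]
      have hb := hbne v hv hc
      rw [hbv] at hb
      have h2 := hmass ⟨e + m - 1 - e, by omega⟩
      have h3 : 0 < (1 - s) + s * (ν ⟨e + m - 1 - e, by omega⟩).real Set.univ := by
        have := mul_pos hs0 h2
        linarith
      have h4 := mul_ne_zero hb h3.ne'
      intro h5
      apply h4
      linarith)
  have hv : ∀ i, row x i ≠ 0 := by
    intro i h
    obtain ⟨c, hc⟩ := hx.2 i
    have := congrFun h c
    simp only [row, Pi.zero_apply] at this
    rw [this] at hc; simp at hc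
  have hy : ∀ i (c : Fin e), row x i ⟨d + c.1, by omega⟩ = 0 := by
    intro i c
    have := H1 ⟨c.1, by omega⟩ i
    simp only [u, c.2, dif_pos] at this
    exact this
  have hU : ∀ i r, UU hdn (ν r) (row x i) = 0 := by
    intro i r
    have := H1 ⟨e + r.1, by omega⟩ i
    have h1 : ¬ e + r.1 < e := by omega
    have h2 : (⟨e + r.1 - e, by omega⟩ : Fin m) = r := Fin.ext (by simp only; omega)
    simp only [u, h1, dif_neg, not_false_eq_true, h2] at this
    exact this
  have hH : ∀ i j r, i ≠ j → HH hdn (ν r) (row x i) (row x j) = 0 := by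
    intro i j r hij
    have := H2 ⟨r.1 + 1, by omega⟩ i j hij
    simpa [h] using this
  have hane : ∀ i, av hdn (row x i) ≠ 0 := by
    intro i ha
    have h1 := hU i ⟨0, by omega⟩
    rw [UU_of_zero hdn _ _ ha] at h1
    have h2 := (mul_eq_zero.1 h1).resolve_right (hmass _).ne'
    refine hbne _ (hv i) ?_ h2
    intro c
    by_cases hc : c.1 < d
    · have := congrArg (fun w : EuclideanSpace ℝ (Fin d) => w ⟨c.1, hc⟩) ha
      exact this
    · have h3 := hy i ⟨c.1 - d, by omega⟩
      have h4 : (⟨d + (c.1 - d), by omega⟩ : Fin (d + e + 1)) = c.castSucc :=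
        Fin.ext (by simp only [Fin.val_castSucc]; omega)
      simp only [h4] at h3
      exact h3
  have hnrm : ∀ i, nrm hdn (row x i) ≠ 0 := by
    intro i
    have := norm_pos_iff.2 (hane i)
    unfold nrm
    have := abs_nonneg (bv hdn (row x i))
    linarith
  refine ⟨fun i => av hdn (row x i), fun i => bv hdn (row x i), hane, ?_, ?_⟩
  · intro i j hij
    have h1 := H2 ⟨0, by omega⟩ i j hij
    simp only [h, if_true] at h1
    rw [Fin.sum_univ_add] at h1
    have h2 : ∑ c : Fin e, row x i (Fin.natAdd d c).castSucc * row x j (Fin.natAdd d c).castSucc = 0 := by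
      apply Finset.sum_eq_zero
      intro c _
      have h3 : row x i (Fin.natAdd d c).castSucc = 0 := hy i c
      rw [h3, zero_mul]
    rw [h2, add_zero] at h1
    rw [← h1, PiLp.inner_apply]
    apply Finset.sum_congr rfl
    intro c _
    simp only [RCLike.inner_apply, conj_trivial]
    exact mul_comm _ _
  · intro r s hs ε
    obtain ⟨i, j, hij, rfl⟩ := Finset.card_eq_two.1 hs
    have := hfin r
    have h1 : region (fun i => av hdn (row x i)) (fun i => bv hdn (row x i)) {i, j} ε =
        halfSpace (av hdn (row x i)) (bv hdn (row x i)) (ε i) ∩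
        halfSpace (av hdn (row x j)) (bv hdn (row x j)) (ε j) := by
      unfold region
      simp
    rw [h1]
    exact quarter hdn (ν r) (hac r) _ _ (hnrm i) (hnrm j) (hU i r) (hU j r) (hH i j r hij) _ _

end

theorem stmt_2 (q t k : ℕ) (ht1 : 1 ≤ t) (ht2 : t ≤ 2 ^ q) (hk : 2 ≤ k)
    (m d : ℕ) (hm : m = 2 ^ (q + 1) - t) (hd : d = 2 ^ q * (k + 1) - t)
    (μ : Fin m → Measure (EuclideanSpace ℝ (Fin d)))
    (hfin : ∀ r, IsFiniteMeasure (μ r))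
    (hac : ∀ r, μ r ≪ volume) :
    ∃ (a : Fin k → EuclideanSpace ℝ (Fin d)) (b : Fin k → ℝ),
      (∀ i, a i ≠ 0) ∧
      (∀ i j, i ≠ j → ⟪a i, a j⟫ = (0 : ℝ)) ∧
      ∀ r : Fin m, ∀ s : Finset (Fin k), s.card = 2 → ∀ ε : Fin k → Bool,
        μ r (region a b s ε) = μ r Set.univ / 2 ^ 2 := by
  classical
  obtain ⟨e, rfl⟩ : ∃ e, t = e + 1 := ⟨t - 1, by omega⟩
  have hp : 2 ^ (q + 1) = 2 * 2 ^ q := by rw [pow_succ]; ring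
  have hle : 2 ^ q ≤ 2 ^ q * (k + 1) := Nat.le_mul_of_pos_right _ (by omega)
  let ν : Fin m → Measure (EuclideanSpace ℝ (Fin d)) := fun r =>
    if μ r = 0 then volume.restrict (Metric.ball 0 1) else μ r
  obtain ⟨a, b, h1, h2, h3⟩ := masses_main (q := q) (k := k) (B := 2 ^ q) (m := m) (d := d) (e := e)
    hk rfl (by omega) ht2 (by omega) ν
    (by
      intro r
      simp only [ν]
      split_ifs
      · exact ⟨by rw [Measure.restrict_apply_univ]; exact measure_ball_lt_top⟩
      · exact hfin r)
    (by
      intro r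
      simp only [ν]
      split_ifs
      · exact Measure.absolutelyContinuous_of_le Measure.restrict_le_self
      · exact hac r)
    (by
      intro r
      simp only [ν]
      split_ifs with h
      · rw [ne_eq, Measure.restrict_eq_zero]
        exact (Metric.measure_ball_pos volume _ one_pos).ne'
      · exact h)
  refine ⟨a, b, h1, h2, fun r s hs ε => ?_⟩
  by_cases h : μ r = 0
  · simp [h]
  · have := h3 r s hs ε
    simp only [ν, h, if_false] at this
    exact this
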